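/- arXiv:2605.15884 — 3 statements merged into one kernel-verified Lean document; each statement's English description precedes it below -/
import Mathlib

section
/- Let R be a Markov generator on n ≥ 3 states with maximum escape rate r, let λ be a nonreal eigenvalue of R, and let u be a left eigenvector (Rᵀu = λu) or a right eigenvector (Ru = λu) for λ. Then −2r < Re λ < 0, and for every τ ∈ [0,1] there exists a cycle c of R that is admissible for u, whose winding number w_c = ω_c(u) lies in {1, …, ⌈n_c/2⌉ − 1}, and which satisfies τ·(|Im λ|/(−Re λ))·tan(πw_c/n_c) + (1−τ)·(|Im λ|/(2r + Re λ))·cot(πw_c/n_c) ≤ tanh(F_c/(2n_c)). -/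
open Matrix Finset

/-- Wrapped frequency `|k|ₘ := min (k mod m) ((m - k) mod m)`. -/
def wrapIdx (m : ℕ) (k : ℤ) : ℤ :=
  min (k % (m : ℤ)) (((m : ℤ) - k) % (m : ℤ))

/-- A cycle of the generator `R`: a cyclic sequence of `len + 3 ≥ 3` distinct
states `vert t`, each consecutive pair joined by a transition with positive
rate (the edge `vert (t+1) ← vert t` requires `R (vert (t+1)) (vert t) > 0`). -/
structure MCycle (n : ℕ) (R : Matrix (Fin n) (Fin n) ℝ) where
  len : ℕ
  vert : ZMod (len + 3) → Fin n
  inj : Function.Injective vert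
  pos : ∀ t, 0 < R (vert (t + 1)) (vert t)

namespace MCycle

variable {n : ℕ} {R : Matrix (Fin n) (Fin n) ℝ}

/-- The number of states `n_c` in the cycle. -/
def size (c : MCycle n R) : ℕ := c.len + 3

/-- `tanh (F_c / 2n_c)` where `F_c = ∑ ln (R_{ji}/R_{ij})` is the cycle
affinity; equal to `1` when `F_c = ∞` (some reverse rate vanishes). -/
noncomputable def tanhAff (c : MCycle n R) : ℝ :=
  open Classical in
  if ∀ t, 0 < R (c.vert t) (c.vert (t + 1)) then
    Real.tanh ((∑ t : ZMod (c.len + 3),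
        Real.log (R (c.vert (t + 1)) (c.vert t) / R (c.vert t) (c.vert (t + 1)))) /
      (2 * (c.len + 3)))
  else 1

/-- The cycle affinity is positive, `F_c > 0` (automatic when `F_c = ∞`,
i.e. when some reverse rate vanishes). -/
def affPos (c : MCycle n R) : Prop :=
  (∀ t, 0 < R (c.vert t) (c.vert (t + 1))) →
    0 < ∑ t : ZMod (c.len + 3),
      Real.log (R (c.vert (t + 1)) (c.vert t) / R (c.vert t) (c.vert (t + 1)))

/-- The cycle `c` is admissible for `u`: `u` is nonzero on the vertices of `c`
and the edge ratios all lie in a common open half-plane of `ℂ`. -/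
def Admissible (c : MCycle n R) (u : Fin n → ℂ) : Prop :=
  (∀ t, u (c.vert t) ≠ 0) ∧
  ∃ z : ℂ, ∀ t, 0 < ((starRingEnd ℂ) z * (u (c.vert (t + 1)) / u (c.vert t))).re

/-- The branch parameter `φ  = Arg ∑ exp (i Arg (u_j/u_i))` determined by the
average phase vector of the edge ratios of `u` along `c`. -/
noncomputable def branchPhi (c : MCycle n R) (u : Fin n → ℂ) : ℝ :=
  Complex.arg (∑ t : ZMod (c.len + 3),
    Complex.exp (Complex.I * (Complex.arg (u (c.vert (t + 1)) / u (c.vert t)) : ℂ)))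

/-- The winding number `ω_c(u) = |(1/2π) ∑ arg_φ (u_j/u_i)|_{n_c}`, where
`arg_φ z := Arg (exp (-iφ) z) + φ` (the sum divided by `2π` is an integer
whenever the cycle is admissible for `u`). -/
noncomputable def winding (c : MCycle n R) (u : Fin n → ℂ) : ℤ :=
  wrapIdx (c.len + 3) (round ((∑ t : ZMod (c.len + 3),
    (Complex.arg (Complex.exp (-(Complex.I * (c.branchPhi u : ℂ))) *
        (u (c.vert (t + 1)) / u (c.vert t))) + c.branchPhi u)) / (2 * Real.pi)))

end MCycle


open Real in
/-- A refinement of `sin x ≤ x` in the reverse direction. -/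
lemma le_sin_mul_two_sub_cos {b : ℝ} (h0 : 0 ≤ b) (h1 : b ≤ π / 2) :
    b ≤ sin b * (2 - cos b) := by
  have hmono : MonotoneOn (fun x : ℝ => sin x * (2 - cos x) - x) (Set.Icc 0 (π / 2)) := by
    apply monotoneOn_of_deriv_nonneg (convex_Icc _ _)
    · fun_prop
    · fun_prop
    · intro x hx
      rw [interior_Icc] at hx
      have hd : HasDerivAt (fun x : ℝ => sin x * (2 - cos x) - x)
          (cos x * (2 - cos x) + sin x * (0 - (-sin x)) - 1) x :=
        ((hasDerivAt_sin x).mul ((hasDerivAt_const x 2).sub (hasDerivAt_cos x))).sub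
          (hasDerivAt_id x)
      rw [hd.deriv]
      have hc : 0 ≤ cos x := cos_nonneg_of_mem_Icc ⟨by linarith [hx.1, pi_pos], hx.2.le⟩
      nlinarith [sin_sq_add_cos_sq x, cos_le_one x]
  have := hmono ⟨le_refl _, by positivity⟩ ⟨h0, h1⟩ h0
  simp at this
  linarith

open Real in
lemma abs_le_sqrt_geom {σ δ : ℝ} (hδ : |δ| ≤ σ) (m b : ℝ) :
    |σ * cos b - δ * cos m| ≤
      √((σ - δ * cos (m - b)) * (σ - δ * cos (m + b))) := by
  apply abs_le_sqrt
  have h1 : δ ^ 2 ≤ σ ^ 2 := by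
    rw [← sq_abs δ]; exact pow_le_pow_left₀ (abs_nonneg _) hδ 2
  rw [cos_sub, cos_add]
  have hm := sin_sq_add_cos_sq m
  have hb := sin_sq_add_cos_sq b
  have hid : (σ - δ * (cos m * cos b + sin m * sin b)) *
      (σ - δ * (cos m * cos b - sin m * sin b)) - (σ * cos b - δ * cos m) ^ 2
      = (σ ^ 2 - δ ^ 2) * sin b ^ 2 := by
    have e1 : sin m ^ 2 = 1 - cos m ^ 2 := by linarith
    have e2 : sin b ^ 2 = 1 - cos b ^ 2 := by linarith
    ring_nf
    rw [e1, e2]; ring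
  nlinarith [mul_nonneg (sub_nonneg.2 h1) (sq_nonneg (sin b))]

open Real in
/-- The tangent-line inequality follows from its version minimised over `t`. -/
lemma edge_bound_of_geom {σ δ θ θ₀ t : ℝ} (hQ : 0 ≤ σ - δ * cos θ) (hQ₀ : 0 < σ - δ * cos θ₀)
    (ht : 0 < t)
    (h : (σ - δ * cos θ₀) * (sin θ + sin θ₀) - (σ * cos θ₀ - δ) * (θ - θ₀) ≤
      2 * sin θ₀ * √((σ - δ * cos θ) * (σ - δ * cos θ₀))) :
    sin θ - (σ - δ * cos θ) / t ≤ (σ * cos θ₀ - δ) / (σ - δ * cos θ₀) * (θ - θ₀) +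
      sin θ₀ ^ 2 / (σ - δ * cos θ₀) * t - sin θ₀ := by
  set Q := σ - δ * cos θ
  set Q₀ := σ - δ * cos θ₀
  set S := sin θ₀
  set w := √(Q * Q₀)
  have hw : w ^ 2 = Q * Q₀ := sq_sqrt (by positivity)
  have key : 2 * S * w ≤ Q * Q₀ / t + S ^ 2 * t := by
    have : Q * Q₀ / t + S ^ 2 * t - 2 * S * w = (w - S * t) ^ 2 / t := by
      rw [← hw]; field_simp; ring
    have h2 : 0 ≤ (w - S * t) ^ 2 / t := by positivity
    linarith
  have : 0 ≤ (Q * Q₀ / t + S ^ 2 * t - (Q₀ * (sin θ + S) - (σ * cos θ₀ - δ) * (θ - θ₀))) / Q₀ :=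
    div_nonneg (by linarith) hQ₀.le
  have e : (Q * Q₀ / t + S ^ 2 * t - (Q₀ * (sin θ + S) - (σ * cos θ₀ - δ) * (θ - θ₀))) / Q₀ =
      (σ * cos θ₀ - δ) / Q₀ * (θ - θ₀) + S ^ 2 / Q₀ * t - S - (sin θ - Q / t) := by
    field_simp; ring
  linarith

open Real in
lemma geom_bound_of_nonneg {σ δ θ θ₀ : ℝ} (hδ : |δ| ≤ σ)
    (hθ₀ : θ₀ < π) (hθ : 0 ≤ θ) (hle : θ ≤ θ₀) (hC : 0 ≤ σ * cos θ₀ - δ) :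
    (σ - δ * cos θ₀) * (sin θ + sin θ₀) - (σ * cos θ₀ - δ) * (θ - θ₀) ≤
      2 * sin θ₀ * √((σ - δ * cos θ) * (σ - δ * cos θ₀)) := by
  obtain ⟨m, b, rfl, rfl⟩ : ∃ m b, θ = m - b ∧ θ₀ = m + b :=
    ⟨(θ₀ + θ) / 2, (θ₀ - θ) / 2, by ring, by ring⟩
  have hb : 0 ≤ b := by linarith
  have hmb : b ≤ m := by linarith
  have hS : 0 ≤ sin (m + b) := sin_nonneg_of_nonneg_of_le_pi (by linarith) hθ₀.le
  have hg := le_trans (le_abs_self _) (abs_le_sqrt_geom hδ m b)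
  refine le_trans ?_ (mul_le_mul_of_nonneg_left hg (by positivity))
  have hσδ := abs_le.1 hδ
  have hK : 0 < 1 + cos (m + b) := by
    rcases eq_or_lt_of_le (by linarith : 0 ≤ m + b) with h | h
    · rw [← h]; norm_num
    have : -1 < cos (m + b) := by
      rw [← cos_pi]; exact cos_lt_cos_of_nonneg_of_le_pi h.le le_rfl hθ₀
    linarith
  have hsm : 0 ≤ sin m := sin_nonneg_of_nonneg_of_le_pi (by linarith) (by linarith)
  have hsb : 0 ≤ sin b := sin_nonneg_of_nonneg_of_le_pi (by linarith) (by linarith)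
  have hsmb : sin b ≤ sin m := by
    have : sin m - sin b = 2 * sin ((m - b) / 2) * cos ((m + b) / 2) := sin_sub_sin m b
    have h1 : 0 ≤ sin ((m - b) / 2) := sin_nonneg_of_nonneg_of_le_pi (by linarith) (by linarith)
    have h2 : 0 ≤ cos ((m + b) / 2) := cos_nonneg_of_mem_Icc ⟨by linarith, by linarith⟩
    nlinarith [mul_nonneg h1 h2]
  have hcusa := le_sin_mul_two_sub_cos hb (by linarith)
  have hcb := cos_le_one b
  set K := cos (m + b) with hKd
  set S := sin (m + b) with hSd
  have hmS : K * cos m + S * sin m = cos b := by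
    rw [hKd, hSd, ← cos_sub]; ring_nf
  have i2 : S * (cos b + cos m) = (1 + K) * (sin m + sin b) := by
    have e1 : S * cos b - K * sin b = sin m := by rw [hKd, hSd, ← sin_sub]; ring_nf
    have e2 : S * cos m - K * sin m = sin b := by rw [hKd, hSd, ← sin_sub]; ring_nf
    linear_combination e1 + e2
  have hid : (σ - δ * K) * (sin (m - b) + S) =
      2 * S * (cos b * (σ * cos b - δ * cos m)) - (σ * K - δ) * (2 * sin b * cos b) := by
    rw [hKd, hSd, sin_sub, sin_add, cos_add]
    have hm := sin_sq_add_cos_sq m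
    have hb := sin_sq_add_cos_sq b
    have e1 : sin m ^ 2 = 1 - cos m ^ 2 := by linarith
    have e2 : sin b ^ 2 = 1 - cos b ^ 2 := by linarith
    ring_nf
    simp only [e1, e2, pow_succ, pow_zero, one_mul]
    ring_nf
  have A1 : 0 ≤ 2 * S * (1 - cos b) * (cos b - K * cos m) := by
    have : cos b - K * cos m = S * sin m := by linarith
    rw [this]
    have : 0 ≤ 1 - cos b := by linarith
    positivity
  have A2 : (1 + K) * (2 * b - 2 * sin b * cos b) ≤ 2 * S * (1 - cos b) * (cos b + cos m) := by
    have : 2 * S * (1 - cos b) * (cos b + cos m) =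
        (1 + K) * (2 * (1 - cos b) * (sin m + sin b)) := by linear_combination 2 * (1 - cos b) * i2
    rw [this]
    apply mul_le_mul_of_nonneg_left _ hK.le
    nlinarith
  have hμ1 : 0 ≤ (σ * K - δ) / (1 + K) := div_nonneg hC hK.le
  have hμ2 : 0 ≤ (σ + δ) / (1 + K) := div_nonneg (by linarith) hK.le
  have B1 := mul_le_mul_of_nonneg_left A2 hμ1
  have B2 := mul_nonneg hμ2 A1
  have s1 : (σ * K - δ) / (1 + K) * ((1 + K) * (2 * b - 2 * sin b * cos b)) =
      (σ * K - δ) * (2 * b - 2 * sin b * cos b) := by field_simp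
  have s2 : (σ * K - δ) / (1 + K) * (2 * S * (1 - cos b) * (cos b + cos m)) +
      (σ + δ) / (1 + K) * (2 * S * (1 - cos b) * (cos b - K * cos m)) =
      2 * S * (1 - cos b) * (σ * cos b - δ * cos m) := by field_simp; ring
  nlinarith

open Real in
lemma geom_bound_of_mul_nonneg {σ δ θ θ₀ : ℝ} (hδ : |δ| ≤ σ) (hS : 0 ≤ sin θ₀)
    (hle : θ ≤ θ₀) (hC : σ * cos θ₀ - δ ≤ 0) :
    (σ - δ * cos θ₀) * (sin θ + sin θ₀) - (σ * cos θ₀ - δ) * (θ - θ₀) ≤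
      2 * sin θ₀ * √((σ - δ * cos θ) * (σ - δ * cos θ₀)) := by
  obtain ⟨m, b, rfl, rfl⟩ : ∃ m b, θ = m - b ∧ θ₀ = m + b :=
    ⟨(θ₀ + θ) / 2, (θ₀ - θ) / 2, by ring, by ring⟩
  have hg := abs_le_sqrt_geom hδ m b
  have hg' : cos b * (σ * cos b - δ * cos m) ≤
      √((σ - δ * cos (m - b)) * (σ - δ * cos (m + b))) := by
    refine le_trans (le_abs_self _) ?_
    rw [abs_mul]
    nlinarith [abs_cos_le_one b, abs_nonneg (σ * cos b - δ * cos m)]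
  refine le_trans ?_ (mul_le_mul_of_nonneg_left hg' (by positivity))
  have hid : (σ - δ * cos (m + b)) * (sin (m - b) + sin (m + b)) =
      2 * sin (m + b) * (cos b * (σ * cos b - δ * cos m)) -
        (σ * cos (m + b) - δ) * (2 * sin b * cos b) := by
    rw [sin_sub, sin_add, cos_add]
    have hm := sin_sq_add_cos_sq m
    have hb := sin_sq_add_cos_sq b
    have e1 : sin m ^ 2 = 1 - cos m ^ 2 := by linarith
    have e2 : sin b ^ 2 = 1 - cos b ^ 2 := by linarith
    ring_nf
    simp only [e1, e2, pow_succ, pow_zero, one_mul]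
    ring_nf
  have hs : 2 * sin b * cos b ≤ 2 * b := by
    rw [← sin_two_mul]; exact sin_le (by linarith)
  nlinarith [mul_nonneg (neg_nonneg.2 hC) (sub_nonneg.2 hs)]

open Real in
lemma le_tan_of_nonneg {φ : ℝ} (h0 : 0 ≤ φ) (h1 : φ < π / 2) : φ ≤ tan φ := by
  rcases eq_or_lt_of_le h0 with h | h
  · simp [← h]
  · exact (lt_tan h h1).le

open Real in
lemma edge_bound_left {σ δ θ θ₀ t : ℝ} (hσ : 0 < σ) (hδ : |δ| ≤ σ) (hθ₀ : 0 < θ₀)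
    (hθ₀' : θ₀ < π) (ht : 0 < t) (ht1 : t ≤ 1) (hθ : -(π / 2) < θ)
    (hκ : 0 ≤ sin θ + δ * cos θ) (hle : θ ≤ θ₀) :
    sin θ - (σ - δ * cos θ) / t ≤ (σ * cos θ₀ - δ) / (σ - δ * cos θ₀) * (θ - θ₀) +
      sin θ₀ ^ 2 / (σ - δ * cos θ₀) * t - sin θ₀ := by
  have hσδ := abs_le.1 hδ
  have hS : 0 < sin θ₀ := sin_pos_of_pos_of_lt_pi hθ₀ hθ₀'
  have hQ : ∀ x, 0 ≤ σ - δ * cos x := by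
    intro x
    have : |δ * cos x| ≤ σ := by
      rw [abs_mul]; nlinarith [abs_cos_le_one x, abs_nonneg δ, abs_nonneg (cos x)]
    linarith [(abs_le.1 this).2]
  have hQ₀ : 0 < σ - δ * cos θ₀ := by
    have h1 : |cos θ₀| < 1 := by
      rw [← sq_lt_one_iff_abs_lt_one]; nlinarith [sin_sq_add_cos_sq θ₀]
    have : |δ * cos θ₀| < σ := by
      rw [abs_mul]; nlinarith [abs_nonneg δ, abs_nonneg (cos θ₀)]
    linarith [(abs_le.1 this.le).2, (abs_lt.1 this).2]
  rcases le_or_gt (σ * cos θ₀ - δ) 0 with hC | hC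
  · exact edge_bound_of_geom (hQ _) hQ₀ ht (geom_bound_of_mul_nonneg hδ hS.le hle hC)
  rcases le_or_gt 0 θ with h0 | h0
  · exact edge_bound_of_geom (hQ _) hQ₀ ht (geom_bound_of_nonneg hδ hθ₀' h0 hle hC.le)
  have hz := edge_bound_of_geom (hQ 0) hQ₀ ht
    (geom_bound_of_nonneg hδ hθ₀' le_rfl hθ₀.le hC.le)
  obtain ⟨φ, rfl⟩ : ∃ φ, θ = -φ := ⟨-θ, by ring⟩
  rw [sin_neg, cos_neg] at *
  have hφ : 0 < φ := by linarith
  have hcos : 0 < cos φ := cos_pos_of_mem_Ioo ⟨by linarith, by linarith⟩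
  have hsin : 0 < sin φ := sin_pos_of_pos_of_lt_pi hφ (by linarith)
  have htan := le_tan_of_nonneg hφ.le (by linarith)
  have hδtan : tan φ ≤ δ := by
    rw [tan_eq_sin_div_cos, div_le_iff₀ hcos]; linarith
  have hδ0 : 0 ≤ δ := by linarith
  have hCle : (σ * cos θ₀ - δ) / (σ - δ * cos θ₀) ≤ 1 := by
    rw [div_le_one hQ₀]
    nlinarith [cos_le_one θ₀]
  set C := (σ * cos θ₀ - δ) / (σ - δ * cos θ₀)
  simp only [sin_zero, cos_zero, mul_one, zero_sub] at hz
  have h1 : δ * (1 - cos φ) ≤ (δ * (1 - cos φ)) / t := by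
    rw [le_div_iff₀ ht]
    have : 0 ≤ δ * (1 - cos φ) := mul_nonneg hδ0 (by linarith [cos_le_one φ])
    nlinarith
  have h2 : (σ - δ * cos φ) / t = (σ - δ) / t + (δ * (1 - cos φ)) / t := by
    field_simp; ring
  have h3 : tan φ * cos φ = sin φ := tan_mul_cos hcos.ne'
  have h4 : tan φ * (1 - cos φ) ≤ δ * (1 - cos φ) :=
    mul_le_mul_of_nonneg_right hδtan (by linarith [cos_le_one φ])
  have h5 : C * φ ≤ φ := by nlinarith
  rw [h2]
  have h6 : -((σ - δ) / t) = -(σ - δ) / t := by ring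
  have h7 : C * (-φ - θ₀) = -(C * φ) - C * θ₀ := by ring
  have h8 : C * -θ₀ = -(C * θ₀) := by ring
  linarith

open Real in
/-- Tangent-line bound for the contribution of one edge with phase `θ` and asymmetry `t`. -/
lemma edge_bound {σ δ θ θ₀ t : ℝ} (hσ : 0 < σ) (hδ : |δ| ≤ σ) (hθ₀ : 0 < θ₀)
    (hθ₀' : θ₀ < π) (ht : 0 < t) (ht1 : t ≤ 1) (hθ : -(π / 2) < θ) (hθ' : θ < 3 * π / 2)
    (hκ : 0 ≤ sin θ + δ * cos θ) :
    sin θ - (σ - δ * cos θ) / t ≤ (σ * cos θ₀ - δ) / (σ - δ * cos θ₀) * (θ - θ₀) +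
      sin θ₀ ^ 2 / (σ - δ * cos θ₀) * t - sin θ₀ := by
  rcases le_total θ θ₀ with h | h
  · exact edge_bound_left hσ hδ hθ₀ hθ₀' ht ht1 hθ hκ h
  have := edge_bound_left (δ := -δ) (θ := π - θ) (θ₀ := π - θ₀) (t := t) hσ (by rwa [abs_neg])
    (by linarith) (by linarith) ht ht1 (by linarith)
    (by rw [sin_pi_sub, cos_pi_sub]; linarith) (by linarith)
  simp only [sin_pi_sub, cos_pi_sub] at this
  have e : (σ * -cos θ₀ - -δ) / (σ - -δ * -cos θ₀) * (π - θ - (π - θ₀)) =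
      (σ * cos θ₀ - δ) / (σ - δ * cos θ₀) * (θ - θ₀) := by
    rw [neg_mul_neg, show σ * -cos θ₀ - -δ = -(σ * cos θ₀ - δ) by ring]; ring
  rw [e] at this
  simpa using this

open Real in
lemma ConcaveOn.sum_le_card_mul {τ : Type*} [Fintype τ] [Nonempty τ] {s : Set ℝ} {g : ℝ → ℝ}
    (hg : ConcaveOn ℝ s g) (x : τ → ℝ) (hx : ∀ e, x e ∈ s) :
    ∑ e, g (x e) ≤ Fintype.card τ * g ((∑ e, x e) / Fintype.card τ) := by
  have hN : (0 : ℝ) < Fintype.card τ := by exact_mod_cast Fintype.card_pos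
  have h := hg.le_map_sum (t := Finset.univ) (w := fun _ : τ => (1 : ℝ) / Fintype.card τ) (p := x)
    (fun _ _ => by positivity) (by simp) (fun e _ => hx e)
  simp only [smul_eq_mul, ← Finset.mul_sum] at h
  rw [one_div_mul_eq_div, one_div_mul_eq_div, div_le_iff₀ hN] at h
  linarith

open Real in
lemma concaveOn_tanh : ConcaveOn ℝ (Set.Ici 0) tanh := by
  have hd : ∀ x, HasDerivAt tanh (1 / cosh x ^ 2) x := by
    intro x
    have h := (hasDerivAt_sinh x).div (hasDerivAt_cosh x) (cosh_pos x).ne'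
    have e : (cosh x * cosh x - sinh x * sinh x) = 1 := by
      have := cosh_sq_sub_sinh_sq x; linarith [sq (cosh x), sq (sinh x)]
    rw [e] at h
    have : tanh = fun y => sinh y / cosh y := by funext y; exact tanh_eq_sinh_div_cosh y
    rw [this]; exact h
  apply AntitoneOn.concaveOn_of_deriv (convex_Ici 0)
  · exact fun x _ => (hd x).continuousAt.continuousWithinAt
  · exact fun x _ => (hd x).differentiableAt.differentiableWithinAt
  · intro x hx y hy hxy
    rw [interior_Ici] at hx hy
    rw [(hd x).deriv, (hd y).deriv]
    have : cosh x ≤ cosh y := by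
      rw [cosh_le_cosh, abs_of_pos hx, abs_of_pos hy]; exact hxy
    have := cosh_pos x
    gcongr

open Real in
lemma tanh_half_log_div {a b : ℝ} (ha : 0 < a) (hb : 0 < b) :
    tanh (log (a / b) / 2) = (a - b) / (a + b) := by
  rw [tanh_eq_sinh_div_cosh, sinh_eq, cosh_eq]
  set x := log (a / b) / 2 with hx
  have h1 : exp x * exp x = a / b := by
    rw [← exp_add, hx, add_halves, exp_log (by positivity)]
  have h2 : exp x * exp (-x) = 1 := by rw [← exp_add]; simp
  have hp := exp_pos x
  have hp' := exp_pos (-x)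
  rw [div_div_div_cancel_right₀ (by norm_num), div_eq_div_iff (by positivity) (by positivity)]
  have h3 : exp x * exp x * b = a := by rw [h1]; field_simp
  have : exp x * ((exp x - exp (-x)) * (a + b)) = exp x * ((a - b) * (exp x + exp (-x))) := by
    linear_combination 2 * h3 - (2 * a) * h2
  exact mul_left_cancel₀ hp.ne' this

open Real in
/-- Average phase and asymmetry of a cycle on which the total edge gain is positive. -/
lemma mean_phase_bound {τ : Type*} [Fintype τ] [Nonempty τ] {α β ψ : ℝ} (hα : 0 ≤ α)
    (hβ : 0 ≤ β) (hαβ : 0 < α + β) (hψ : 0 < ψ) (hψ' : ψ < π) (hcot : cos ψ = (α - β) * sin ψ)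
    (θ t : τ → ℝ) (hθ : ∀ e, |θ e - ψ| < π / 2) (ht : ∀ e, 0 < t e) (ht1 : ∀ e, t e ≤ 1)
    (hsum : 0 < ∑ e, (sin (θ e) - ((α + β) - (α - β) * cos (θ e)) / t e)) :
    0 < (∑ e, θ e) / Fintype.card τ ∧ (∑ e, θ e) / Fintype.card τ < π ∧
      α * tan ((∑ e, θ e) / Fintype.card τ / 2) + β * cot ((∑ e, θ e) / Fintype.card τ / 2) ≤
        (∑ e, t e) / Fintype.card τ := by
  have hN : (0 : ℝ) < Fintype.card τ := by exact_mod_cast Fintype.card_pos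
  have hsψ : 0 < sin ψ := sin_pos_of_pos_of_lt_pi hψ hψ'
  set θ₀ := (∑ e, θ e) / Fintype.card τ with hθ₀
  set σ := α + β with hσ
  set δ := α - β with hδ
  have hδσ : |δ| ≤ σ := by rw [abs_le]; constructor <;> linarith
  have hκ : ∀ x, sin ψ * (sin x + δ * cos x) = cos (x - ψ) := by
    intro x; rw [cos_sub, hcot]; ring
  have hQ : ∀ x, 0 ≤ σ - δ * cos x := by
    intro x
    have : |δ * cos x| ≤ σ := by
      rw [abs_mul]; nlinarith [abs_cos_le_one x, abs_nonneg δ, abs_nonneg (cos x)]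
    linarith [(abs_le.1 this).2]
  have hmean : (∑ e, (θ e - ψ)) / Fintype.card τ = θ₀ - ψ := by
    rw [Finset.sum_sub_distrib, hθ₀]; simp; field_simp
  have hθi : ∀ e, θ e - ψ ∈ Set.Icc (-(π / 2)) (π / 2) := fun e =>
    ⟨(abs_lt.1 (hθ e)).1.le, (abs_lt.1 (hθ e)).2.le⟩
  have hJ : ∑ e, cos (θ e - ψ) ≤ Fintype.card τ * cos (θ₀ - ψ) := by
    rw [← hmean]
    exact strictConcaveOn_cos_Icc.concaveOn.sum_le_card_mul (fun e => θ e - ψ) hθi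
  have h1 : ∑ e, (sin (θ e) - (σ - δ * cos (θ e)) / t e) ≤
      ∑ e, (cos (θ e - ψ) / sin ψ - σ) := by
    apply Finset.sum_le_sum
    intro e _
    rw [← hκ, mul_div_cancel_left₀ _ hsψ.ne']
    have : σ - δ * cos (θ e) ≤ (σ - δ * cos (θ e)) / t e := by
      rw [le_div_iff₀ (ht e)]; nlinarith [hQ (θ e), ht1 e]
    linarith
  have hκ₀ : σ < sin θ₀ + δ * cos θ₀ := by
    have h2 : 0 < ∑ e, (cos (θ e - ψ) / sin ψ - σ) := lt_of_lt_of_le hsum h1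
    rw [Finset.sum_sub_distrib, ← Finset.sum_div, Finset.sum_const, Finset.card_univ,
      nsmul_eq_mul] at h2
    have h3 : (∑ e, cos (θ e - ψ)) / sin ψ ≤ Fintype.card τ * (sin θ₀ + δ * cos θ₀) := by
      rw [div_le_iff₀ hsψ, mul_assoc, mul_comm _ (sin ψ), hκ]; exact hJ
    have h4 : (Fintype.card τ : ℝ) * σ < Fintype.card τ * (sin θ₀ + δ * cos θ₀) := by linarith
    exact lt_of_mul_lt_mul_left h4 hN.le
  have hS : 0 < sin θ₀ := by linarith [hQ θ₀]
  have hlo : -(π / 2) < θ₀ - ψ := by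
    rw [← hmean, lt_div_iff₀ hN]
    have : ∑ _e : τ, (-(π / 2)) < ∑ e, (θ e - ψ) :=
      Finset.sum_lt_sum_of_nonempty Finset.univ_nonempty fun e _ => (abs_lt.1 (hθ e)).1
    rw [Finset.sum_const, Finset.card_univ, nsmul_eq_mul] at this; linarith
  have hhi : θ₀ - ψ < π / 2 := by
    rw [← hmean, div_lt_iff₀ hN]
    have : ∑ e, (θ e - ψ) < ∑ _e : τ, (π / 2) :=
      Finset.sum_lt_sum_of_nonempty Finset.univ_nonempty fun e _ => (abs_lt.1 (hθ e)).2
    rw [Finset.sum_const, Finset.card_univ, nsmul_eq_mul] at this; linarith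
  have h0 : 0 < θ₀ := by
    by_contra! h
    have := sin_nonpos_of_nonpos_of_neg_pi_le h (by linarith)
    linarith
  have hπ : θ₀ < π := by
    by_contra! h
    have := sin_nonneg_of_nonneg_of_le_pi (sub_nonneg.2 h) (by linarith)
    rw [sin_sub_pi] at this
    linarith
  refine ⟨h0, hπ, ?_⟩
  have hQ₀ : 0 < σ - δ * cos θ₀ := by
    have h1 : |cos θ₀| < 1 := by
      rw [← sq_lt_one_iff_abs_lt_one]; nlinarith [sin_sq_add_cos_sq θ₀]
    have : |δ * cos θ₀| < σ := by
      rw [abs_mul]; nlinarith [abs_nonneg δ, abs_nonneg (cos θ₀)]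
    linarith [(abs_lt.1 this).2]
  have hb : ∑ e, (sin (θ e) - (σ - δ * cos (θ e)) / t e) ≤
      ∑ e, ((σ * cos θ₀ - δ) / (σ - δ * cos θ₀) * (θ e - θ₀) +
        sin θ₀ ^ 2 / (σ - δ * cos θ₀) * t e - sin θ₀) := by
    apply Finset.sum_le_sum
    intro e _
    have := abs_lt.1 (hθ e)
    refine edge_bound hαβ hδσ h0 hπ (ht e) (ht1 e) (by linarith) (by linarith) ?_
    have hc : 0 < cos (θ e - ψ) := cos_pos_of_mem_Ioo this
    rw [← hκ] at hc
    exact (pos_of_mul_pos_right hc hsψ.le).le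
  have hs0 : ∑ e, (θ e - θ₀) = 0 := by
    rw [Finset.sum_sub_distrib, hθ₀]; simp; field_simp; ring
  have hb2 := lt_of_lt_of_le hsum hb
  rw [Finset.sum_sub_distrib, Finset.sum_add_distrib, ← Finset.mul_sum, ← Finset.mul_sum, hs0,
    Finset.sum_const, Finset.card_univ, nsmul_eq_mul] at hb2
  have hh : α * tan (θ₀ / 2) + β * cot (θ₀ / 2) = (σ - δ * cos θ₀) / sin θ₀ := by
    have hs2 : 0 < sin (θ₀ / 2) := sin_pos_of_pos_of_lt_pi (by linarith) (by linarith)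
    have hc2 : 0 < cos (θ₀ / 2) := cos_pos_of_mem_Ioo ⟨by linarith, by linarith⟩
    have e1 : sin θ₀ = 2 * sin (θ₀ / 2) * cos (θ₀ / 2) := by rw [← sin_two_mul]; ring_nf
    have e2 : cos θ₀ = 2 * cos (θ₀ / 2) ^ 2 - 1 := by rw [← cos_two_mul]; ring_nf
    rw [tan_eq_sin_div_cos, cot_eq_cos_div_sin, e1, e2]
    have e3 : sin (θ₀ / 2) ^ 2 = 1 - cos (θ₀ / 2) ^ 2 := by
      linarith [sin_sq_add_cos_sq (θ₀ / 2)]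
    field_simp
    rw [e3, hσ, hδ]; ring
  rw [hh, div_le_div_iff₀ hS hN]
  have hpos : 0 < sin θ₀ ^ 2 / (σ - δ * cos θ₀) * ∑ e, t e - Fintype.card τ * sin θ₀ := by linarith
  have : 0 < (sin θ₀ * ((∑ e, t e) * sin θ₀ - (σ - δ * cos θ₀) * Fintype.card τ)) := by
    have e : sin θ₀ * ((∑ e, t e) * sin θ₀ - (σ - δ * cos θ₀) * Fintype.card τ) =
      (σ - δ * cos θ₀) * (sin θ₀ ^ 2 / (σ - δ * cos θ₀) * ∑ e, t e - Fintype.card τ * sin θ₀) := by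
      field_simp
    rw [e]; positivity
  linarith [pos_of_mul_pos_right this hS.le]

/-- Positive part of the net flow `q i * M i j - q j * M j i`, kept on selected pairs only. -/
noncomputable def rectFlow {ι : Type*} (M : ι → ι → ℝ) (good : ι → ι → Prop) (q : ι → ℝ)
    (i j : ι) : ℝ :=
  open Classical in if good i j then max (q i * M i j - q j * M j i) 0 else 0

lemma rectFlow_nonneg {ι : Type*} (M : ι → ι → ℝ) (good : ι → ι → Prop) (q : ι → ℝ) (i j : ι) :
    0 ≤ rectFlow M good q i j := by
  unfold rectFlow; split_ifs
  · exact le_max_right _ _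
  · exact le_rfl

lemma continuous_rectFlow {ι : Type*} (M : ι → ι → ℝ) (good : ι → ι → Prop) (i j : ι) :
    Continuous fun q => rectFlow M good q i j := by
  unfold rectFlow; split_ifs <;> fun_prop

lemma rectFlow_diff_le {ι : Type*} {M : ι → ι → ℝ} (hM : ∀ i j, 0 ≤ M i j)
    (good : ι → ι → Prop) {p q : ι → ℝ} (hpq : p ≤ q) (i j : ι) :
    (rectFlow M good q i j - rectFlow M good q j i) -
      (rectFlow M good p i j - rectFlow M good p j i) ≤ (q i - p i) * M i j := by
  have h1 := mul_le_mul_of_nonneg_right (hpq i) (hM i j)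
  have h2 := mul_le_mul_of_nonneg_right (hpq j) (hM j i)
  unfold rectFlow
  have e1 : q j * M j i - q i * M i j = -(q i * M i j - q j * M j i) := by ring
  have e2 : p j * M j i - p i * M i j = -(p i * M i j - p j * M j i) := by ring
  rw [e1, e2]
  have h3 : (q i * M i j - q j * M j i) - (p i * M i j - p j * M j i) ≤ (q i - p i) * M i j := by
    linarith
  have h4 : 0 ≤ (q i - p i) * M i j := by linarith
  generalize q i * M i j - q j * M j i = a at h3
  generalize p i * M i j - p j * M j i = b at h3
  split_ifs <;> rcases max_cases a 0 with ⟨ha, _⟩ | ⟨ha, _⟩ <;>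
    rcases max_cases b 0 with ⟨hb, _⟩ | ⟨hb, _⟩ <;>
    rcases max_cases (-a) 0 with ⟨ha', _⟩ | ⟨ha', _⟩ <;>
    rcases max_cases (-b) 0 with ⟨hb', _⟩ | ⟨hb', _⟩ <;>
    linarith

/-- Net outflow of the rectified flow at a vertex. -/
noncomputable def rectDiv {ι : Type*} [Fintype ι] (M : ι → ι → ℝ) (good : ι → ι → Prop)
    (q : ι → ℝ) (i : ι) : ℝ :=
  ∑ j, (rectFlow M good q i j - rectFlow M good q j i)

lemma sum_rectDiv {ι : Type*} [Fintype ι] (M : ι → ι → ℝ) (good : ι → ι → Prop) (q : ι → ℝ) :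
    ∑ i, rectDiv M good q i = 0 := by
  simp only [rectDiv, Finset.sum_sub_distrib]
  rw [Finset.sum_comm, sub_self]

lemma continuous_rectDiv {ι : Type*} [Fintype ι] (M : ι → ι → ℝ) (good : ι → ι → Prop) (i : ι) :
    Continuous fun q => rectDiv M good q i := by
  unfold rectDiv
  exact continuous_finsetSum _ fun j _ =>
    (continuous_rectFlow M good i j).sub (continuous_rectFlow M good j i)

lemma exists_rectDiv_le {ι : Type*} [Fintype ι] [Nonempty ι] {M : ι → ι → ℝ}
    (hM : ∀ i j, 0 ≤ M i j) (good : ι → ι → Prop) {ε η : ℝ} (hε : 0 < ε)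
    (hεM : ∀ i, ε * ∑ j, M i j ≤ 1) (hη : 0 < η) (hη2 : η ≤ 1 / 2) :
    ∃ q ∈ stdSimplex ℝ ι, ∀ i, |rectDiv M good q i| ≤ 2 * η / ε := by
  set N := (Fintype.card ι : ℝ) with hN
  have hN0 : 0 < N := by rw [hN]; exact_mod_cast Fintype.card_pos
  have hN1 : 1 ≤ N := by rw [hN]; exact_mod_cast Nat.one_le_iff_ne_zero.2 Fintype.card_ne_zero
  let Ψ : (ι → ℝ) → (ι → ℝ) := fun q i => (1 - η) * (q i - ε * rectDiv M good q i) + η / N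
  have hmass : ∀ q, ∑ i, Ψ q i = (1 - η) * ∑ i, q i + η := by
    intro q
    simp only [Ψ, Finset.sum_add_distrib, ← Finset.mul_sum, Finset.sum_sub_distrib, sum_rectDiv,
      Finset.sum_const, Finset.card_univ, nsmul_eq_mul]
    rw [← hN]; field_simp; ring
  have hmono : Monotone Ψ := by
    intro p q hpq i
    have h1 : rectDiv M good q i - rectDiv M good p i ≤ (q i - p i) * ∑ j, M i j := by
      unfold rectDiv
      rw [← Finset.sum_sub_distrib, Finset.mul_sum]
      exact Finset.sum_le_sum fun j _ => rectFlow_diff_le hM good hpq i j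
    have h2 := mul_le_mul_of_nonneg_left h1 hε.le
    have h3 := mul_le_mul_of_nonneg_left (hεM i) (sub_nonneg.2 (hpq i))
    have h4 : 0 ≤ 1 - η := by linarith
    have h5 : p i - ε * rectDiv M good p i ≤ q i - ε * rectDiv M good q i := by linarith
    simp only [Ψ]; gcongr
  have hcont : Continuous Ψ := by
    refine continuous_pi fun i => ?_
    have := continuous_rectDiv M good i
    simp only [Ψ]; fun_prop
  have h0 : (0 : ι → ℝ) ≤ Ψ 0 := by
    intro i
    have : rectDiv M good 0 i = 0 := by simp [rectDiv, rectFlow]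
    simp only [Ψ, this]; simp; positivity
  have hxm : Monotone fun k => Ψ^[k] 0 := hmono.monotone_iterate_of_le_map h0
  have hx0 : ∀ k, 0 ≤ Ψ^[k] 0 := fun k => hxm (Nat.zero_le k)
  have hx1 : ∀ k, ∑ i, (Ψ^[k] 0) i ≤ 1 := by
    intro k
    induction k with
    | zero => simp
    | succ k ih =>
      rw [Function.iterate_succ_apply', hmass]; nlinarith
  have hle1 : ∀ k i, (Ψ^[k] 0) i ≤ 1 := fun k i =>
    (Finset.single_le_sum (fun j _ => hx0 k j) (Finset.mem_univ i)).trans (hx1 k)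
  have hlim : ∀ i, ∃ l, Filter.Tendsto (fun k => (Ψ^[k] 0) i) Filter.atTop (nhds l) := fun i =>
    ⟨_, tendsto_atTop_ciSup (fun a b hab => hxm hab i) ⟨1, by rintro _ ⟨k, rfl⟩; exact hle1 k i⟩⟩
  choose q hq using hlim
  have hfix : Ψ q = q :=
    isFixedPt_of_tendsto_iterate (tendsto_pi_nhds.2 hq) hcont.continuousAt
  have hq0 : ∀ i, 0 ≤ q i := fun i => ge_of_tendsto' (hq i) fun k => hx0 k i
  have hqs : ∑ i, q i = 1 := by
    have := hmass q
    rw [hfix] at this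
    have : η * (∑ i, q i - 1) = 0 := by linarith
    rcases mul_eq_zero.1 this with h | h <;> linarith
  refine ⟨q, ⟨hq0, hqs⟩, fun i => ?_⟩
  have hqi : q i ≤ 1 := by
    rw [← hqs]; exact Finset.single_le_sum (fun j _ => hq0 j) (Finset.mem_univ i)
  have he : (1 - η) * (q i - ε * rectDiv M good q i) + η / N = q i := congrFun hfix i
  have hηN : η / N ≤ η := div_le_self hη.le hN1
  have hηN0 : 0 ≤ η / N := by positivity
  have h6 : (1 - η) * (ε * rectDiv M good q i) = η / N - η * q i := by linarith
  have hle : η * q i ≤ η := mul_le_of_le_one_right hη.le hqi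
  have hge : 0 ≤ η * q i := mul_nonneg hη.le (hq0 i)
  have h7 : (1 - η) * (|rectDiv M good q i| * ε) ≤ η := by
    have : (1 - η) * (|rectDiv M good q i| * ε) = |(1 - η) * (ε * rectDiv M good q i)| := by
      rw [abs_mul, abs_mul, abs_of_pos hε, abs_of_nonneg (by linarith : 0 ≤ 1 - η)]; ring
    rw [this, h6, abs_le]; constructor <;> linarith
  rw [le_div_iff₀ hε]
  have h8 : 0 ≤ |rectDiv M good q i| * ε := by positivity
  nlinarith

/-- A nonnegative array admits a probability vector whose rectified net flow is balanced. -/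
lemma exists_rectDiv_eq_zero {ι : Type*} [Fintype ι] [Nonempty ι] {M : ι → ι → ℝ}
    (hM : ∀ i j, 0 ≤ M i j) (good : ι → ι → Prop) :
    ∃ q ∈ stdSimplex ℝ ι, ∀ i, rectDiv M good q i = 0 := by
  classical
  set S := ∑ i, ∑ j, M i j
  have hS : ∀ i, ∑ j, M i j ≤ S := fun i =>
    Finset.single_le_sum (f := fun i => ∑ j, M i j)
      (fun i _ => Finset.sum_nonneg fun j _ => hM i j) (Finset.mem_univ i)
  have hS0 : 0 ≤ S := Finset.sum_nonneg fun i _ => Finset.sum_nonneg fun j _ => hM i j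
  obtain ⟨q, hq, hmin⟩ := (isCompact_stdSimplex ℝ ι).exists_isMinOn
    (f := fun q => ∑ i, |rectDiv M good q i|) ⟨_, single_mem_stdSimplex ℝ (Classical.arbitrary ι)⟩
    (continuous_finsetSum _ fun i _ => (continuous_rectDiv M good i).abs).continuousOn
  have hle : ∑ i, |rectDiv M good q i| ≤ 0 := by
    refine le_of_forall_pos_le_add fun ε hε => ?_
    set N := (Fintype.card ι : ℝ) with hN
    have hN0 : 0 < N := by rw [hN]; exact_mod_cast Fintype.card_pos
    set η := min (1 / 2) (ε / (2 * N * (1 + S))) with hη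
    obtain ⟨p, hp, hpb⟩ := exists_rectDiv_le hM good (ε := 1 / (1 + S)) (η := η) (by positivity)
      (fun i => by
        rw [one_div_mul_eq_div, div_le_one (by positivity)]; linarith [hS i])
      (by positivity) (min_le_left _ _)
    have h1 : ∑ i, |rectDiv M good q i| ≤ ∑ i, |rectDiv M good p i| := hmin hp
    have h2 : ∑ i, |rectDiv M good p i| ≤ N * (2 * η / (1 / (1 + S))) := by
      rw [hN, ← nsmul_eq_mul, ← Finset.card_univ, ← Finset.sum_const]
      exact Finset.sum_le_sum fun i _ => hpb i
    have h3 : η ≤ ε / (2 * N * (1 + S)) := min_le_right _ _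
    rw [le_div_iff₀ (by positivity)] at h3
    have h4 : N * (2 * η / (1 / (1 + S))) = η * (2 * N * (1 + S)) := by field_simp
    linarith
  refine ⟨q, hq, fun i => ?_⟩
  have := (Finset.sum_eq_zero_iff_of_nonneg fun i _ => abs_nonneg (rectDiv M good q i)).1
    (le_antisymm hle (Finset.sum_nonneg fun _ _ => abs_nonneg _)) i (Finset.mem_univ i)
  exact abs_eq_zero.1 this

/-- A nonempty relation without 2-cycles in which every edge can be continued has a cycle. -/
lemma exists_injective_cycle {ι : Type*} [Finite ι] {P : ι → ι → Prop}
    (hasymm : ∀ i j, P i j → ¬ P j i) (hne : ∃ i j, P i j)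
    (hsucc : ∀ i j, P i j → ∃ k, P j k) :
    ∃ (len : ℕ) (vert : ZMod (len + 3) → ι), Function.Injective vert ∧
      ∀ t, P (vert t) (vert (t + 1)) := by
  classical
  obtain ⟨i₀, j₀, h₀⟩ := hne
  let f : ι → ι := fun j => if h : ∃ k, P j k then h.choose else j
  have hf : ∀ j, (∃ i, P i j) → P j (f j) := by
    rintro j ⟨i, hi⟩
    have h := hsucc i j hi
    simp only [f, dif_pos h]; exact h.choose_spec
  have hk : ∀ k, P (f^[k] j₀) (f^[k + 1] j₀) := by
    intro k
    induction k with
    | zero => exact hf _ ⟨_, h₀⟩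
    | succ k ih => rw [Function.iterate_succ_apply' f (k + 1)]; exact hf _ ⟨_, ih⟩
  obtain ⟨a, b, hab, heq⟩ : ∃ a b, a < b ∧ f^[a] j₀ = f^[b] j₀ := by
    obtain ⟨a, b, hne, h⟩ := Finite.exists_ne_map_eq_of_infinite fun k : ℕ => f^[k] j₀
    rcases lt_or_gt_of_ne hne with h' | h'
    · exact ⟨a, b, h', h⟩
    · exact ⟨b, a, h', h.symm⟩
  set y := f^[a] j₀ with hy
  have hPy : ∀ k, P (f^[k] y) (f^[k + 1] y) := by
    intro k
    rw [hy, ← Function.iterate_add_apply, ← Function.iterate_add_apply,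
      show k + 1 + a = (k + a) + 1 by ring]
    exact hk _
  have hper : Function.IsPeriodicPt f (b - a) y := by
    change f^[b - a] y = y
    rw [hy, ← Function.iterate_add_apply, Nat.sub_add_cancel hab.le, ← heq]
  have hm0 : 0 < Function.minimalPeriod f y := hper.minimalPeriod_pos (Nat.sub_pos_of_lt hab)
  have hmy : f^[Function.minimalPeriod f y] y = y := Function.iterate_minimalPeriod
  have hm1 : Function.minimalPeriod f y ≠ 1 := by
    intro h
    rw [h] at hmy
    have h1 := hPy 0
    simp only [zero_add, hmy, Function.iterate_zero, id] at h1
    exact hasymm _ _ h1 h1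
  have hm2 : Function.minimalPeriod f y ≠ 2 := by
    intro h
    rw [h] at hmy
    have h1 := hPy 1
    rw [show 1 + 1 = 2 from rfl, hmy] at h1
    exact hasymm _ _ (hPy 0) h1
  obtain ⟨len, hlen⟩ : ∃ len, Function.minimalPeriod f y = len + 3 :=
    ⟨Function.minimalPeriod f y - 3, by omega⟩
  refine ⟨len, fun t => f^[t.val] y, ?_, fun t => ?_⟩
  · intro s t hst
    have := Function.iterate_injOn_Iio_minimalPeriod (f := f) (x := y)
      (by rw [hlen]; exact ZMod.val_lt s) (by rw [hlen]; exact ZMod.val_lt t) hst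
    exact ZMod.val_injective _ this
  · have : f^[(t + 1).val] y = f^[t.val + 1] y := by
      have h := Function.iterate_mod_minimalPeriod_eq (f := f) (x := y) (n := t.val + 1)
      rw [hlen] at h
      rw [ZMod.val_add, show (1 : ZMod (len + 3)).val = 1 from ZMod.val_one'' (by omega), h]
    simp only [this]
    exact hPy _

/-- A balanced antisymmetrically supported flow with positive total weight contains a simple
directed cycle with positive total weight. -/
lemma exists_cycle_of_balanced {ι : Type*} [Fintype ι] (y : ι → ι → ℝ) (J : ι → ι → ℝ)
    (hJ : ∀ i j, 0 ≤ J i j) (hbal : ∀ i, ∑ j, J i j = ∑ j, J j i)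
    (hasymm : ∀ i j, 0 < J i j → J j i = 0) (hpos : 0 < ∑ i, ∑ j, J i j * y i j) :
    ∃ (len : ℕ) (vert : ZMod (len + 3) → ι), Function.Injective vert ∧
      (∀ t, 0 < J (vert t) (vert (t + 1))) ∧ 0 < ∑ t, y (vert t) (vert (t + 1)) := by
  classical
  induction hN : (Finset.univ.filter fun p : ι × ι => J p.1 p.2 ≠ 0).card using
    Nat.strong_induction_on generalizing J with
  | _ N ih =>
    obtain ⟨len, vert, hinj, hP⟩ := exists_injective_cycle (P := fun i j => 0 < J i j)
      (fun i j h h' => by rw [hasymm i j h] at h'; exact lt_irrefl _ h')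
      (by
        by_contra! h
        have : ∀ i j, J i j = 0 := fun i j => le_antisymm (h i j) (hJ i j)
        simp [this] at hpos)
      (fun i j h => by
        by_contra! h'
        have h1 : ∑ k, J j k ≤ 0 := Finset.sum_nonpos fun k _ => h' k
        rw [hbal] at h1
        have := Finset.single_le_sum (f := fun k => J k j) (fun k _ => hJ k j) (Finset.mem_univ i)
        linarith)
    by_cases hy : 0 < ∑ t, y (vert t) (vert (t + 1))
    · exact ⟨len, vert, hinj, hP, hy⟩
    push Not at hy
    obtain ⟨t₀, -, ht₀⟩ := Finset.exists_min_image Finset.univ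
      (fun t => J (vert t) (vert (t + 1))) Finset.univ_nonempty
    set μ := J (vert t₀) (vert (t₀ + 1)) with hμ
    have hμ0 : 0 < μ := hP t₀
    let E : ι → ι → ℝ := fun i j => ∑ t, if vert t = i ∧ vert (t + 1) = j then 1 else 0
    have hEv : ∀ t, E (vert t) (vert (t + 1)) = 1 := by
      intro t
      simp only [E]
      rw [Finset.sum_eq_single t]
      · simp
      · intro s _ hs
        rw [if_neg]
        exact fun h => hs (hinj h.1)
      · simp
    have hE0 : ∀ i j, (¬ ∃ t, vert t = i ∧ vert (t + 1) = j) → E i j = 0 := by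
      intro i j h
      refine Finset.sum_eq_zero fun t _ => if_neg fun h' => h ⟨t, h'⟩
    let J' : ι → ι → ℝ := fun i j => J i j - μ * E i j
    have hJ'le : ∀ i j, J' i j ≤ J i j := by
      intro i j
      have : 0 ≤ E i j := Finset.sum_nonneg fun t _ => by split_ifs <;> norm_num
      have := mul_nonneg hμ0.le this
      simp only [J']; linarith
    have hJ' : ∀ i j, 0 ≤ J' i j := by
      intro i j
      by_cases h : ∃ t, vert t = i ∧ vert (t + 1) = j
      · obtain ⟨t, rfl, rfl⟩ := h
        have := ht₀ t (Finset.mem_univ t)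
        simp only [J', hEv]; linarith
      · simp only [J', hE0 i j h]; linarith [hJ i j]
    have hEy : ∑ i, ∑ j, E i j * y i j = ∑ t, y (vert t) (vert (t + 1)) := by
      simp only [E, Finset.sum_mul]
      rw [Finset.sum_congr rfl fun i _ => Finset.sum_comm, Finset.sum_comm]
      refine Finset.sum_congr rfl fun t _ => ?_
      rw [Finset.sum_eq_single (vert t), Finset.sum_eq_single (vert (t + 1))]
      · simp
      · intro j _ hj; simp [hj.symm]
      · simp
      · intro i _ hi; simp [hi.symm]
      · simp
    have hEb : ∀ i, ∑ j, E i j = ∑ j, E j i := by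
      intro i
      simp only [E]
      rw [Finset.sum_comm, Finset.sum_comm (f := fun j t => if vert t = j ∧ vert (t + 1) = i
        then (1 : ℝ) else 0)]
      have e1 : ∀ t, ∑ j, (if vert t = i ∧ vert (t + 1) = j then (1 : ℝ) else 0) =
          if vert t = i then 1 else 0 := by
        intro t; by_cases h : vert t = i <;> simp [h]
      have e2 : ∀ t, ∑ j, (if vert t = j ∧ vert (t + 1) = i then (1 : ℝ) else 0) =
          if vert (t + 1) = i then 1 else 0 := by
        intro t; by_cases h : vert (t + 1) = i <;> simp [h]
      simp only [e1, e2]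
      exact (Equiv.sum_comp (Equiv.addRight (1 : ZMod (len + 3)))
        fun t => if vert t = i then (1 : ℝ) else 0).symm
    have hcard : (Finset.univ.filter fun p : ι × ι => J' p.1 p.2 ≠ 0).card < N := by
      rw [← hN]
      refine Finset.card_lt_card ⟨fun p hp => ?_, fun hsub => ?_⟩
      · simp only [Finset.mem_filter, Finset.mem_univ, true_and] at hp ⊢
        intro h
        exact hp (le_antisymm (h ▸ hJ'le _ _) (hJ' _ _))
      · have := hsub (x := (vert t₀, vert (t₀ + 1))) (by simpa using (hP t₀).ne')
        simp [J', hEv, hμ] at this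
    have hbal' : ∀ i, ∑ j, J' i j = ∑ j, J' j i := by
      intro i
      simp only [J', Finset.sum_sub_distrib, ← Finset.mul_sum, hbal i, hEb i]
    have hasymm' : ∀ i j, 0 < J' i j → J' j i = 0 := by
      intro i j h
      exact le_antisymm ((hJ'le j i).trans (hasymm i j (h.trans_le (hJ'le i j))).le) (hJ' j i)
    have hpos' : 0 < ∑ i, ∑ j, J' i j * y i j := by
      have : ∑ i, ∑ j, J' i j * y i j =
          ∑ i, ∑ j, J i j * y i j - μ * ∑ t, y (vert t) (vert (t + 1)) := by
        rw [← hEy, Finset.mul_sum, ← Finset.sum_sub_distrib]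
        refine Finset.sum_congr rfl fun i _ => ?_
        rw [Finset.mul_sum, ← Finset.sum_sub_distrib]
        refine Finset.sum_congr rfl fun j _ => ?_
        simp only [J']; ring
      rw [this]
      nlinarith
    obtain ⟨len', vert', hinj', hP', hy'⟩ := ih _ hcard J' hJ' hbal' hasymm' hpos' rfl
    exact ⟨len', vert', hinj', fun t => (hP' t).trans_le (hJ'le _ _), hy'⟩

lemma sum_add_one_zmod {len : ℕ} {G : Type*} [AddCommMonoid G] (f : ZMod (len + 3) → G) :
    ∑ t, f (t + 1) = ∑ t, f t :=
  Equiv.sum_comp (Equiv.addRight (1 : ZMod (len + 3))) f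

lemma half_gain_le {a b s c σ δ μ : ℝ} (hb : 0 ≤ b) (hab : b ≤ a) (hσ : 0 ≤ σ)
    (hc : δ * c ≤ σ) :
    a * (s + δ * c) - σ * (a * Real.exp (-μ)) + (b * (-s + δ * c) - σ * (b * Real.exp μ)) ≤
      (open Classical in if 0 < s + δ * c then max (a - b) 0 else 0) *
        (s - (σ - δ * c) / ((a - b) / (a + b)) + σ * μ) := by
  have h1 := Real.add_one_le_exp μ
  have h2 := Real.add_one_le_exp (-μ)
  have h3 : 0 ≤ σ * (b * (Real.exp μ - (μ + 1))) :=
    mul_nonneg hσ (mul_nonneg hb (by linarith))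
  have h4 : 0 ≤ σ * (a * (Real.exp (-μ) - (-μ + 1))) :=
    mul_nonneg hσ (mul_nonneg (hb.trans hab) (by linarith))
  have h5 : 0 ≤ σ * ((a - b) * (Real.exp (-μ))) :=
    mul_nonneg hσ (mul_nonneg (by linarith) (Real.exp_pos _).le)
  have h6 : 0 ≤ b * (σ - δ * c) := mul_nonneg hb (by linarith)
  have h7 : 0 ≤ σ * (b * (Real.exp (-μ) - (-μ + 1))) :=
    mul_nonneg hσ (mul_nonneg hb (by linarith))
  split_ifs with hk
  · rcases hab.eq_or_lt with rfl | hlt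
    · simp only [sub_self, max_self, zero_mul]; nlinarith
    · rw [max_eq_left (by linarith), div_div_eq_mul_div]
      have : (a - b) * (s - (σ - δ * c) * (a + b) / (a - b) + σ * μ) =
          (a - b) * s - (σ - δ * c) * (a + b) + σ * μ * (a - b) := by
        have : a - b ≠ 0 := by linarith
        field_simp
      rw [this]; nlinarith
  · have h8 : (a - b) * (s + δ * c) ≤ 0 :=
      mul_nonpos_of_nonneg_of_nonpos (by linarith) (by linarith)
    rw [zero_mul]; nlinarith

lemma pair_gain_le {a b s s' c c' σ δ μ μ' : ℝ} (ha : 0 ≤ a) (hb : 0 ≤ b) (hσ : 0 ≤ σ)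
    (hc : δ * c ≤ σ) (hs' : s' = -s) (hc' : c' = c) (hμ' : μ' = -μ) :
    (a * (s + δ * c) - σ * (a * Real.exp μ')) + (b * (s' + δ * c') - σ * (b * Real.exp μ)) ≤
      (open Classical in if 0 < s + δ * c then max (a - b) 0 else 0) *
        (s - (σ - δ * c) / ((a - b) / (a + b)) + σ * μ) +
      (open Classical in if 0 < s' + δ * c' then max (b - a) 0 else 0) *
        (s' - (σ - δ * c') / ((b - a) / (b + a)) + σ * μ') := by
  subst hs' hc' hμ'
  rcases le_total b a with h | h
  · have h1 := half_gain_le (s := s) (μ := μ) hb h hσ hc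
    have h2 : max (b - a) 0 = 0 := max_eq_right (by linarith)
    simp only [h2, ite_self, zero_mul, add_zero]
    exact h1
  · have h1 := half_gain_le (s := -s) (μ := -μ) ha h hσ hc
    have h2 : max (a - b) 0 = 0 := max_eq_right (by linarith)
    simp only [h2, ite_self, zero_mul, zero_add]
    rw [neg_neg, neg_neg] at h1
    linarith

/-- From a positive local gain at every vertex, a simple cycle carrying a net flow along every
edge, with positive total gain. -/
lemma exists_cycle_gain {ι : Type*} [Fintype ι] [Nonempty ι] {A : ι → ι → ℝ} {ρ d : ι → ℝ}
    {s c : ι → ι → ℝ} {σ δ : ℝ} (hA : ∀ i j, 0 ≤ A i j) (hρ : ∀ i, 0 < ρ i)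
    (hd : (∀ i, ∑ j, A i j ≤ d i) ∨ ∀ i, ∑ j, A j i ≤ d i) (hσ : 0 ≤ σ)
    (hs : ∀ i j, s j i = -s i j) (hc : ∀ i j, c j i = c i j) (hδc : ∀ i j, δ * c i j ≤ σ)
    (hloc : ∀ i, σ * d i < ∑ j, A i j * (ρ j / ρ i) * (s i j + δ * c i j)) :
    ∃ (q : ι → ℝ) (len : ℕ) (vert : ZMod (len + 3) → ι), Function.Injective vert ∧
      (∀ t, 0 < q (vert t)) ∧
      (∀ t, q (vert (t + 1)) * (A (vert (t + 1)) (vert t) * (ρ (vert t) / ρ (vert (t + 1)))) <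
        q (vert t) * (A (vert t) (vert (t + 1)) * (ρ (vert (t + 1)) / ρ (vert t)))) ∧
      (∀ t, 0 < s (vert t) (vert (t + 1)) + δ * c (vert t) (vert (t + 1))) ∧
      0 < ∑ t, (s (vert t) (vert (t + 1)) - (σ - δ * c (vert t) (vert (t + 1))) /
        ((q (vert t) * (A (vert t) (vert (t + 1)) * (ρ (vert (t + 1)) / ρ (vert t))) -
          q (vert (t + 1)) * (A (vert (t + 1)) (vert t) * (ρ (vert t) / ρ (vert (t + 1))))) /
        (q (vert t) * (A (vert t) (vert (t + 1)) * (ρ (vert (t + 1)) / ρ (vert t))) +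
          q (vert (t + 1)) * (A (vert (t + 1)) (vert t) * (ρ (vert t) / ρ (vert (t + 1))))))) := by
  classical
  set M : ι → ι → ℝ := fun i j => A i j * (ρ j / ρ i) with hMdef
  have hM : ∀ i j, 0 ≤ M i j := fun i j => mul_nonneg (hA i j) (div_pos (hρ j) (hρ i)).le
  let good : ι → ι → Prop := fun i j => 0 < s i j + δ * c i j
  obtain ⟨q, ⟨hq0, hq1⟩, hdiv⟩ := exists_rectDiv_eq_zero hM good
  have hbal : ∀ i, ∑ j, rectFlow M good q i j = ∑ j, rectFlow M good q j i := by
    intro i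
    have := hdiv i
    rw [rectDiv, Finset.sum_sub_distrib] at this
    linarith
  have hout : ∀ j, q j = 0 → ∀ i, rectFlow M good q j i = 0 := by
    intro j hj i
    have := mul_nonneg (hq0 i) (hM i j)
    unfold rectFlow
    split_ifs
    · rw [hj]; exact max_eq_right (by linarith)
    · rfl
  have hin : ∀ j, q j = 0 → ∀ i, rectFlow M good q i j = 0 := by
    intro j hj i
    have h := hbal j
    rw [Finset.sum_eq_zero fun i _ => hout j hj i] at h
    exact (Finset.sum_eq_zero_iff_of_nonneg fun i _ => rectFlow_nonneg M good q i j).1 h.symm i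
      (Finset.mem_univ i)
  let T : ι → ι → ℝ := fun i j => if q j = 0 then 0 else q i * M i j
  have hT0 : ∀ i j, 0 ≤ T i j := by
    intro i j; simp only [T]; split_ifs
    · exact le_rfl
    · exact mul_nonneg (hq0 i) (hM i j)
  have hTk : ∀ i j, q i * M i j * (s i j + δ * c i j) ≤ T i j * (s i j + δ * c i j) := by
    intro i j; simp only [T]; split_ifs with h
    · have h1 := hin j h i
      have h2 := mul_nonneg (hq0 i) (hM i j)
      rw [zero_mul]
      by_cases hg : good i j
      · simp only [rectFlow, if_pos hg, h, zero_mul, sub_zero] at h1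
        rw [max_eq_left h2] at h1
        rw [h1, zero_mul]
      · exact mul_nonpos_of_nonneg_of_nonpos h2 (not_lt.1 hg)
    · exact le_rfl
  have hJT : ∀ i j, rectFlow M good q i j = if good i j then max (T i j - T j i) 0 else 0 := by
    intro i j
    by_cases hj : q j = 0
    · rw [hin j hj]; simp [T, hj]
    by_cases hi : q i = 0
    · rw [hout i hi]; simp [T, hi]
    simp [rectFlow, T, hi, hj]
  obtain ⟨h, hh⟩ : ∃ h : ι → ℝ, ∑ i, ∑ j, T i j * Real.exp (h i - h j) ≤ ∑ i, q i * d i := by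
    rcases hd with hd | hd
    · refine ⟨fun i => Real.log (ρ i), Finset.sum_le_sum fun i _ => ?_⟩
      refine le_trans ?_ (mul_le_mul_of_nonneg_left (hd i) (hq0 i))
      rw [Finset.mul_sum]
      refine Finset.sum_le_sum fun j _ => ?_
      rw [Real.exp_sub, Real.exp_log (hρ i), Real.exp_log (hρ j)]
      simp only [T]; split_ifs
      · rw [zero_mul]; exact mul_nonneg (hq0 i) (hA i j)
      · have := (hρ i).ne'
        have := (hρ j).ne'
        simp only [hMdef]; field_simp; exact le_rfl
    · refine ⟨fun i => Real.log (ρ i) - Real.log (q i), ?_⟩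
      rw [Finset.sum_comm]
      refine Finset.sum_le_sum fun j _ => ?_
      refine le_trans ?_ (mul_le_mul_of_nonneg_left (hd j) (hq0 j))
      rw [Finset.mul_sum]
      refine Finset.sum_le_sum fun i _ => ?_
      have h0 := mul_nonneg (hq0 j) (hA i j)
      by_cases hj : q j = 0
      · simp [T, hj]
      by_cases hi : q i = 0
      · simpa [T, hi] using h0
      have hi' := (hq0 i).lt_of_ne' hi
      have hj' := (hq0 j).lt_of_ne' hj
      rw [Real.exp_sub, Real.exp_sub, Real.exp_sub, Real.exp_log (hρ i), Real.exp_log (hρ j),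
        Real.exp_log hi', Real.exp_log hj']
      have := (hρ i).ne'
      have := (hρ j).ne'
      simp only [T, if_neg hj, hMdef]; field_simp; exact le_rfl
  have hX : 0 < ∑ i, ∑ j, (T i j * (s i j + δ * c i j) - σ * (T i j * Real.exp (h i - h j))) := by
    have h1 : σ * ∑ i, q i * d i < ∑ i, q i * ∑ j, M i j * (s i j + δ * c i j) := by
      rw [Finset.mul_sum]
      obtain ⟨i, hi⟩ : ∃ i, q i ≠ 0 := by
        by_contra! h0
        simp [h0] at hq1
      refine Finset.sum_lt_sum (fun i _ => ?_) ⟨i, Finset.mem_univ i, ?_⟩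
      · nlinarith [mul_le_mul_of_nonneg_left (hloc i).le (hq0 i)]
      · nlinarith [mul_lt_mul_of_pos_left (hloc i) ((hq0 i).lt_of_ne' hi)]
    have h2 : ∑ i, q i * ∑ j, M i j * (s i j + δ * c i j) ≤
        ∑ i, ∑ j, T i j * (s i j + δ * c i j) := by
      refine Finset.sum_le_sum fun i _ => ?_
      rw [Finset.mul_sum]
      refine Finset.sum_le_sum fun j _ => ?_
      rw [← mul_assoc]; exact hTk i j
    have h3 := mul_le_mul_of_nonneg_left hh hσ
    simp only [Finset.sum_sub_distrib, ← Finset.mul_sum]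
    linarith
  set J := rectFlow M good q with hJ
  let g : ι → ι → ℝ := fun i j => s i j - (σ - δ * c i j) / ((T i j - T j i) / (T i j + T j i))
  have hY : 0 < ∑ i, ∑ j, J i j * (g i j + σ * (h j - h i)) := by
    have h1 : ∑ i, ∑ j, ((T i j * (s i j + δ * c i j) - σ * (T i j * Real.exp (h i - h j))) +
        (T j i * (s j i + δ * c j i) - σ * (T j i * Real.exp (h j - h i)))) ≤
        ∑ i, ∑ j, (J i j * (g i j + σ * (h j - h i)) + J j i * (g j i + σ * (h i - h j))) := by
      refine Finset.sum_le_sum fun i _ => Finset.sum_le_sum fun j _ => ?_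
      rw [hJT i j, hJT j i]
      exact pair_gain_le (hT0 i j) (hT0 j i) hσ (hδc i j) (hs i j) (hc i j) (by ring)
    have hsym : ∀ f : ι → ι → ℝ, ∑ i, ∑ j, (f i j + f j i) = 2 * ∑ i, ∑ j, f i j := by
      intro f
      simp only [Finset.sum_add_distrib]
      rw [Finset.sum_comm (f := fun i j => f j i)]; ring
    rw [hsym (fun i j => T i j * (s i j + δ * c i j) - σ * (T i j * Real.exp (h i - h j))),
      hsym (fun i j => J i j * (g i j + σ * (h j - h i)))] at h1
    linarith
  have hJlt : ∀ i j, 0 < J i j → good i j ∧ T j i < T i j := by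
    intro i j hij
    rw [hJT] at hij
    split_ifs at hij with hg
    · refine ⟨hg, ?_⟩
      by_contra! h'
      rw [max_eq_right (by linarith)] at hij
      exact lt_irrefl _ hij
    · exact absurd hij (lt_irrefl _)
  obtain ⟨len, vert, hinj, hP, hy⟩ := exists_cycle_of_balanced
    (fun i j => g i j + σ * (h j - h i)) J (rectFlow_nonneg M good q) hbal
    (fun i j hij => by
      rw [hJT j i]
      split_ifs
      · exact max_eq_right (by linarith [(hJlt i j hij).2])
      · rfl) hY
  have hpos : ∀ t, T (vert (t + 1)) (vert t) < T (vert t) (vert (t + 1)) :=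
    fun t => (hJlt _ _ (hP t)).2
  have hqv : ∀ t, q (vert t) ≠ 0 := by
    intro t h0
    have := hpos t
    simp only [T, h0, if_true, zero_mul, ite_self, lt_self_iff_false] at this
  have hTv : ∀ t, T (vert t) (vert (t + 1)) = q (vert t) * M (vert t) (vert (t + 1)) :=
    fun t => if_neg (hqv _)
  have hTv' : ∀ t, T (vert (t + 1)) (vert t) = q (vert (t + 1)) * M (vert (t + 1)) (vert t) :=
    fun t => if_neg (hqv _)
  refine ⟨q, len, vert, hinj, fun t => (hq0 _).lt_of_ne' (hqv t), fun t => ?_,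
    fun t => (hJlt _ _ (hP t)).1, ?_⟩
  · have := hpos t
    rwa [hTv, hTv'] at this
  · have htel : ∑ t, σ * (h (vert (t + 1)) - h (vert t)) = 0 := by
      rw [← Finset.mul_sum, Finset.sum_sub_distrib,
        sum_add_one_zmod fun t => h (vert t), sub_self, mul_zero]
    rw [Finset.sum_add_distrib, htel, add_zero] at hy
    simpa only [g, hTv, hTv'] using hy

open Real in
lemma exists_phase_near {w : ℂ} (hw : ‖w‖ = 1) {δ ψ : ℝ} (hs : 0 < sin ψ)
    (hcot : cos ψ = δ * sin ψ) (hpos : 0 < w.im + δ * w.re) :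
    ∃ θ : ℝ, w = Complex.exp (θ * Complex.I) ∧ |θ - ψ| < π / 2 := by
  set x := w * Complex.exp ((-ψ : ℝ) * Complex.I) with hx
  have hxn : ‖x‖ = 1 := by rw [hx, norm_mul, hw, Complex.norm_exp_ofReal_mul_I, one_mul]
  have hre : 0 < x.re := by
    have : x.re = sin ψ * (w.im + δ * w.re) := by
      rw [hx, Complex.mul_re, Complex.exp_ofReal_mul_I_re, Complex.exp_ofReal_mul_I_im, cos_neg,
        sin_neg, hcot]
      ring
    rw [this]; positivity
  refine ⟨ψ + x.arg, ?_, ?_⟩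
  · have h := Complex.norm_mul_exp_arg_mul_I x
    rw [hxn, Complex.ofReal_one, one_mul] at h
    rw [Complex.ofReal_add, add_mul, Complex.exp_add, h, hx, mul_comm, mul_assoc, ← Complex.exp_add]
    simp
  · rw [add_sub_cancel_left]
    exact Complex.abs_arg_lt_pi_div_two_iff.2 (Or.inl hre)

/-- The edge ratios of `v` along the closed path `vert` have continuous phases in a common open
half-plane, adding up to `W` full turns. -/
def HasLift {ι : Type*} {len : ℕ} (vert : ZMod (len + 3) → ι) (v : ι → ℂ) (W : ℤ) : Prop :=
  (∀ t, v (vert t) ≠ 0) ∧ ∃ (θ : ZMod (len + 3) → ℝ) (ψ : ℝ),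
    (∀ t, v (vert (t + 1)) / v (vert t) =
      ‖v (vert (t + 1)) / v (vert t)‖ * Complex.exp (θ t * Complex.I)) ∧
    (∀ t, |θ t - ψ| < Real.pi / 2) ∧ ∑ t, θ t = 2 * Real.pi * W

/-- Hyperbolic tangent of the mean half log-ratio of forward to backward weights of a closed
path, equal to `1` when some backward weight vanishes. -/
noncomputable def pathAff {ι : Type*} {len : ℕ} (A : ι → ι → ℝ) (vert : ZMod (len + 3) → ι) : ℝ :=
  open Classical in
  if ∀ t, 0 < A (vert (t + 1)) (vert t) then
    Real.tanh ((∑ t, Real.log (A (vert t) (vert (t + 1)) / A (vert (t + 1)) (vert t))) /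
      (2 * (len + 3)))
  else 1

open Real in
lemma sum_asymmetry_le_pathAff {ι : Type*} {A : ι → ι → ℝ} (hA : ∀ i j, 0 ≤ A i j)
    {ρ q : ι → ℝ} (hρ : ∀ i, 0 < ρ i) {len : ℕ} {vert : ZMod (len + 3) → ι}
    (hq : ∀ t, 0 < q (vert t))
    (hlt : ∀ t, q (vert (t + 1)) * (A (vert (t + 1)) (vert t) * (ρ (vert t) / ρ (vert (t + 1)))) <
        q (vert t) * (A (vert t) (vert (t + 1)) * (ρ (vert (t + 1)) / ρ (vert t)))) :
    (∑ t, ((q (vert t) * (A (vert t) (vert (t + 1)) * (ρ (vert (t + 1)) / ρ (vert t))) -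
          q (vert (t + 1)) * (A (vert (t + 1)) (vert t) * (ρ (vert t) / ρ (vert (t + 1))))) /
        (q (vert t) * (A (vert t) (vert (t + 1)) * (ρ (vert (t + 1)) / ρ (vert t))) +
          q (vert (t + 1)) * (A (vert (t + 1)) (vert t) * (ρ (vert t) / ρ (vert (t + 1))))))) /
      (len + 3) ≤ pathAff A vert := by
  set a := fun t => q (vert t) * (A (vert t) (vert (t + 1)) * (ρ (vert (t + 1)) / ρ (vert t)))
    with ha
  set b := fun t =>
    q (vert (t + 1)) * (A (vert (t + 1)) (vert t) * (ρ (vert t) / ρ (vert (t + 1)))) with hb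
  have hlt' : ∀ t, b t < a t := hlt
  have hb0 : ∀ t, 0 ≤ b t := fun t =>
    mul_nonneg (hq _).le (mul_nonneg (hA _ _) (div_pos (hρ _) (hρ _)).le)
  have ha0 : ∀ t, 0 < a t := fun t => (hb0 t).trans_lt (hlt' t)
  have hApos : ∀ t, 0 < A (vert t) (vert (t + 1)) := by
    intro t
    refine (hA _ _).lt_of_ne' fun h => ?_
    have := ha0 t
    simp [ha, h] at this
  have hm : (0 : ℝ) < len + 3 := by positivity
  change (∑ t, (a t - b t) / (a t + b t)) / (len + 3) ≤ _
  rw [div_le_iff₀ hm]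
  unfold pathAff
  split_ifs with hrev
  · have hbp : ∀ t, 0 < b t := fun t =>
      mul_pos (hq _) (mul_pos (hrev t) (div_pos (hρ _) (hρ _)))
    have h1 := concaveOn_tanh.sum_le_card_mul (fun t => log (a t / b t) / 2) (fun t => by
      have := log_nonneg ((one_le_div (hbp t)).2 (hlt' t).le)
      simp only [Set.mem_Ici]; positivity)
    simp only [tanh_half_log_div (ha0 _) (hbp _)] at h1
    have hlog : ∀ t, log (a t / b t) = log (A (vert t) (vert (t + 1)) / A (vert (t + 1)) (vert t)) +
        ((2 * log (ρ (vert (t + 1))) - log (q (vert (t + 1)))) -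
          (2 * log (ρ (vert t)) - log (q (vert t)))) := by
      intro t
      have e1 := (hq t).ne'
      have e2 := (hq (t + 1)).ne'
      have e3 := (hρ (vert t)).ne'
      have e4 := (hρ (vert (t + 1))).ne'
      have e5 := (hApos t).ne'
      have e6 := (hrev t).ne'
      simp only [ha, hb]
      rw [log_div (by positivity) (by positivity), log_mul e1 (by positivity),
        log_mul e5 (by positivity), log_div e4 e3, log_mul e2 (by positivity),
        log_mul e6 (by positivity), log_div e3 e4, log_div e5 e6]
      ring
    have h2 : ∑ t, log (a t / b t) / 2 =
        (∑ t, log (A (vert t) (vert (t + 1)) / A (vert (t + 1)) (vert t))) / 2 := by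
      rw [← Finset.sum_div]
      simp only [hlog]
      rw [Finset.sum_add_distrib, Finset.sum_sub_distrib,
        sum_add_one_zmod fun t => 2 * log (ρ (vert t)) - log (q (vert t)), sub_self, add_zero]
    rw [h2, ZMod.card, div_div] at h1
    push_cast at h1
    linarith
  · have h1 : ∑ t, (a t - b t) / (a t + b t) ≤ ∑ _t : ZMod (len + 3), (1 : ℝ) := by
      refine Finset.sum_le_sum fun t _ => ?_
      rw [div_le_one (by linarith [ha0 t, hb0 t])]
      linarith [hb0 t]
    rw [Finset.sum_const, Finset.card_univ, ZMod.card, nsmul_eq_mul] at h1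
    push_cast at h1
    linarith

open Real in
/-- The cycle supplied by a nowhere vanishing solution of the local eigenvalue equations. -/
lemma exists_cycle_hasLift {ι : Type*} [Fintype ι] [Nonempty ι] {A : ι → ι → ℝ} {d : ι → ℝ}
    (hA : ∀ i j, 0 ≤ A i j) (hd : (∀ i, ∑ j, A i j ≤ d i) ∨ ∀ i, ∑ j, A j i ≤ d i)
    {r : ℝ} (hdr : ∀ i, d i ≤ r) {v : ι → ℂ} (hv : ∀ i, v i ≠ 0) {lam : ℂ}
    (heig : ∀ i, ∑ j, (A i j : ℂ) * (v j / v i) = lam + d i) {α β : ℝ} (hα : 0 ≤ α) (hβ : 0 ≤ β)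
    (hαβ : 0 < α + β) (hlt : α * (-lam.re) + β * (2 * r + lam.re) < lam.im) :
    ∃ (len : ℕ) (vert : ZMod (len + 3) → ι) (W : ℤ), Function.Injective vert ∧
      (∀ t, 0 < A (vert t) (vert (t + 1))) ∧ HasLift vert v W ∧ 1 ≤ W ∧ 2 * W < len + 3 ∧
      α * tan (π * W / (len + 3)) + β * cot (π * W / (len + 3)) ≤ pathAff A vert := by
  set ψ := π / 2 - arctan (α - β) with hψ
  have hψ0 : 0 < ψ := by linarith [arctan_lt_pi_div_two (α - β)]
  have hψπ : ψ < π := by linarith [neg_pi_div_two_lt_arctan (α - β)]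
  have hcot : cos ψ = (α - β) * sin ψ := by
    rw [hψ, cos_pi_div_two_sub, sin_pi_div_two_sub, sin_arctan, cos_arctan]; ring
  have hsψ : 0 < sin ψ := sin_pos_of_pos_of_lt_pi hψ0 hψπ
  have hρ : ∀ i, 0 < ‖v i‖ := fun i => norm_pos_iff.2 (hv i)
  let e : ι → ℂ := fun i => v i / ‖v i‖
  have he : ∀ i, ‖e i‖ = 1 := by
    intro i
    simp only [e, norm_div, Complex.norm_real, norm_norm]
    exact div_self (hρ i).ne'
  let w : ι → ι → ℂ := fun i j => e j * (starRingEnd ℂ) (e i)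
  have hwn : ∀ i j, ‖w i j‖ = 1 := by
    intro i j; simp only [w, norm_mul, RCLike.norm_conj, he, mul_one]
  have hee : ∀ i, e i * (starRingEnd ℂ) (e i) = 1 := by
    intro i; rw [Complex.mul_conj, Complex.normSq_eq_norm_sq, he]; simp
  have hratio : ∀ i j, v j / v i = (‖v j‖ / ‖v i‖ : ℝ) * w i j := by
    intro i j
    have h1 : ∀ i, v i = ‖v i‖ * e i := by
      intro i
      have : (‖v i‖ : ℂ) ≠ 0 := by exact_mod_cast (hρ i).ne'
      simp only [e]; field_simp
    have h2 : e i ≠ 0 := by rw [← norm_pos_iff, he]; norm_num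
    have h3 : (‖v i‖ : ℂ) ≠ 0 := by exact_mod_cast (hρ i).ne'
    have h4 : w i j = e j / e i := by
      rw [eq_div_iff h2]
      simp only [w]
      rw [mul_assoc, mul_comm _ (e i), hee, mul_one]
    rw [h4, Complex.ofReal_div]
    conv_lhs => rw [h1 i, h1 j]
    field_simp
  have hloc : ∀ i, (α + β) * d i <
      ∑ j, A i j * (‖v j‖ / ‖v i‖) * ((w i j).im + (α - β) * (w i j).re) := by
    intro i
    have h1 : ∑ j, ((A i j * (‖v j‖ / ‖v i‖) : ℝ) : ℂ) * w i j = lam + d i := by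
      rw [← heig i]
      refine Finset.sum_congr rfl fun j _ => ?_
      rw [hratio i j, Complex.ofReal_mul, mul_assoc]
    have hre := congrArg Complex.re h1
    have him := congrArg Complex.im h1
    rw [Complex.re_sum] at hre
    rw [Complex.im_sum] at him
    simp only [Complex.re_ofReal_mul, Complex.im_ofReal_mul, Complex.add_re, Complex.add_im,
      Complex.ofReal_re, Complex.ofReal_im, add_zero] at hre him
    have h2 : ∑ j, A i j * (‖v j‖ / ‖v i‖) * ((w i j).im + (α - β) * (w i j).re) =
        lam.im + (α - β) * (lam.re + d i) := by
      rw [← hre, ← him, Finset.mul_sum, ← Finset.sum_add_distrib]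
      exact Finset.sum_congr rfl fun j _ => by ring
    rw [h2]
    nlinarith [mul_le_mul_of_nonneg_left (hdr i) hβ]
  have hδc : ∀ i j, (α - β) * (w i j).re ≤ α + β := by
    intro i j
    have h1 := Complex.abs_re_le_norm (w i j)
    rw [hwn, abs_le] at h1
    nlinarith
  obtain ⟨q, len, vert, hinj, hq, hnet, hgood, hgain⟩ := exists_cycle_gain (ρ := fun i => ‖v i‖)
    (s := fun i j => (w i j).im) (c := fun i j => (w i j).re) hA hρ hd hαβ.le
    (fun i j => by simp [w]; ring) (fun i j => by simp [w]; ring) hδc hloc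
  choose θ hθ hθψ using fun t => exists_phase_near (hwn (vert t) (vert (t + 1))) hsψ hcot (hgood t)
  have hm : (0 : ℝ) < len + 3 := by positivity
  obtain ⟨W, hW⟩ : ∃ W : ℤ, ∑ t, θ t = 2 * π * W := by
    have h1 : Complex.exp ((∑ t, θ t : ℝ) * Complex.I) = 1 := by
      rw [Complex.ofReal_sum, Finset.sum_mul, Complex.exp_sum]
      simp only [← hθ]
      simp only [w, Finset.prod_mul_distrib]
      rw [show ∏ t, e (vert (t + 1)) = ∏ t, e (vert t) from
        Equiv.prod_comp (Equiv.addRight (1 : ZMod (len + 3))) fun t => e (vert t),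
        ← Finset.prod_mul_distrib]
      exact Finset.prod_eq_one fun t _ => hee _
    obtain ⟨W, hW⟩ := Complex.exp_eq_one_iff.1 h1
    refine ⟨W, ?_⟩
    have := congrArg Complex.im hW
    simp at this
    linarith
  have hsin : ∀ t, (w (vert t) (vert (t + 1))).im = sin (θ t) := fun t => by
    rw [hθ, Complex.exp_ofReal_mul_I_im]
  have hcos : ∀ t, (w (vert t) (vert (t + 1))).re = cos (θ t) := fun t => by
    rw [hθ, Complex.exp_ofReal_mul_I_re]
  simp only [hsin, hcos] at hgain
  have hb0 : ∀ t, 0 ≤ q (vert (t + 1)) *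
      (A (vert (t + 1)) (vert t) * (‖v (vert t)‖ / ‖v (vert (t + 1))‖)) := fun t =>
    mul_nonneg (hq _).le (mul_nonneg (hA _ _) (div_pos (hρ _) (hρ _)).le)
  obtain ⟨h0, hπ, hle⟩ := mean_phase_bound hα hβ hαβ hψ0 hψπ hcot θ _ hθψ
    (fun t => div_pos (by linarith [hnet t]) (by linarith [hnet t, hb0 t]))
    (fun t => (div_le_one (by linarith [hnet t, hb0 t])).2 (by linarith [hnet t, hb0 t])) hgain
  have hcard : ((Fintype.card (ZMod (len + 3)) : ℕ) : ℝ) = len + 3 := by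
    rw [ZMod.card]; push_cast; rfl
  rw [hcard, hW] at h0 hπ hle
  have hW1 : 0 < W := by
    rw [div_pos_iff_of_pos_right hm] at h0
    exact_mod_cast pos_of_mul_pos_right h0 (by positivity)
  have hW2 : 2 * W < len + 3 := by
    rw [div_lt_iff₀ hm] at hπ
    have : (2 * W : ℝ) < len + 3 := by nlinarith [pi_pos]
    exact_mod_cast this
  refine ⟨len, vert, W, hinj, fun t => ?_, ⟨fun t => hv _, θ, ψ, fun t => ?_, hθψ, hW⟩, hW1, hW2,
    ?_⟩
  · refine (hA _ _).lt_of_ne' fun h => ?_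
    have := hnet t
    rw [h, zero_mul, mul_zero] at this
    linarith [hb0 t]
  · rw [← hθ, norm_div, ← hratio]
  · have : 2 * π * W / (len + 3) / 2 = π * W / (len + 3) := by ring
    rw [this] at hle
    exact hle.trans (sum_asymmetry_le_pathAff hA hρ hq hnet)

lemma wrapIdx_add_mul (m : ℕ) (k l : ℤ) : wrapIdx m (k + m * l) = wrapIdx m k := by
  have : (m : ℤ) - (k + m * l) = m - k + m * (-l) := by ring
  rw [wrapIdx, wrapIdx, this, Int.add_mul_emod_self_left, Int.add_mul_emod_self_left]

lemma wrapIdx_of_lt_half {m : ℕ} {W : ℤ} (h1 : 1 ≤ W) (h2 : 2 * W < m) : wrapIdx m W = W := by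
  rw [wrapIdx, Int.emod_eq_of_lt (by omega) (by omega), Int.emod_eq_of_lt (by omega) (by omega),
    min_eq_left (by omega)]

lemma wrapIdx_neg_of_lt_half {m : ℕ} {W : ℤ} (h1 : 1 ≤ W) (h2 : 2 * W < m) :
    wrapIdx m (-W) = W := by
  rw [← wrapIdx_add_mul m (-W) 1, mul_one, wrapIdx, Int.emod_eq_of_lt (by omega) (by omega),
    show (m : ℤ) - (-W + m) = W by ring, Int.emod_eq_of_lt (by omega) (by omega),
    min_eq_right (by omega)]

lemma HasLift.admissible {n : ℕ} {R : Matrix (Fin n) (Fin n) ℝ} {c : MCycle n R} {v : Fin n → ℂ}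
    {W : ℤ} (h : HasLift c.vert v W) : c.Admissible v := by
  obtain ⟨hv, θ, ψ, hθ, hψ, -⟩ := h
  refine ⟨hv, Complex.exp (ψ * Complex.I), fun t => ?_⟩
  have hpos : 0 < ‖v (c.vert (t + 1)) / v (c.vert t)‖ :=
    norm_pos_iff.2 (div_ne_zero (hv _) (hv _))
  have hc : 0 < Real.cos (θ t - ψ) := Real.cos_pos_of_mem_Ioo (abs_lt.1 (hψ t))
  have : (starRingEnd ℂ) (Complex.exp (ψ * Complex.I)) * (v (c.vert (t + 1)) / v (c.vert t)) =
      ‖v (c.vert (t + 1)) / v (c.vert t)‖ * Complex.exp ((θ t - ψ : ℝ) * Complex.I) := by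
    conv_lhs => rw [hθ t]
    rw [← Complex.exp_conj, mul_left_comm, ← Complex.exp_add]
    congr 2
    simp
    ring
  rw [this, Complex.re_ofReal_mul, Complex.exp_ofReal_mul_I_re]
  positivity

open Real in
lemma HasLift.winding_eq {n : ℕ} {R : Matrix (Fin n) (Fin n) ℝ} {c : MCycle n R} {v : Fin n → ℂ}
    {W : ℤ} (h : HasLift c.vert v W) : c.winding v = wrapIdx (c.len + 3) W := by
  obtain ⟨hv, θ, ψ, hθ, hψ, hsum⟩ := h
  have hpos : ∀ t, 0 < ‖v (c.vert (t + 1)) / v (c.vert t)‖ := fun t =>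
    norm_pos_iff.2 (div_ne_zero (hv _) (hv _))
  have hexp : ∀ t, Complex.exp (Complex.I * (Complex.arg (v (c.vert (t + 1)) / v (c.vert t)) : ℂ))
      = Complex.exp (θ t * Complex.I) := by
    intro t
    have h1 := Complex.norm_mul_exp_arg_mul_I (v (c.vert (t + 1)) / v (c.vert t))
    have h2 : (‖v (c.vert (t + 1)) / v (c.vert t)‖ : ℂ) ≠ 0 := by exact_mod_cast (hpos t).ne'
    rw [mul_comm Complex.I]
    exact mul_left_cancel₀ h2 (h1.trans (hθ t))
  set S := ∑ t, Complex.exp (θ t * Complex.I) with hS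
  have hφ : c.branchPhi v = Complex.arg S := by
    unfold MCycle.branchPhi; simp only [hexp]; rfl
  set φ := c.branchPhi v
  set x := Complex.exp ((-ψ : ℝ) * Complex.I) * S with hx
  have hxre : 0 < x.re := by
    rw [hx, hS, Finset.mul_sum, Complex.re_sum]
    refine Finset.sum_pos (fun t _ => ?_) Finset.univ_nonempty
    rw [← Complex.exp_add, ← add_mul, ← Complex.ofReal_add, Complex.exp_ofReal_mul_I_re,
      neg_add_eq_sub]
    exact cos_pos_of_mem_Ioo (abs_lt.1 (hψ t))
  have hxarg := Complex.abs_arg_lt_pi_div_two_iff.2 (Or.inl hxre)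
  have hnorm : ‖x‖ = ‖S‖ := by rw [hx, norm_mul, Complex.norm_exp_ofReal_mul_I, one_mul]
  have hS0 : (‖S‖ : ℂ) ≠ 0 := by
    rw [← hnorm]
    have : x ≠ 0 := fun h0 => by simp [h0] at hxre
    exact_mod_cast (norm_pos_iff.2 this).ne'
  have hφ' : Complex.exp (φ * Complex.I) = Complex.exp ((ψ + x.arg : ℝ) * Complex.I) := by
    have h1 := Complex.norm_mul_exp_arg_mul_I S
    have h2 := Complex.norm_mul_exp_arg_mul_I x
    rw [hnorm, hx] at h2
    rw [← hφ] at h1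
    refine mul_left_cancel₀ hS0 (h1.trans ?_)
    rw [Complex.ofReal_add, add_mul, Complex.exp_add, mul_left_comm, h2, ← mul_assoc,
      ← Complex.exp_add]
    simp
  obtain ⟨k, hk⟩ := Complex.exp_eq_exp_iff_exists_int.1 hφ'
  have hk' : φ = ψ + x.arg + 2 * π * k := by
    have := congrArg Complex.im hk
    simp at this
    linarith
  have harg : ∀ t, Complex.arg (Complex.exp (-(Complex.I * (φ : ℂ))) *
      (v (c.vert (t + 1)) / v (c.vert t))) + φ = θ t + 2 * π * k := by
    intro t
    have h1 : Complex.exp (-(Complex.I * (φ : ℂ))) * (v (c.vert (t + 1)) / v (c.vert t)) =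
        (‖v (c.vert (t + 1)) / v (c.vert t)‖ : ℝ) *
          Complex.exp ((θ t - (ψ + x.arg) : ℝ) * Complex.I) := by
      conv_lhs => rw [hθ t]
      rw [mul_left_comm, Complex.exp_neg, mul_comm Complex.I, hφ', ← Complex.exp_neg,
        ← Complex.exp_add]
      congr 2
      push_cast
      ring
    have h2 := abs_lt.1 (hψ t)
    have h3 := abs_lt.1 hxarg
    rw [h1, Complex.arg_real_mul _ (hpos t), Complex.arg_exp_mul_I,
      (toIocMod_eq_self _).2 ⟨by linarith, by linarith⟩, hk']
    ring
  have hround : (∑ t : ZMod (c.len + 3), (θ t + 2 * π * k)) / (2 * π) =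
      ((W + ((c.len + 3 : ℕ) : ℤ) * k : ℤ) : ℝ) := by
    rw [Finset.sum_add_distrib, hsum, Finset.sum_const, Finset.card_univ, ZMod.card, nsmul_eq_mul]
    have := pi_pos.ne'
    push_cast
    field_simp
  unfold MCycle.winding
  rw [Finset.sum_congr rfl fun t _ => harg t, hround, round_intCast, wrapIdx_add_mul]

lemma HasLift.of_conj {ι : Type*} {len : ℕ} {vert : ZMod (len + 3) → ι} {v : ι → ℂ} {W : ℤ}
    (h : HasLift vert (fun i => (starRingEnd ℂ) (v i)) W) : HasLift vert v (-W) := by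
  obtain ⟨hv, θ, ψ, hθ, hψ, hsum⟩ := h
  refine ⟨fun t h0 => hv t (by simp [h0]), fun t => -θ t, -ψ, fun t => ?_, fun t => ?_, ?_⟩
  · have h1 := congrArg (starRingEnd ℂ) (hθ t)
    rw [← map_div₀, Complex.conj_conj, RCLike.norm_conj, map_mul, Complex.conj_ofReal,
      ← Complex.exp_conj] at h1
    simpa using h1
  · rw [← neg_sub', abs_neg]; exact hψ t
  · rw [Finset.sum_neg_distrib, hsum]; push_cast; ring

lemma HasLift.reverse {ι : Type*} {len : ℕ} {vert : ZMod (len + 3) → ι} {v : ι → ℂ} {W : ℤ}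
    (h : HasLift vert v W) : HasLift (fun t => vert (-t)) v (-W) := by
  obtain ⟨hv, θ, ψ, hθ, hψ, hsum⟩ := h
  refine ⟨fun t => hv _, fun t => -θ (-(t + 1)), -ψ, fun t => ?_, fun t => ?_, ?_⟩
  · have h1 := hθ (-(t + 1))
    rw [show -(t + 1) + 1 = -t by ring] at h1
    have h2 : v (vert (-(t + 1))) / v (vert (-t)) = (v (vert (-t)) / v (vert (-(t + 1))))⁻¹ :=
      (inv_div _ _).symm
    rw [h2, norm_inv]
    conv_lhs => rw [h1]
    rw [mul_inv, ← Complex.exp_neg]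
    simp
  · rw [← neg_sub', abs_neg]; exact hψ _
  · rw [Finset.sum_neg_distrib, show ∑ t, θ (-(t + 1)) = ∑ t, θ t from
      Equiv.sum_comp ((Equiv.addRight (1 : ZMod (len + 3))).trans (Equiv.neg _)) θ, hsum]
    push_cast; ring

lemma pathAff_congr {ι κ : Type*} {len : ℕ} {A : ι → ι → ℝ} {B : κ → κ → ℝ}
    {vert : ZMod (len + 3) → ι} {vert' : ZMod (len + 3) → κ} (e : Equiv.Perm (ZMod (len + 3)))
    (h1 : ∀ t, A (vert t) (vert (t + 1)) = B (vert' (e t)) (vert' (e t + 1)))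
    (h2 : ∀ t, A (vert (t + 1)) (vert t) = B (vert' (e t + 1)) (vert' (e t))) :
    pathAff A vert = pathAff B vert' := by
  unfold pathAff
  simp only [h1, h2]
  have hiff : (∀ t, 0 < B (vert' (e t + 1)) (vert' (e t))) ↔
      ∀ t, 0 < B (vert' (t + 1)) (vert' t) :=
    e.forall_congr_left.trans (by simp)
  have hsum : ∑ t, Real.log (B (vert' (e t)) (vert' (e t + 1)) / B (vert' (e t + 1)) (vert' (e t)))
      = ∑ t, Real.log (B (vert' t) (vert' (t + 1)) / B (vert' (t + 1)) (vert' t)) :=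
    Equiv.sum_comp e fun t => Real.log (B (vert' t) (vert' (t + 1)) / B (vert' (t + 1)) (vert' t))
  rw [hsum]
  exact if_congr hiff rfl rfl

lemma MCycle.tanhAff_eq_pathAff {n : ℕ} {R : Matrix (Fin n) (Fin n) ℝ} (c : MCycle n R) :
    c.tanhAff = pathAff (fun i j => R j i) c.vert := rfl

open Real in
/-- The cycle supplied by an eigenvector of the transpose of a matrix with nonnegative off-diagonal
entries and vanishing row or column sums. -/
lemma exists_cycle_of_eigenvector {n : ℕ} {B : Matrix (Fin n) (Fin n) ℝ}
    (hoff : ∀ i j, i ≠ j → 0 ≤ B i j) (hsum : (∀ i, ∑ j, B j i = 0) ∨ ∀ i, ∑ j, B i j = 0)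
    {r : ℝ} (hr : ∀ i, -B i i ≤ r) {v : Fin n → ℂ} (hv : v ≠ 0) {lam : ℂ}
    (heig : (B.map Complex.ofReal)ᵀ *ᵥ v = lam • v) {α β : ℝ} (hα : 0 ≤ α) (hβ : 0 ≤ β)
    (hαβ : 0 < α + β) (hlt : α * (-lam.re) + β * (2 * r + lam.re) < lam.im) :
    ∃ (len : ℕ) (vert : ZMod (len + 3) → Fin n) (W : ℤ), Function.Injective vert ∧
      (∀ t, 0 < B (vert (t + 1)) (vert t)) ∧ HasLift vert v W ∧ 1 ≤ W ∧ 2 * W < len + 3 ∧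
      α * tan (π * W / (len + 3)) + β * cot (π * W / (len + 3)) ≤
        pathAff (fun i j => B j i) vert := by
  classical
  let ι := {i : Fin n // v i ≠ 0}
  obtain ⟨i₀, hi₀⟩ := Function.ne_iff.1 hv
  have : Nonempty ι := ⟨⟨i₀, hi₀⟩⟩
  have hsub : ∀ {G : Type} [AddCommMonoid G] (f : Fin n → G),
      ∑ j : ι, f j = ∑ j ∈ Finset.univ.filter (fun j => v j ≠ 0), f j := fun f =>
    (Finset.sum_subtype _ (by simp) f).symm
  let A' : Fin n → Fin n → ℝ := fun i j => if i = j then 0 else B j i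
  have hA' : ∀ i j, 0 ≤ A' i j := by
    intro i j; simp only [A']; split_ifs with h
    · exact le_rfl
    · exact hoff j i (Ne.symm h)
  have hd : (∀ i : ι, ∑ j : ι, A' i j ≤ -B i i) ∨ ∀ i : ι, ∑ j : ι, A' j i ≤ -B i i := by
    refine hsum.imp (fun h i => ?_) fun h i => ?_
    · rw [hsub fun j => A' i j]
      refine (Finset.sum_le_sum_of_subset_of_nonneg (Finset.filter_subset _ _)
        fun j _ _ => hA' i j).trans ?_
      have h1 := h i
      rw [← Finset.add_sum_erase _ _ (Finset.mem_univ (i : Fin n))] at h1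
      rw [← Finset.add_sum_erase _ _ (Finset.mem_univ (i : Fin n))]
      have h2 : ∑ j ∈ Finset.univ.erase (i : Fin n), A' i j =
          ∑ j ∈ Finset.univ.erase (i : Fin n), B j i :=
        Finset.sum_congr rfl fun j hj => if_neg (Finset.ne_of_mem_erase hj).symm
      have h3 : A' i i = 0 := if_pos rfl
      linarith
    · rw [hsub fun j => A' j i]
      refine (Finset.sum_le_sum_of_subset_of_nonneg (Finset.filter_subset _ _)
        fun j _ _ => hA' j i).trans ?_
      have h1 := h i
      rw [← Finset.add_sum_erase _ _ (Finset.mem_univ (i : Fin n))] at h1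
      rw [← Finset.add_sum_erase _ _ (Finset.mem_univ (i : Fin n))]
      have h2 : ∑ j ∈ Finset.univ.erase (i : Fin n), A' j i =
          ∑ j ∈ Finset.univ.erase (i : Fin n), B i j :=
        Finset.sum_congr rfl fun j hj => if_neg (Finset.ne_of_mem_erase hj)
      have h3 : A' i i = 0 := if_pos rfl
      linarith
  have hloc : ∀ i : ι, ∑ j : ι, (A' i j : ℂ) * (v j / v i) = lam + (-B i i : ℝ) := by
    intro i
    have h1 : ∑ j, (B j i : ℂ) * v j = lam * v i := congrFun heig i
    rw [← Finset.add_sum_erase _ _ (Finset.mem_univ (i : Fin n))] at h1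
    rw [hsub fun j => (A' i j : ℂ) * (v j / v i), Finset.sum_filter_of_ne,
      ← Finset.add_sum_erase _ _ (Finset.mem_univ (i : Fin n))]
    · have h2 : ∑ j ∈ Finset.univ.erase (i : Fin n), (A' i j : ℂ) * (v j / v i) =
          (∑ j ∈ Finset.univ.erase (i : Fin n), (B j i : ℂ) * v j) / v i := by
        rw [Finset.sum_div]
        refine Finset.sum_congr rfl fun j hj => ?_
        simp only [A', if_neg (Finset.ne_of_mem_erase hj).symm]
        ring
      have h3 : A' i i = 0 := if_pos rfl
      have h4 := i.2
      rw [h2, h3, Complex.ofReal_zero, zero_mul, zero_add, div_eq_iff h4]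
      push_cast
      linear_combination h1
    · intro j _ hj h0
      simp [h0] at hj
  obtain ⟨len, vert, W, hinj, hpos, ⟨hv0, θ, ψ, hθ⟩, hW1, hW2, hle⟩ :=
    exists_cycle_hasLift (ι := ι) (A := fun i j => A' i j) (v := fun i => v i) (r := r)
      (fun i j => hA' i j) hd (fun i => hr i) (fun i => i.2) hloc hα hβ hαβ hlt
  have : Fact (1 < len + 3) := ⟨by omega⟩
  have hne : ∀ t, (vert t : Fin n) ≠ vert (t + 1) := by
    intro t h
    have := hinj (Subtype.ext h)
    simp at this
  have hAB : ∀ t, A' (vert t) (vert (t + 1)) = B (vert (t + 1)) (vert t) := fun t => if_neg (hne t)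
  have hBA : ∀ t, A' (vert (t + 1)) (vert t) = B (vert t) (vert (t + 1)) := fun t =>
    if_neg (hne t).symm
  refine ⟨len, fun t => vert t, W, Subtype.val_injective.comp hinj, fun t => ?_,
    ⟨hv0, θ, ψ, hθ⟩, hW1, hW2, hle.trans (pathAff_congr (Equiv.refl _) hAB hBA).le⟩
  rw [← hAB]; exact hpos t

lemma mulVec_conj_eigenvector {n : ℕ} {B : Matrix (Fin n) (Fin n) ℝ} {u : Fin n → ℂ} {lam : ℂ}
    (h : B.map Complex.ofReal *ᵥ u = lam • u) :
    B.map Complex.ofReal *ᵥ (fun i => (starRingEnd ℂ) (u i)) =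
      (starRingEnd ℂ) lam • fun i => (starRingEnd ℂ) (u i) := by
  funext i
  have h1 : ∑ j, (B i j : ℂ) * u j = lam * u i := congrFun h i
  have h2 := congrArg (starRingEnd ℂ) h1
  simp only [map_sum, map_mul, Complex.conj_ofReal] at h2
  exact h2

/-- Reversal of a cycle of the transposed generator. -/
def reverseCycle {n : ℕ} {R : Matrix (Fin n) (Fin n) ℝ} {len : ℕ} (vert : ZMod (len + 3) → Fin n)
    (hinj : Function.Injective vert) (hpos : ∀ t, 0 < R (vert t) (vert (t + 1))) : MCycle n R where
  len := len
  vert t := vert (-t)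
  inj := hinj.comp neg_injective
  pos t := by
    have := hpos (-(t + 1))
    rwa [show -(t + 1) + 1 = -t by ring] at this

open Real in
lemma exists_mcycle_of_im_pos {n : ℕ} {R : Matrix (Fin n) (Fin n) ℝ}
    (hoff : ∀ i j, i ≠ j → 0 ≤ R i j) (hcol : ∀ i, ∑ j, R j i = 0) {r : ℝ}
    (hr : ∀ i, -R i i ≤ r) {u : Fin n → ℂ} (hu : u ≠ 0) {lam : ℂ}
    (heig : (R.map Complex.ofReal)ᵀ *ᵥ u = lam • u ∨ R.map Complex.ofReal *ᵥ u = lam • u)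
    {α β : ℝ} (hα : 0 ≤ α) (hβ : 0 ≤ β) (hαβ : 0 < α + β)
    (hlt : α * (-lam.re) + β * (2 * r + lam.re) < lam.im) :
    ∃ (c : MCycle n R) (W : ℤ), (HasLift c.vert u W ∨ HasLift c.vert u (-W)) ∧ 1 ≤ W ∧
      2 * W < c.len + 3 ∧
      α * tan (π * W / (c.len + 3)) + β * cot (π * W / (c.len + 3)) ≤ c.tanhAff := by
  rcases heig with heig | heig
  · obtain ⟨len, vert, W, hinj, hpos, hlift, hW1, hW2, hle⟩ :=
      exists_cycle_of_eigenvector hoff (Or.inl hcol) hr hu heig hα hβ hαβ hlt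
    exact ⟨⟨len, vert, hinj, hpos⟩, W, Or.inl hlift, hW1, hW2, hle⟩
  · obtain ⟨len, vert, W, hinj, hpos, hlift, hW1, hW2, hle⟩ :=
      exists_cycle_of_eigenvector (B := Rᵀ) (fun i j hij => hoff j i hij.symm) (Or.inr hcol) hr hu
        heig hα hβ hαβ hlt
    refine ⟨reverseCycle vert hinj hpos, W, Or.inr hlift.reverse, hW1, hW2, hle.trans_eq ?_⟩
    rw [MCycle.tanhAff_eq_pathAff]
    refine pathAff_congr ((Equiv.addRight (1 : ZMod (len + 3))).trans (Equiv.neg _))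
      (fun t => ?_) fun t => ?_
    · change R (vert t) (vert (t + 1)) = R (vert (-(-(t + 1) + 1))) (vert (-(-(t + 1))))
      rw [neg_neg, show -(-(t + 1) + 1) = t by ring]
    · change R (vert (t + 1)) (vert t) = R (vert (-(-(t + 1)))) (vert (-(-(t + 1) + 1)))
      rw [neg_neg, show -(-(t + 1) + 1) = t by ring]

open Real in
/-- Admissible cycles for all pairs of weights satisfying a strict linear constraint. -/
lemma exists_mcycle_of_lt {n : ℕ} {R : Matrix (Fin n) (Fin n) ℝ}
    (hoff : ∀ i j, i ≠ j → 0 ≤ R i j) (hcol : ∀ i, ∑ j, R j i = 0) {r : ℝ}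
    (hr : ∀ i, -R i i ≤ r) {u : Fin n → ℂ} (hu : u ≠ 0) {lam : ℂ} (hlam : lam.im ≠ 0)
    (heig : (R.map Complex.ofReal)ᵀ *ᵥ u = lam • u ∨ R.map Complex.ofReal *ᵥ u = lam • u)
    {α β : ℝ} (hα : 0 ≤ α) (hβ : 0 ≤ β) (hαβ : 0 < α + β)
    (hlt : α * (-lam.re) + β * (2 * r + lam.re) < |lam.im|) :
    ∃ c : MCycle n R, c.Admissible u ∧ 1 ≤ c.winding u ∧ 2 * c.winding u < c.len + 3 ∧
      α * tan (π * c.winding u / (c.len + 3)) + β * cot (π * c.winding u / (c.len + 3)) ≤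
        c.tanhAff := by
  obtain ⟨c, W, hlift, hW1, hW2, hle⟩ : ∃ (c : MCycle n R) (W : ℤ),
      (HasLift c.vert u W ∨ HasLift c.vert u (-W)) ∧ 1 ≤ W ∧ 2 * W < c.len + 3 ∧
      α * tan (π * W / (c.len + 3)) + β * cot (π * W / (c.len + 3)) ≤ c.tanhAff := by
    rcases hlam.lt_or_gt with hneg | hpos
    · have hu' : (fun i => (starRingEnd ℂ) (u i)) ≠ 0 := by
        intro h
        refine hu (funext fun i => ?_)
        simpa using congrFun h i
      rw [abs_of_neg hneg] at hlt
      obtain ⟨c, W, hlift, h⟩ := exists_mcycle_of_im_pos hoff hcol hr hu' (lam := (starRingEnd ℂ) lam)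
        (heig.imp (fun h => mulVec_conj_eigenvector (B := Rᵀ) h) mulVec_conj_eigenvector)
        hα hβ hαβ (by simpa using hlt)
      refine ⟨c, W, ?_, h⟩
      rcases hlift with hlift | hlift
      · exact Or.inr hlift.of_conj
      · have := hlift.of_conj
        rw [neg_neg] at this
        exact Or.inl this
    · rw [abs_of_pos hpos] at hlt
      exact exists_mcycle_of_im_pos hoff hcol hr hu heig hα hβ hαβ hlt
  have hW2' : 2 * W < ((c.len + 3 : ℕ) : ℤ) := by exact_mod_cast hW2
  have hw : c.winding u = W := by
    rcases hlift with h | h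
    · rw [h.winding_eq, wrapIdx_of_lt_half hW1 hW2']
    · rw [h.winding_eq, wrapIdx_neg_of_lt_half hW1 hW2']
  refine ⟨c, ?_, ?_⟩
  · rcases hlift with h | h <;> exact h.admissible
  · rw [hw]; exact ⟨hW1, hW2, hle⟩

lemma MCycle.len_add_three_le {n : ℕ} {R : Matrix (Fin n) (Fin n) ℝ} (c : MCycle n R) :
    c.len + 3 ≤ n := by
  simpa [ZMod.card] using Fintype.card_le_of_injective c.vert c.inj

lemma MCycle.tanhAff_le_one {n : ℕ} {R : Matrix (Fin n) (Fin n) ℝ} (c : MCycle n R) :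
    c.tanhAff ≤ 1 := by
  unfold MCycle.tanhAff
  split_ifs
  · exact (Real.tanh_lt_one _).le
  · exact le_rfl

lemma finite_mcycle (n : ℕ) (R : Matrix (Fin n) (Fin n) ℝ) : Finite (MCycle n R) := by
  refine Finite.of_injective
    (β := Σ l : Fin n, ZMod ((l : ℕ) + 3) → Fin n)
    (fun c => ⟨⟨c.len, by have := c.len_add_three_le; omega⟩, c.vert⟩) ?_
  rintro ⟨l, v, _, _⟩ ⟨l', v', _, _⟩ h
  simp only [Sigma.mk.injEq, Fin.mk.injEq] at h
  obtain ⟨rfl, h⟩ := h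
  simpa using h

theorem multicyclic_main
    (n : ℕ) (hn : 3 ≤ n) (R : Matrix (Fin n) (Fin n) ℝ)
    (hoff : ∀ i j, i ≠ j → 0 ≤ R i j) (hcol : ∀ i, ∑ j, R j i = 0)
    (r : ℝ) (hr : IsGreatest (Set.range fun i => -R i i) r)
    (lam : ℂ) (hlam : lam.im ≠ 0)
    (u : Fin n → ℂ) (hu : u ≠ 0)
    (heig : (R.map Complex.ofReal)ᵀ *ᵥ u = lam • u ∨ R.map Complex.ofReal *ᵥ u = lam • u) :
    (-(2 * r) < lam.re ∧ lam.re < 0) ∧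
    ∀ τ : ℝ, 0 ≤ τ → τ ≤ 1 →
      ∃ c : MCycle n R, c.Admissible u ∧
        (1 ≤ c.winding u ∧ c.winding u ≤ ((c.len : ℤ) + 4) / 2 - 1) ∧
        τ * (|lam.im| / (-lam.re)) * Real.tan (Real.pi * (c.winding u : ℝ) / (c.len + 3)) +
          (1 - τ) * (|lam.im| / (2 * r + lam.re)) *
            Real.cot (Real.pi * (c.winding u : ℝ) / (c.len + 3)) ≤
        c.tanhAff := by
  have hr' : ∀ i, -R i i ≤ r := fun i => hr.2 ⟨i, rfl⟩
  have him : 0 < |lam.im| := abs_pos.2 hlam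
  have hn0 : (0 : ℝ) < n := by exact_mod_cast (by omega : 0 < n)
  have key : ∀ {α β : ℝ}, 0 ≤ α → 0 ≤ β → 0 < α + β →
      α * (-lam.re) + β * (2 * r + lam.re) < |lam.im| → _ := fun hα hβ hαβ hlt =>
    exists_mcycle_of_lt hoff hcol hr' hu hlam heig hα hβ hαβ hlt
  have hangle : ∀ c : MCycle n R, 1 ≤ c.winding u → 2 * c.winding u < c.len + 3 →
      Real.pi ≤ n * (Real.pi * (c.winding u : ℝ) / (c.len + 3)) ∧
      Real.pi ≤ n * (2 * (Real.pi / 2 - Real.pi * (c.winding u : ℝ) / (c.len + 3))) ∧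
      0 < Real.pi * (c.winding u : ℝ) / (c.len + 3) ∧
      0 < Real.pi / 2 - Real.pi * (c.winding u : ℝ) / (c.len + 3) := by
    intro c h1 h2
    have hm : (0 : ℝ) < c.len + 3 := by positivity
    have hmn : (c.len + 3 : ℝ) ≤ n := by exact_mod_cast c.len_add_three_le
    have h1' : (1 : ℝ) ≤ c.winding u := by exact_mod_cast h1
    have h2' : (2 * c.winding u + 1 : ℝ) ≤ c.len + 3 := by exact_mod_cast h2
    have hpi := Real.pi_pos
    have e1 : Real.pi / (c.len + 3) ≤ Real.pi * (c.winding u : ℝ) / (c.len + 3) := by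
      gcongr; nlinarith
    have e2 : Real.pi / (c.len + 3) ≤
        2 * (Real.pi / 2 - Real.pi * (c.winding u : ℝ) / (c.len + 3)) := by
      have : 2 * (Real.pi / 2 - Real.pi * (c.winding u : ℝ) / (c.len + 3)) =
          Real.pi * (c.len + 3 - 2 * c.winding u) / (c.len + 3) := by field_simp
      rw [this]
      gcongr; nlinarith
    have e3 : Real.pi ≤ n * (Real.pi / (c.len + 3)) := by
      rw [mul_div_assoc', le_div_iff₀ hm]; nlinarith
    have e4 : 0 < Real.pi / (c.len + 3) := by positivity
    exact ⟨e3.trans (by gcongr), e3.trans (by gcongr), by linarith, by linarith⟩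
  have hneg : lam.re < 0 := by
    by_contra! h
    obtain ⟨c, -, h1, h2, hle⟩ := key (α := n) (β := 0) hn0.le le_rfl (by linarith) (by nlinarith)
    obtain ⟨a1, -, a3, a4⟩ := hangle c h1 h2
    have := Real.lt_tan a3 (by linarith)
    have := c.tanhAff_le_one
    nlinarith [Real.pi_gt_three]
  have hlow : -(2 * r) < lam.re := by
    by_contra! h
    obtain ⟨c, -, h1, h2, hle⟩ := key (α := 0) (β := n) le_rfl hn0.le (by linarith) (by nlinarith)
    obtain ⟨-, a2, a3, a4⟩ := hangle c h1 h2
    have h3 := Real.lt_tan a4 (by linarith)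
    rw [Real.tan_pi_div_two_sub, Real.tan_inv_eq_cot] at h3
    have := c.tanhAff_le_one
    nlinarith [Real.pi_gt_three]
  refine ⟨⟨hlow, hneg⟩, fun τ hτ0 hτ1 => ?_⟩
  have hA : 0 < -lam.re := by linarith
  have hB : 0 < 2 * r + lam.re := by linarith
  set α := τ * (|lam.im| / (-lam.re)) with hα
  set β := (1 - τ) * (|lam.im| / (2 * r + lam.re)) with hβ
  have hα0 : 0 ≤ α := by positivity
  have hβ0 : 0 ≤ β := mul_nonneg (by linarith) (by positivity)
  have hsum : α * (-lam.re) + β * (2 * r + lam.re) = |lam.im| := by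
    rw [hα, hβ, mul_assoc, mul_assoc, div_mul_cancel₀ _ hA.ne', div_mul_cancel₀ _ hB.ne']; ring
  have hαβ : 0 < α + β := by
    by_contra! h
    have h1 : α = 0 := by linarith
    have h2 : β = 0 := by linarith
    rw [h1, h2] at hsum
    linarith
  have := finite_mcycle n R
  by_contra! hcon
  have hev : ∀ c : MCycle n R, ∀ᶠ η in nhdsWithin (0 : ℝ) (Set.Ioi 0),
      ¬(c.Admissible u ∧ 1 ≤ c.winding u ∧ 2 * c.winding u < c.len + 3 ∧
        (1 - η) * α * Real.tan (Real.pi * c.winding u / (c.len + 3)) +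
          (1 - η) * β * Real.cot (Real.pi * c.winding u / (c.len + 3)) ≤ c.tanhAff) := by
    intro c
    by_cases hc : c.Admissible u ∧ 1 ≤ c.winding u ∧ 2 * c.winding u < c.len + 3
    · have h1 := hcon c hc.1 ⟨hc.2.1, by have := hc.2.2; omega⟩
      have hcont : Continuous fun η : ℝ =>
          (1 - η) * α * Real.tan (Real.pi * c.winding u / (c.len + 3)) +
          (1 - η) * β * Real.cot (Real.pi * c.winding u / (c.len + 3)) := by fun_prop
      have h2 := (hcont.tendsto 0).eventually_const_lt (u := c.tanhAff) (by simpa using h1)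
      filter_upwards [h2.filter_mono nhdsWithin_le_nhds] with η hη h3
      linarith [h3.2.2.2]
    · exact Filter.Eventually.of_forall fun η h => hc ⟨h.1, h.2.1, h.2.2.1⟩
  obtain ⟨η, hη, hη01⟩ := ((Filter.eventually_all.2 hev).and
    (Ioo_mem_nhdsGT (zero_lt_one' ℝ))).exists
  have hη1 : 0 < 1 - η := by linarith [hη01.2]
  obtain ⟨c, hc⟩ := key (α := (1 - η) * α) (β := (1 - η) * β) (by positivity) (by positivity)
    (by rw [← mul_add]; positivity) (by
      have : (1 - η) * α * (-lam.re) + (1 - η) * β * (2 * r + lam.re) = (1 - η) * |lam.im| := by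
        rw [← hsum]; ring
      rw [this]
      nlinarith [hη01.1])
  exact hη c hc
end

section
/- Let R be a Markov generator on n ≥ 3 states with maximum escape rate r, and let λ be a nonreal eigenvalue of R. Then −2r < Re λ < 0 and there exists a cycle c of R with F_c > 0 such that |Im λ|/(−Re λ) ≤ tanh(F_c/(2n_c)) · cot(π/n_c). -/
open Matrix Finset

open Real in
theorem cot_two_edges {α β : ℝ} (hα : 0 < α) (hβ : 0 < β) (hαβ : α + β < π) (p q : ℂ) :
    cot (α + β) * Complex.normSq (p + q) + 2 * ((starRingEnd ℂ) p * q).im ≤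
      cot α * Complex.normSq p + cot β * Complex.normSq q := by
  have h1 : 0 < sin α := sin_pos_of_pos_of_lt_pi hα (by linarith)
  have h2 : 0 < sin β := sin_pos_of_pos_of_lt_pi hβ (by linarith)
  have h3 : 0 < sin (α + β) := sin_pos_of_pos_of_lt_pi (by linarith) hαβ
  have key : cot α * Complex.normSq p + cot β * Complex.normSq q -
      (cot (α + β) * Complex.normSq (p + q) + 2 * ((starRingEnd ℂ) p * q).im) =
      ((sin β * p.re - sin α * (cos (α + β) * q.re + sin (α + β) * q.im)) ^ 2 +
        (sin β * p.im - sin α * (cos (α + β) * q.im - sin (α + β) * q.re)) ^ 2) /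
        (sin α * sin β * sin (α + β)) := by
    rw [eq_div_iff (by positivity)]
    simp only [Complex.normSq_apply, Complex.add_re, Complex.add_im,
      Complex.mul_im, Complex.conj_re, Complex.conj_im]
    have e1 : sin β = sin (α + β) * cos α - cos (α + β) * sin α := by
      rw [← sin_sub]; ring_nf
    have e2 : sin α = sin (α + β) * cos β - cos (α + β) * sin β := by
      rw [← sin_sub]; ring_nf
    have e3 := sin_sq_add_cos_sq (α + β)
    have c1 : cot α * sin α = cos α := by rw [cot_eq_cos_div_sin, div_mul_cancel₀ _ h1.ne']
    have c2 : cot β * sin β = cos β := by rw [cot_eq_cos_div_sin, div_mul_cancel₀ _ h2.ne']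
    have c3 : cot (α + β) * sin (α + β) = cos (α + β) := by
      rw [cot_eq_cos_div_sin, div_mul_cancel₀ _ h3.ne']
    linear_combination (p.re * p.re + p.im * p.im) * (sin β * sin (α + β) * c1 - sin β * e1) +
      (q.re * q.re + q.im * q.im) *
        (sin α * sin (α + β) * c2 - sin α * e2 - sin α ^ 2 * e3) -
      ((p.re + q.re) * (p.re + q.re) + (p.im + q.im) * (p.im + q.im)) * sin α * sin β * c3
  have : 0 ≤ cot α * Complex.normSq p + cot β * Complex.normSq q -
      (cot (α + β) * Complex.normSq (p + q) + 2 * ((starRingEnd ℂ) p * q).im) := by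
    rw [key]; positivity
  linarith

theorem cot_sum_path (z : ℕ → ℂ) (θ : ℕ → ℝ) (hθ : ∀ t, 0 < θ t) (k : ℕ)
    (hk : ∑ t ∈ range (k + 1), θ t < Real.pi) :
    2 * ∑ t ∈ range (k + 1), ((starRingEnd ℂ) (z t) * z (t + 1)).im +
      2 * ((starRingEnd ℂ) (z (k + 1)) * z 0).im +
      Real.cot (∑ t ∈ range (k + 1), θ t) * Complex.normSq (z (k + 1) - z 0) ≤
    ∑ t ∈ range (k + 1), Real.cot (θ t) * Complex.normSq (z (t + 1) - z t) := by
  induction k with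
  | zero =>
    simp only [zero_add, sum_range_one, Complex.mul_im, Complex.conj_re, Complex.conj_im]
    linarith
  | succ k ih =>
    rw [sum_range_succ θ] at hk
    have ih := ih (by linarith [hθ (k + 1)])
    have hpos : 0 < ∑ t ∈ range (k + 1), θ t := sum_pos (fun t _ => hθ t) (by simp)
    have h := cot_two_edges hpos (hθ (k + 1)) hk (z (k + 1) - z 0) (z (k + 1 + 1) - z (k + 1))
    rw [sub_add_sub_comm, add_comm (z (k + 1)), add_sub_add_right_eq_sub] at h
    rw [sum_range_succ, sum_range_succ θ, sum_range_succ (fun t => Real.cot _ * _)]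
    have e : ((starRingEnd ℂ) (z (k + 1) - z 0) * (z (k + 1 + 1) - z (k + 1))).im =
        ((starRingEnd ℂ) (z (k + 1)) * z (k + 1 + 1)).im +
        ((starRingEnd ℂ) (z (k + 1 + 1)) * z 0).im -
        ((starRingEnd ℂ) (z (k + 1)) * z 0).im := by
      simp only [Complex.mul_im, Complex.conj_re, Complex.conj_im, Complex.sub_re, Complex.sub_im]
      ring
    rw [e] at h
    linarith

theorem neg_cot_le_cot {α β : ℝ} (hα : 0 < α) (hβ : 0 < β) (h : α + β ≤ Real.pi) :
    -Real.cot α ≤ Real.cot β := by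
  have h1 : 0 < Real.sin α :=
    Real.sin_pos_of_pos_of_lt_pi hα (by linarith)
  have h2 : 0 < Real.sin β := Real.sin_pos_of_pos_of_lt_pi hβ (by linarith)
  have h3 : 0 ≤ Real.sin (α + β) := Real.sin_nonneg_of_nonneg_of_le_pi (by linarith) h
  have : Real.cot α + Real.cot β = Real.sin (α + β) / (Real.sin α * Real.sin β) := by
    rw [Real.cot_eq_cos_div_sin, Real.cot_eq_cos_div_sin, Real.sin_add]
    field_simp
    ring
  have : 0 ≤ Real.cot α + Real.cot β := by rw [this]; positivity
  linarith

theorem sum_zmod_eq_sum_range (m : ℕ) [NeZero m] (f : ZMod m → ℝ) :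
    ∑ t, f t = ∑ k ∈ range m, f k := by
  symm
  refine sum_nbij (fun k => (k : ZMod m)) (by simp) ?_ ?_ (by simp)
  · intro a ha b hb hab
    simp only [coe_range, Set.mem_Iio] at ha hb
    have := congrArg ZMod.val hab
    rwa [ZMod.val_natCast_of_lt ha, ZMod.val_natCast_of_lt hb] at this
  · intro t _
    exact ⟨t.val, by simpa using ZMod.val_lt t, by simp⟩

theorem cot_sum_cycle (l : ℕ) (g : ZMod (l + 3) → ℂ) (θ : ZMod (l + 3) → ℝ)
    (hθ : ∀ t, 0 < θ t) (hsum : ∑ t, θ t ≤ Real.pi) :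
    2 * ∑ t, ((starRingEnd ℂ) (g t) * g (t + 1)).im ≤
      ∑ t, Real.cot (θ t) * Complex.normSq (g (t + 1) - g t) := by
  rw [sum_zmod_eq_sum_range] at hsum ⊢
  rw [sum_zmod_eq_sum_range]
  rw [sum_range_succ _ (l + 2)] at hsum ⊢
  rw [sum_range_succ _ (l + 2)]
  have h0 : ((l + 2 : ℕ) : ZMod (l + 3)) + 1 = 0 := by
    have := ZMod.natCast_self (l + 3)
    push_cast at this ⊢
    rw [← this]; ring
  have h := cot_sum_path (fun k => g k) (fun k => θ k) (fun k => hθ k) (l + 1)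
    (by linarith [hθ ((l + 2 : ℕ) : ZMod (l + 3))])
  have hpos : 0 < ∑ t ∈ range (l + 2), θ t := sum_pos (fun t _ => hθ t) (by simp)
  have hc := neg_cot_le_cot hpos (hθ ((l + 2 : ℕ) : ZMod (l + 3))) hsum
  rw [h0]
  simp only [Nat.cast_add, Nat.cast_one, Nat.cast_zero, Nat.cast_ofNat] at h hc ⊢
  have e : ((l : ZMod (l + 3)) + 1 + 1) = l + 2 := by ring
  rw [e] at h
  have hn : Complex.normSq (g 0 - g (l + 2)) = Complex.normSq (g (l + 2) - g 0) := by
    rw [← Complex.normSq_neg, neg_sub]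
  rw [hn]
  have := mul_le_mul_of_nonneg_right hc (Complex.normSq_nonneg (g (l + 2) - g 0))
  linarith

theorem exists_stationary {V : Type*} [Fintype V] [DecidableEq V] [Nonempty V]
    (W : V → V → ℝ) (hW : ∀ j i, 0 ≤ W j i) :
    ∃ p : V → ℝ, (∀ i, 0 ≤ p i) ∧ p ≠ 0 ∧ ∀ j, ∑ i, W j i * p i = (∑ i, W i j) * p j := by
  let G : Matrix V V ℝ := Matrix.of W - Matrix.diagonal fun j => ∑ i, W i j
  have hG : ∀ v j, (G *ᵥ v) j = ∑ i, W j i * v i - (∑ i, W i j) * v j := by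
    intro v j
    simp [G, Matrix.mulVec, dotProduct, Matrix.diagonal_apply, sub_mul, ite_mul]
  have hdet : G.det = 0 := by
    rw [← Matrix.exists_vecMul_eq_zero_iff]
    refine ⟨fun _ => 1, fun h => one_ne_zero (congrFun h (Classical.arbitrary V)), ?_⟩
    ext i
    simp [G, Matrix.vecMul, dotProduct, Matrix.diagonal_apply]
  obtain ⟨v, hv0, hv⟩ := Matrix.exists_mulVec_eq_zero_iff.mpr hdet
  have hle : ∀ j, (∑ i, W i j) * |v j| ≤ ∑ i, W j i * |v i| := by
    intro j
    have h := congrFun hv j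
    rw [hG, Pi.zero_apply, sub_eq_zero] at h
    calc (∑ i, W i j) * |v j| = |∑ i, W j i * v i| := by
          rw [h, abs_mul, abs_of_nonneg (sum_nonneg fun i _ => hW i j)]
      _ ≤ ∑ i, |W j i * v i| := abs_sum_le_sum_abs _ _
      _ = _ := by simp_rw [abs_mul, abs_of_nonneg (hW _ _)]
  have htot : ∑ j, (∑ i, W i j) * |v j| = ∑ j, ∑ i, W j i * |v i| := by
    rw [sum_comm]
    simp_rw [sum_mul]
  refine ⟨fun i => |v i|, fun i => abs_nonneg _, ?_, fun j => ?_⟩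
  · intro h
    exact hv0 (funext fun i => abs_eq_zero.mp (congrFun h i))
  · exact ((sum_eq_sum_iff_of_le fun j _ => hle j).mp htot j (mem_univ j)).symm

theorem exists_stationary_restriction {n : ℕ} (R : Matrix (Fin n) (Fin n) ℝ)
    (hoff : ∀ i j, i ≠ j → 0 ≤ R i j) (lam : ℂ) (u : Fin n → ℂ) (C : Finset (Fin n))
    (hu : ∃ i ∈ C, u i ≠ 0) (heig : ∀ i ∈ C, ∑ j ∈ C, (R j i : ℂ) * u j = lam * u i) :
    ∃ (C : Finset (Fin n)) (p : Fin n → ℝ), (∀ i, 0 ≤ p i) ∧ (∀ i ∉ C, p i = 0) ∧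
      (∃ i, p i ≠ 0 ∧ u i ≠ 0) ∧ (∀ i ∈ C, ∑ j ∈ C, (R j i : ℂ) * u j = lam * u i) ∧
      ∀ j ∈ C, ∑ i ∈ C, (if j = i then 0 else R j i) * p i =
        (∑ i ∈ C, if i = j then 0 else R i j) * p j := by
  induction C using Finset.strongInduction with
  | H C ih =>
    obtain ⟨i₀, hi₀, hui₀⟩ := hu
    have : Nonempty C := ⟨⟨i₀, hi₀⟩⟩
    obtain ⟨p, hp, hp0, hst⟩ := exists_stationary (V := C)
      (fun j i => if (j : Fin n) = i then 0 else R j i)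
      (fun j i => by split_ifs with h; exacts [le_rfl, hoff _ _ h])
    let q : Fin n → ℝ := fun i => if h : i ∈ C then p ⟨i, h⟩ else 0
    have hq : ∀ i : C, q i = p i := fun i => by simp [q]
    by_cases hex : ∃ i, q i ≠ 0 ∧ u i ≠ 0
    · refine ⟨C, q, fun i => ?_, fun i hi => by simp [q, hi], hex, heig, fun j hj => ?_⟩
      · by_cases h : i ∈ C
        · simpa [q, h] using hp ⟨i, h⟩
        · simp [q, h]
      · have := hst ⟨j, hj⟩
        simp_rw [← hq] at this
        rwa [sum_coe_sort C (fun i => (if j = i then 0 else R j i) * q i),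
          sum_coe_sort C (fun i => if i = j then 0 else R i j)] at this
    · push Not at hex
      have hres : ∀ f : Fin n → ℂ, ∑ j ∈ C with q j = 0, f j * u j = ∑ j ∈ C, f j * u j := by
        intro f
        refine sum_subset (filter_subset _ _) fun j hj hj' => ?_
        rw [hex j (fun h => hj' (by simp [hj, h])), mul_zero]
      refine ih (C.filter fun i => q i = 0) ?_ ?_ ?_
      · refine filter_ssubset.mpr ?_
        by_contra! h
        exact hp0 (funext fun i => by rw [← hq]; exact h i i.2)
      · refine ⟨i₀, mem_filter.mpr ⟨hi₀, ?_⟩, hui₀⟩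
        by_contra h
        exact hui₀ (hex _ h)
      · intro i hi
        rw [hres]
        exact heig i (mem_filter.mp hi).1

theorem hasDerivAt_arctan_mul_tanh (κ y : ℝ) :
    HasDerivAt (fun y => Real.arctan (κ * Real.tanh y))
      (κ / (1 + (1 + κ ^ 2) * Real.sinh y ^ 2)) y := by
  have hc := Real.cosh_pos y
  have hsq := Real.cosh_sq y
  have h : HasDerivAt Real.tanh (1 / Real.cosh y ^ 2) y := by
    have := (Real.hasDerivAt_sinh y).div (Real.hasDerivAt_cosh y) hc.ne'
    refine (this.congr_deriv ?_).congr_of_eventuallyEq ?_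
    · congr 1
      linarith
    · exact Filter.Eventually.of_forall fun y => Real.tanh_eq_sinh_div_cosh y
  refine (h.const_mul κ).arctan.congr_deriv ?_
  rw [Real.tanh_eq_sinh_div_cosh, ← mul_div_assoc, div_pow]
  have : 0 < 1 + (1 + κ ^ 2) * Real.sinh y ^ 2 := by positivity
  field_simp
  rw [hsq]
  ring

theorem concaveOn_arctan_mul_tanh {κ : ℝ} (hκ : 0 ≤ κ) :
    ConcaveOn ℝ (Set.Ici 0) fun y => Real.arctan (κ * Real.tanh y) := by
  refine AntitoneOn.concaveOn_of_deriv (convex_Ici 0)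
    (fun y _ => (hasDerivAt_arctan_mul_tanh κ y).continuousAt.continuousWithinAt)
    (fun y _ => (hasDerivAt_arctan_mul_tanh κ y).differentiableAt.differentiableWithinAt) ?_
  intro a ha b hb hab
  rw [interior_Ici, Set.mem_Ioi] at ha hb
  rw [(hasDerivAt_arctan_mul_tanh κ a).deriv, (hasDerivAt_arctan_mul_tanh κ b).deriv]
  have : 0 ≤ Real.sinh a := Real.sinh_nonneg_iff.mpr ha.le
  have : Real.sinh a ≤ Real.sinh b := Real.sinh_le_sinh.mpr hab
  gcongr

theorem cot_pi_div_pos (l : ℕ) : 0 < Real.cot (Real.pi / (l + 3)) := by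
  have hlt : Real.pi / (l + 3) < Real.pi / 2 :=
    div_lt_div_of_pos_left Real.pi_pos (by norm_num) (by linarith [l.cast_nonneg (α := ℝ)])
  rw [← Real.tan_inv_eq_cot]
  exact inv_pos.mpr (Real.tan_pos_of_pos_of_lt_pi_div_two (by positivity) hlt)

theorem arctan_inv_cot_pi_div (l : ℕ) :
    Real.arctan (Real.cot (Real.pi / (l + 3)))⁻¹ = Real.pi / (l + 3) := by
  have hlt : Real.pi / (l + 3) < Real.pi / 2 :=
    div_lt_div_of_pos_left Real.pi_pos (by norm_num) (by linarith [l.cast_nonneg (α := ℝ)])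
  have h0 : 0 < Real.pi / (l + 3) := by positivity
  rw [← Real.tan_inv_eq_cot, inv_inv]
  exact Real.arctan_tan (by linarith) hlt

theorem tanh_half_log {f b : ℝ} (hf : 0 < f) (hb : 0 < b) :
    Real.tanh (Real.log (f / b) / 2) = (f - b) / (f + b) := by
  have h : Real.exp (Real.log (f / b) / 2) ^ 2 = f / b := by
    rw [← Real.exp_nat_mul]
    push_cast
    rw [mul_div_cancel₀ _ two_ne_zero, Real.exp_log (by positivity)]
  have he := Real.exp_pos (Real.log (f / b) / 2)
  rw [Real.tanh_eq_sinh_div_cosh, Real.sinh_eq, Real.cosh_eq, Real.exp_neg]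
  generalize Real.exp (Real.log (f / b) / 2) = e at *
  rw [eq_div_iff hb.ne'] at h
  field_simp
  rw [← h]
  ring

open Classical in
theorem sum_arctan_asymmetry_le (l : ℕ) (f b : ZMod (l + 3) → ℝ) (hb : ∀ t, 0 ≤ b t)
    (hbf : ∀ t, b t < f t) (T : ℝ)
    (hT : T = if ∀ t, 0 < b t then
      Real.tanh ((∑ t, Real.log (f t / b t)) / (2 * (l + 3))) else 1) :
    0 < T ∧ ∑ t, Real.arctan ((f t - b t) / (f t + b t) / (T * Real.cot (Real.pi / (l + 3)))) ≤
      Real.pi := by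
  have hm : (0 : ℝ) < l + 3 := by positivity
  have hf : ∀ t, 0 < f t := fun t => (hb t).trans_lt (hbf t)
  have hcot := cot_pi_div_pos l
  have hcard : ∑ _t : ZMod (l + 3), Real.pi / (l + 3) = Real.pi := by
    rw [sum_const, card_univ, ZMod.card, nsmul_eq_mul]
    push_cast
    field_simp
  split_ifs at hT with hpos
  · set y : ZMod (l + 3) → ℝ := fun t => Real.log (f t / b t) / 2 with hy
    have hy0 : ∀ t, 0 < y t := fun t =>
      half_pos (Real.log_pos ((one_lt_div (hpos t)).mpr (hbf t)))
    have havg : (∑ t, Real.log (f t / b t)) / (2 * (l + 3)) = ∑ t, (1 / (l + 3 : ℝ)) * y t := by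
      rw [← mul_sum, hy, ← sum_div]
      field_simp
    rw [havg] at hT
    have hT0 : 0 < T := by
      rw [hT, Real.tanh_eq_sinh_div_cosh]
      refine div_pos (Real.sinh_pos_iff.mpr ?_) (Real.cosh_pos _)
      exact sum_pos (fun t _ => mul_pos (by positivity) (hy0 t)) univ_nonempty
    refine ⟨hT0, ?_⟩
    have hJ := (concaveOn_arctan_mul_tanh
        (κ := (T * Real.cot (Real.pi / (l + 3)))⁻¹) (by positivity)).le_map_sum
      (t := univ) (w := fun _ : ZMod (l + 3) => 1 / (l + 3 : ℝ)) (p := y)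
      (fun _ _ => by positivity)
      (by rw [sum_const, card_univ, ZMod.card, nsmul_eq_mul]; push_cast; field_simp)
      (fun t _ => (hy0 t).le)
    simp only [smul_eq_mul] at hJ
    rw [← mul_sum, ← hT, mul_inv, mul_right_comm, inv_mul_cancel₀ hT0.ne', one_mul,
      arctan_inv_cot_pi_div, one_div, inv_mul_eq_div, div_le_div_iff_of_pos_right hm] at hJ
    refine (sum_congr rfl fun t _ => ?_).trans_le hJ
    rw [← tanh_half_log (hf t) (hpos t), ← mul_inv, div_eq_inv_mul]
  · subst hT
    refine ⟨one_pos, ?_⟩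
    refine (sum_le_sum fun t _ => ?_).trans_eq hcard
    rw [one_mul, div_eq_mul_inv]
    refine (Real.arctan_strictMono.monotone ?_).trans_eq (arctan_inv_cot_pi_div l)
    refine mul_le_of_le_one_left (inv_nonneg.mpr hcot.le) ?_
    rw [div_le_one (by linarith [hf t, hb t])]
    linarith [hb t]

theorem weighted_isoperimetric (l : ℕ) (g : ZMod (l + 3) → ℂ) (x : ZMod (l + 3) → ℝ)
    (hx : ∀ t, 0 < x t) {K : ℝ} (hK : 0 < K) (hsum : ∑ t, Real.arctan (x t / K) ≤ Real.pi) :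
    2 * ∑ t, ((starRingEnd ℂ) (g t) * g (t + 1)).im ≤
      K * ∑ t, Complex.normSq (g (t + 1) - g t) / x t := by
  refine (cot_sum_cycle l g (fun t => Real.arctan (x t / K))
    (fun t => Real.arctan_pos.mpr (div_pos (hx t) hK)) hsum).trans_eq ?_
  rw [mul_sum]
  refine sum_congr rfl fun t _ => ?_
  rw [← Real.tan_inv_eq_cot, Real.tan_arctan, inv_div]
  ring

theorem MCycle.exists_of_balanced {n : ℕ} (J : Matrix (Fin n) (Fin n) ℝ)
    (hJ : ∀ j i, 0 ≤ J j i) (hbal : ∀ i, ∑ j, J j i = ∑ j, J i j)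
    (hanti : ∀ j i, 0 < J j i → J i j = 0) (hne : ∃ j i, 0 < J j i) :
    Nonempty (MCycle n J) := by
  have hex : ∀ i, ∃ j, (∃ k, 0 < J k i) → 0 < J j i := by
    intro i
    by_cases h : ∃ k, 0 < J k i
    · exact ⟨h.choose, fun _ => h.choose_spec⟩
    · exact ⟨i, fun h' => absurd h' h⟩
  choose f hf using hex
  obtain ⟨j₀, i₀, h₀⟩ := hne
  have hout : ∀ k, ∃ j, 0 < J j (f^[k] i₀) := by
    intro k
    induction k with
    | zero => exact ⟨j₀, h₀⟩
    | succ k ih =>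
      rw [Function.iterate_succ_apply']
      have h1 : 0 < ∑ j, J j (f (f^[k] i₀)) := by
        rw [hbal]
        exact (hf _ ih).trans_le (single_le_sum (f := fun j => J (f (f^[k] i₀)) j)
          (fun j _ => hJ _ j) (mem_univ (f^[k] i₀)))
      obtain ⟨j, -, hj⟩ := exists_lt_of_sum_lt (s := univ) (f := fun _ : Fin n => (0 : ℝ))
        (g := fun j => J j (f (f^[k] i₀))) (by simpa using h1)
      exact ⟨j, hj⟩
  obtain ⟨a, b, hab, heq⟩ : ∃ a b, a < b ∧ f^[a] i₀ = f^[b] i₀ := by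
    obtain ⟨a, b, hne, h⟩ := Finite.exists_ne_map_eq_of_infinite fun k => f^[k] i₀
    rcases hne.lt_or_gt with h' | h'
    exacts [⟨a, b, h', h⟩, ⟨b, a, h', h.symm⟩]
  set y := f^[a] i₀ with hy
  have hper : y ∈ Function.periodicPts f := by
    refine ⟨b - a, by omega, ?_⟩
    rw [Function.IsPeriodicPt, Function.IsFixedPt, hy, ← Function.iterate_add_apply,
      Nat.sub_add_cancel hab.le, ← heq]
  have hstep : ∀ k, 0 < J (f^[k + 1] y) (f^[k] y) := by
    intro k
    rw [Function.iterate_succ_apply', hy, ← Function.iterate_add_apply]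
    exact hf _ (hout _)
  have hm0 := Function.minimalPeriod_pos_of_mem_periodicPts hper
  have hm := Function.iterate_minimalPeriod (f := f) (x := y)
  have hm3 : 3 ≤ Function.minimalPeriod f y := by
    by_contra! hlt
    interval_cases h : Function.minimalPeriod f y
    · have h1 := hstep 0
      rw [zero_add, hm, Function.iterate_zero_apply] at h1
      exact h1.ne' (hanti _ _ h1)
    · have h1 := hstep 1
      rw [one_add_one_eq_two, hm] at h1
      exact (hstep 0).ne' (hanti _ _ h1)
  obtain ⟨l, hl⟩ := Nat.exists_eq_add_of_le' hm3
  refine ⟨⟨l, fun t => f^[t.val] y, fun s t hst => ?_, fun t => ?_⟩⟩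
  · refine ZMod.val_injective _ (Function.iterate_injOn_Iio_minimalPeriod ?_ ?_ hst) <;>
    · rw [hl]
      exact ZMod.val_lt _
  · have : (t + 1).val = (t.val + 1) % (l + 3) := by
      rw [ZMod.val_add, ZMod.val_one'' (by omega)]
    have hmod : f^[(t.val + 1) % (l + 3)] y = f^[t.val + 1] y := by
      conv_lhs => rw [show (t.val + 1) % (l + 3) =
        (t.val + 1) % Function.minimalPeriod f y from congrArg _ hl.symm]
      exact Function.iterate_mod_minimalPeriod_eq
    simpa only [this, hmod] using hstep t.val

theorem exists_lt_sum_mul_le_of_cycles {n : ℕ} (J : Matrix (Fin n) (Fin n) ℝ)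
    (hJ : ∀ j i, 0 ≤ J j i) (hbal : ∀ i, ∑ j, J j i = ∑ j, J i j)
    (hanti : ∀ j i, 0 < J j i → J i j = 0) (g h : Fin n → Fin n → ℝ)
    (hg : ∀ j i, 0 ≤ g j i) {K : ℝ} (hK : 0 < K)
    (hc : ∀ c : MCycle n J, ∃ k < K, ∑ t, h (c.vert (t + 1)) (c.vert t) ≤
      k * ∑ t, g (c.vert (t + 1)) (c.vert t)) :
    ∃ k < K, 0 ≤ k ∧ ∑ j, ∑ i, J j i * h j i ≤ k * ∑ j, ∑ i, J j i * g j i := by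
  induction hN : #{e : Fin n × Fin n | 0 < J e.1 e.2} using Nat.strong_induction_on
    generalizing J with
  | _ N ih =>
  by_cases hne : ∃ j i, 0 < J j i
  swap
  · push Not at hne
    have hz : ∀ j i, J j i = 0 := fun j i => le_antisymm (hne j i) (hJ j i)
    exact ⟨0, hK, le_rfl, by simp [hz]⟩
  obtain ⟨c⟩ := MCycle.exists_of_balanced J hJ hbal hanti hne
  obtain ⟨t₀, -, ht₀⟩ := exists_min_image univ (fun t => J (c.vert (t + 1)) (c.vert t))
    univ_nonempty
  set m := J (c.vert (t₀ + 1)) (c.vert t₀) with hm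
  have hm0 : 0 < m := c.pos t₀
  let E : Fin n → Fin n → ℝ := fun j i => ∑ t, if c.vert (t + 1) = j ∧ c.vert t = i then 1 else 0
  have hE1 : ∀ t, E (c.vert (t + 1)) (c.vert t) = 1 := by
    intro t
    rw [show E (c.vert (t + 1)) (c.vert t) = _ from Fintype.sum_eq_single t fun s hs =>
      if_neg fun h' => hs (c.inj h'.2)]
    simp
  have hEsum : ∀ φ : Fin n → Fin n → ℝ,
      ∑ j, ∑ i, E j i * φ j i = ∑ t, φ (c.vert (t + 1)) (c.vert t) := by
    intro φ
    simp_rw [E, sum_mul, ite_mul, one_mul, zero_mul, ite_and]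
    simp_rw [sum_comm (t := (univ : Finset (ZMod (c.len + 3))))]
    refine sum_congr rfl fun t _ => ?_
    simp
  have hEbal : ∀ i, ∑ j, E j i = ∑ j, E i j := by
    intro i
    calc ∑ j, E j i = ∑ t, if c.vert t = i then (1 : ℝ) else 0 := by
          simp_rw [E]
          rw [sum_comm]
          exact sum_congr rfl fun t _ => by simp [ite_and]
      _ = ∑ t, if c.vert (t + 1) = i then (1 : ℝ) else 0 :=
          (Equiv.sum_comp (Equiv.addRight 1) fun t => if c.vert t = i then (1 : ℝ) else 0).symm
      _ = ∑ j, E i j := by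
          simp_rw [E]
          rw [sum_comm]
          exact sum_congr rfl fun t _ => by simp [ite_and]
  have hJ'val : ∀ j i, J j i - m * E j i ≤ J j i ∧ 0 ≤ J j i - m * E j i := by
    intro j i
    by_cases hex : ∃ t, c.vert (t + 1) = j ∧ c.vert t = i
    · obtain ⟨t, rfl, rfl⟩ := hex
      rw [hE1]
      have := ht₀ t (mem_univ t)
      constructor <;> linarith
    · have : E j i = 0 := sum_eq_zero fun t _ => if_neg fun h' => hex ⟨t, h'⟩
      rw [this]
      have := hJ j i
      constructor <;> linarith
  have hpos : ∀ j i, 0 < J j i - m * E j i → 0 < J j i :=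
    fun j i hp => hp.trans_le (hJ'val j i).1
  obtain ⟨k, hk, hk0, hle⟩ := ih _ (by
      rw [← hN]
      refine card_lt_card (ssubset_iff_of_subset (fun e he => ?_)|>.mpr
        ⟨(c.vert (t₀ + 1), c.vert t₀), ?_, ?_⟩)
      · simp only [mem_filter, mem_univ, true_and] at he ⊢
        exact hpos _ _ he
      · simpa using c.pos t₀
      · simp [hE1, ← hm])
    (Matrix.of fun j i => J j i - m * E j i) (fun j i => (hJ'val j i).2)
    (fun i => by simp [← mul_sum, hbal, hEbal])
    (fun j i hp => by
      have h1 := hanti j i (hpos j i hp)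
      have h2 := hJ'val i j
      simp only [Matrix.of_apply]
      linarith)
    (fun c' => hc ⟨c'.len, c'.vert, c'.inj, fun t => hpos _ _ (c'.pos t)⟩) rfl
  obtain ⟨k', hk', hle'⟩ := hc c
  have hsplit : ∀ φ : Fin n → Fin n → ℝ, ∑ j, ∑ i, J j i * φ j i =
      ∑ j, ∑ i, (J j i - m * E j i) * φ j i + m * ∑ t, φ (c.vert (t + 1)) (c.vert t) := by
    intro φ
    rw [← hEsum, mul_sum, ← sum_add_distrib]
    refine sum_congr rfl fun j _ => ?_
    rw [mul_sum, ← sum_add_distrib]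
    exact sum_congr rfl fun i _ => by ring
  refine ⟨max k k', max_lt hk hk', hk0.trans (le_max_left _ _), ?_⟩
  rw [hsplit, hsplit, mul_add]
  have hG1 : 0 ≤ ∑ j, ∑ i, (J j i - m * E j i) * g j i :=
    sum_nonneg fun j _ => sum_nonneg fun i _ => mul_nonneg (hJ'val j i).2 (hg j i)
  have hG2 : 0 ≤ ∑ t, g (c.vert (t + 1)) (c.vert t) := sum_nonneg fun t _ => hg _ _
  refine add_le_add (hle.trans (mul_le_mul_of_nonneg_right (le_max_left _ _) hG1)) ?_
  rw [mul_left_comm]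
  exact mul_le_mul_of_nonneg_left
    (hle'.trans (mul_le_mul_of_nonneg_right (le_max_right _ _) hG2)) hm0.le

/-- The net current of a flow `w`: the positive part of its antisymmetrization. -/
def netCurrent {n : ℕ} (w : Matrix (Fin n) (Fin n) ℝ) : Matrix (Fin n) (Fin n) ℝ :=
  Matrix.of fun j i => max (w j i - w i j) 0

theorem netCurrent_pos_iff {n : ℕ} {w : Matrix (Fin n) (Fin n) ℝ} {j i : Fin n} :
    0 < netCurrent w j i ↔ w i j < w j i := by
  simp [netCurrent]

theorem netCurrent_sub_swap {n : ℕ} (w : Matrix (Fin n) (Fin n) ℝ) (j i : Fin n) :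
    netCurrent w j i - netCurrent w i j = w j i - w i j := by
  simp only [netCurrent, Matrix.of_apply]
  rcases le_total (w j i) (w i j) with h | h
  · rw [max_eq_right (by linarith), max_eq_left (by linarith)]; ring
  · rw [max_eq_left (by linarith), max_eq_right (by linarith)]; ring

theorem netCurrent_balanced {n : ℕ} {w : Matrix (Fin n) (Fin n) ℝ}
    (hbal : ∀ i, ∑ j, w j i = ∑ j, w i j) (i : Fin n) :
    ∑ j, netCurrent w j i = ∑ j, netCurrent w i j := by
  rw [← sub_eq_zero, ← sum_sub_distrib]
  simp_rw [netCurrent_sub_swap]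
  rw [sum_sub_distrib, hbal, sub_self]

theorem sum_sum_netCurrent_mul {n : ℕ} (w : Matrix (Fin n) (Fin n) ℝ) (h : Fin n → Fin n → ℝ)
    (hh : ∀ j i, h i j = -h j i) :
    ∑ j, ∑ i, netCurrent w j i * h j i = ∑ j, ∑ i, w j i * h j i := by
  have key : ∀ W : Matrix (Fin n) (Fin n) ℝ,
      2 * ∑ j, ∑ i, W j i * h j i = ∑ j, ∑ i, (W j i - W i j) * h j i := by
    intro W
    have : ∑ j, ∑ i, W i j * h j i = -∑ j, ∑ i, W j i * h j i := by
      rw [sum_comm, ← sum_neg_distrib]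
      refine sum_congr rfl fun j _ => ?_
      rw [← sum_neg_distrib]
      exact sum_congr rfl fun i _ => by rw [hh j i, mul_neg]
    simp_rw [sub_mul, sum_sub_distrib, this]
    ring
  have h1 := key (netCurrent w)
  simp_rw [netCurrent_sub_swap, ← key w] at h1
  linarith

theorem sum_sum_netCurrent_mul_div_le {n : ℕ} (w : Matrix (Fin n) (Fin n) ℝ)
    (hw : ∀ j i, 0 ≤ w j i) (d : Fin n → Fin n → ℝ) (hd : ∀ j i, 0 ≤ d j i)
    (hsymm : ∀ j i, d i j = d j i) :
    ∑ j, ∑ i, netCurrent w j i * (d j i / ((w j i - w i j) / (w j i + w i j))) ≤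
      ∑ j, ∑ i, w j i * d j i := by
  set G : Fin n → Fin n → ℝ := fun j i =>
    netCurrent w j i * (d j i / ((w j i - w i j) / (w j i + w i j))) with hG
  have hpt : ∀ j i, G j i + G i j ≤ w j i * d j i + w i j * d i j := by
    have hlt : ∀ j i, w i j < w j i → G j i + G i j = w j i * d j i + w i j * d i j := by
      intro j i h
      have h1 : 0 < w j i - w i j := sub_pos.mpr h
      have h2 : 0 < w j i + w i j := by linarith [hw i j]
      simp only [hG, netCurrent, Matrix.of_apply]
      rw [max_eq_left h1.le, max_eq_right (by linarith), hsymm j i]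
      field_simp
      ring
    intro j i
    rcases lt_trichotomy (w i j) (w j i) with h | h | h
    · exact (hlt j i h).le
    · have := mul_nonneg (hw j i) (hd j i)
      have := mul_nonneg (hw i j) (hd i j)
      simp only [hG, netCurrent, Matrix.of_apply, h, sub_self, max_self, zero_mul]
      rw [h] at this
      linarith
    · rw [add_comm, (hlt i j h), add_comm]
  have hs : ∀ F : Fin n → Fin n → ℝ, ∑ j, ∑ i, (F j i + F i j) = 2 * ∑ j, ∑ i, F j i := by
    intro F
    simp_rw [sum_add_distrib]
    rw [sum_comm (f := fun j i => F i j)]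
    ring
  have h1 := hs G
  have h2 := hs fun j i => w j i * d j i
  have h3 : ∑ j, ∑ i, (G j i + G i j) ≤ ∑ j, ∑ i, (w j i * d j i + w i j * d i j) :=
    sum_le_sum fun j _ => sum_le_sum fun i _ => hpt j i
  rw [h1, h2] at h3
  exact le_of_mul_le_mul_left h3 two_pos

theorem sum_log_ratio_scaled {n : ℕ} {R w : Matrix (Fin n) (Fin n) ℝ} {p : Fin n → ℝ}
    (l : ℕ) (v : ZMod (l + 3) → Fin n) (hp : ∀ t, 0 < p (v t))
    (hR : ∀ t, 0 < R (v (t + 1)) (v t)) (hR' : ∀ t, 0 < R (v t) (v (t + 1)))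
    (hw : ∀ t, w (v (t + 1)) (v t) = R (v (t + 1)) (v t) * p (v t))
    (hw' : ∀ t, w (v t) (v (t + 1)) = R (v t) (v (t + 1)) * p (v (t + 1))) :
    ∑ t, Real.log (w (v (t + 1)) (v t) / w (v t) (v (t + 1))) =
      ∑ t, Real.log (R (v (t + 1)) (v t) / R (v t) (v (t + 1))) := by
  have h : ∀ t, Real.log (w (v (t + 1)) (v t) / w (v t) (v (t + 1))) =
      Real.log (R (v (t + 1)) (v t) / R (v t) (v (t + 1))) +
        (Real.log (p (v t)) - Real.log (p (v (t + 1)))) := by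
    intro t
    have := hp t
    have := hp (t + 1)
    have := hR t
    have := hR' t
    rw [hw, hw', mul_div_mul_comm, Real.log_mul (by positivity) (by positivity),
      Real.log_div (hp t).ne' (hp (t + 1)).ne']
  have hshift : ∑ t, Real.log (p (v (t + 1))) = ∑ t, Real.log (p (v t)) :=
    Equiv.sum_comp (Equiv.addRight (1 : ZMod (l + 3))) fun t => Real.log (p (v t))
  simp_rw [h]
  rw [sum_add_distrib, sum_sub_distrib, hshift, sub_self, add_zero]

/-- A cycle of the net current of a flow proportional to `R` is a cycle of `R` of positive
affinity, and satisfies a weighted isoperimetric inequality. -/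
theorem MCycle.exists_of_netCurrent {n : ℕ} {R w : Matrix (Fin n) (Fin n) ℝ} {p : Fin n → ℝ}
    (hw : ∀ j i, 0 ≤ w j i) (hp : ∀ i, 0 ≤ p i)
    (hwR : ∀ j i, j ≠ i → p j ≠ 0 → p i ≠ 0 → w j i = R j i * p i)
    (hwle : ∀ j i, w j i ≠ 0 → p i ≠ 0) (c : MCycle n (netCurrent w)) (u : Fin n → ℂ) :
    ∃ c' : MCycle n R, c'.affPos ∧
      2 * ∑ t, ((starRingEnd ℂ) (u (c.vert t)) * u (c.vert (t + 1))).im ≤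
      c'.tanhAff * Real.cot (Real.pi / (c'.len + 3)) *
        ∑ t, Complex.normSq (u (c.vert (t + 1)) - u (c.vert t)) /
          ((w (c.vert (t + 1)) (c.vert t) - w (c.vert t) (c.vert (t + 1))) /
            (w (c.vert (t + 1)) (c.vert t) + w (c.vert t) (c.vert (t + 1)))) := by
  have hlt : ∀ t, w (c.vert t) (c.vert (t + 1)) < w (c.vert (t + 1)) (c.vert t) :=
    fun t => netCurrent_pos_iff.mp (c.pos t)
  have hwpos : ∀ t, 0 < w (c.vert (t + 1)) (c.vert t) := fun t => (hw _ _).trans_lt (hlt t)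
  have hp0 : ∀ t, p (c.vert t) ≠ 0 := fun t => hwle _ _ (hwpos t).ne'
  have hpp : ∀ t, 0 < p (c.vert t) := fun t => (hp _).lt_of_ne' (hp0 t)
  have hne : ∀ t, c.vert (t + 1) ≠ c.vert t := by
    intro t h
    have := hlt t
    rw [h] at this
    exact this.false
  have hf : ∀ t, w (c.vert (t + 1)) (c.vert t) = R (c.vert (t + 1)) (c.vert t) * p (c.vert t) :=
    fun t => hwR _ _ (hne t) (hp0 _) (hp0 _)
  have hb : ∀ t, w (c.vert t) (c.vert (t + 1)) =
      R (c.vert t) (c.vert (t + 1)) * p (c.vert (t + 1)) :=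
    fun t => hwR _ _ (hne t).symm (hp0 _) (hp0 _)
  have hRf : ∀ t, 0 < R (c.vert (t + 1)) (c.vert t) := by
    intro t
    have := hwpos t
    rw [hf] at this
    exact pos_of_mul_pos_left this (hp _)
  have hRb : ∀ t, 0 < R (c.vert t) (c.vert (t + 1)) ↔ 0 < w (c.vert t) (c.vert (t + 1)) := by
    intro t
    rw [hb, mul_pos_iff_of_pos_right (hpp _)]
  refine ⟨⟨c.len, c.vert, c.inj, hRf⟩, fun hrev => ?_, ?_⟩
  · change 0 < ∑ t : ZMod (c.len + 3), _
    rw [← sum_log_ratio_scaled c.len c.vert hpp hRf hrev hf hb]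
    exact sum_pos (fun t _ => Real.log_pos ((one_lt_div ((hRb t).mp (hrev t))).mpr (hlt t)))
      univ_nonempty
  · obtain ⟨hT, hsum⟩ := sum_arctan_asymmetry_le c.len
      (fun t => w (c.vert (t + 1)) (c.vert t)) (fun t => w (c.vert t) (c.vert (t + 1)))
      (fun t => hw _ _) hlt (MCycle.tanhAff ⟨c.len, c.vert, c.inj, hRf⟩) (by
        simp only [MCycle.tanhAff, hRb]
        split_ifs with hrev
        · rw [sum_log_ratio_scaled c.len c.vert hpp hRf (fun t => (hRb t).mpr (hrev t)) hf hb]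
        · rfl)
    exact weighted_isoperimetric c.len (fun t => u (c.vert t)) _
      (fun t => div_pos (sub_pos.mpr (hlt t)) (add_pos_of_pos_of_nonneg (hwpos t) (hw _ _)))
      (mul_pos hT (cot_pi_div_pos _)) hsum

theorem normSq_sub_eq (a b : ℂ) : Complex.normSq (a - b) =
    Complex.normSq a + Complex.normSq b - 2 * ((starRingEnd ℂ) b * a).re := by
  simp only [Complex.normSq_apply, Complex.mul_re, Complex.conj_re, Complex.conj_im,
    Complex.sub_re, Complex.sub_im]
  ring

theorem energy_identities {n : ℕ} (w : Matrix (Fin n) (Fin n) ℝ)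
    (hbal : ∀ i, ∑ j, w j i = ∑ j, w i j) (p κ : Fin n → ℝ) (hκ : ∀ i, 0 ≤ κ i)
    (lam : ℂ) (u : Fin n → ℂ)
    (heq : ∀ i, ∑ j, (w j i : ℂ) * (u j - u i) = (lam * p i + κ i) * u i) :
    ∑ j, ∑ i, w j i * Complex.normSq (u j - u i) ≤
      2 * (-lam.re * ∑ i, p i * Complex.normSq (u i)) ∧
    ∑ j, ∑ i, w j i * ((starRingEnd ℂ) (u i) * u j).im =
      lam.im * ∑ i, p i * Complex.normSq (u i) := by
  have hi : ∀ i, ∑ j, (w j i : ℂ) * ((starRingEnd ℂ) (u i) * (u j - u i)) =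
      (lam * p i + κ i) * Complex.normSq (u i) := by
    intro i
    rw [Complex.normSq_eq_conj_mul_self, mul_left_comm, ← heq i, mul_sum]
    exact sum_congr rfl fun j _ => by ring
  constructor
  · have hre : ∀ i, ∑ j, w j i * (((starRingEnd ℂ) (u i) * u j).re - Complex.normSq (u i)) =
        (lam.re * p i + κ i) * Complex.normSq (u i) := by
      intro i
      have := congrArg Complex.re (hi i)
      rw [Complex.re_sum] at this
      simp only [Complex.re_ofReal_mul, Complex.re_mul_ofReal, Complex.add_re,
        Complex.ofReal_re, mul_sub, Complex.sub_re, ← Complex.normSq_eq_conj_mul_self] at this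
      simpa only [mul_sub] using this
    have hswap : ∑ j, ∑ i, w j i * Complex.normSq (u j) =
        ∑ j, ∑ i, w j i * Complex.normSq (u i) := by
      rw [sum_comm (f := fun j i => w j i * Complex.normSq (u i))]
      simp_rw [← sum_mul, hbal]
    have h2 : ∑ j, ∑ i, w j i * Complex.normSq (u j - u i) =
        -2 * ∑ i, (lam.re * p i + κ i) * Complex.normSq (u i) := by
      simp_rw [← hre]
      rw [sum_comm (f := fun i j =>
        w j i * (((starRingEnd ℂ) (u i) * u j).re - Complex.normSq (u i)))]
      simp_rw [normSq_sub_eq, mul_sub, mul_add, sum_sub_distrib, sum_add_distrib]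
      rw [hswap]
      simp_rw [mul_left_comm _ (2 : ℝ), ← mul_sum]
      ring
    have h3 : 0 ≤ ∑ i, κ i * Complex.normSq (u i) :=
      sum_nonneg fun i _ => mul_nonneg (hκ i) (Complex.normSq_nonneg _)
    rw [h2]
    simp_rw [add_mul, sum_add_distrib, mul_assoc, ← mul_sum]
    linarith
  · rw [sum_comm, mul_sum]
    refine sum_congr rfl fun i _ => ?_
    have := congrArg Complex.im (hi i)
    rw [Complex.im_sum] at this
    simp only [Complex.im_ofReal_mul, Complex.im_mul_ofReal, Complex.add_im,
      Complex.ofReal_im, mul_sub, Complex.sub_im, ← Complex.normSq_eq_conj_mul_self,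
      zero_mul, sub_zero, add_zero] at this
    rw [this]
    ring

theorem exists_cycle_of_eigenvector_s10 {n : ℕ} (R : Matrix (Fin n) (Fin n) ℝ)
    (hoff : ∀ i j, i ≠ j → 0 ≤ R i j) (hcol : ∀ i, ∑ j, R j i = 0)
    (lam : ℂ) (him : 0 < lam.im) (hre : lam.re < 0)
    (u : Fin n → ℂ) (hu : u ≠ 0) (heig : ∀ i, ∑ j, (R j i : ℂ) * u j = lam * u i) :
    ∃ c : MCycle n R, c.affPos ∧
      lam.im / (-lam.re) ≤ c.tanhAff * Real.cot (Real.pi / (c.len + 3)) := by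
  obtain ⟨C, p, hp, hpC, ⟨i₀, hpi₀, hui₀⟩, heigC, hst⟩ :=
    exists_stationary_restriction R hoff lam u univ
      (by simpa using Function.ne_iff.mp hu) (fun i _ => heig i)
  set w : Matrix (Fin n) (Fin n) ℝ :=
    Matrix.of fun j i => if j ∈ C ∧ j ≠ i then R j i * p i else 0 with hw
  have hw0 : ∀ j i, 0 ≤ w j i := by
    intro j i
    simp only [hw, Matrix.of_apply]
    split_ifs with h
    exacts [mul_nonneg (hoff _ _ h.2) (hp i), le_rfl]
  have hwR : ∀ j i, j ≠ i → p j ≠ 0 → p i ≠ 0 → w j i = R j i * p i := by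
    intro j i hji hj _
    exact if_pos ⟨by_contra fun h => hj (hpC j h), hji⟩
  have hwle : ∀ j i, w j i ≠ 0 → p i ≠ 0 := by
    intro j i h h0
    exact h (by simp [hw, h0])
  have hbal : ∀ i, ∑ j, w j i = ∑ j, w i j := by
    intro i
    by_cases hi : i ∈ C
    · have h1 : ∑ j, w j i = (∑ j ∈ C, if j = i then 0 else R j i) * p i := by
        rw [sum_mul, ← sum_subset (subset_univ C)]
        · refine sum_congr rfl fun j hj => ?_
          by_cases h : j = i <;> simp [hw, hj, h]
        · intro j _ hj
          simp [hw, hj]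
      have h2 : ∑ j, w i j = ∑ j ∈ C, (if i = j then 0 else R i j) * p j := by
        rw [← sum_subset (subset_univ C)]
        · refine sum_congr rfl fun j hj => ?_
          by_cases h : i = j <;> simp [hw, hi, h]
        · intro j _ hj
          simp [hw, hpC j hj]
      rw [h1, h2, hst i hi]
    · simp [hw, hi, hpC i hi]
  have heq : ∀ i, ∑ j, (w j i : ℂ) * (u j - u i) =
      (lam * p i + (∑ j ∈ Cᶜ, if j = i then 0 else R j i * p i : ℝ)) * u i := by
    intro i
    by_cases hi : i ∈ C
    · have h1 : ∑ j, (w j i : ℂ) * (u j - u i) = ∑ j ∈ C, (R j i * p i : ℂ) * (u j - u i) := by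
        rw [← sum_subset (subset_univ C)]
        · refine sum_congr rfl fun j hj => ?_
          by_cases h : j = i <;> simp [hw, hj, h]
        · intro j _ hj
          simp [hw, hj]
      have h2 : (∑ j ∈ Cᶜ, if j = i then 0 else R j i * p i : ℝ) = -∑ j ∈ C, R j i * p i := by
        have h3 : ∑ j ∈ Cᶜ, R j i + ∑ j ∈ C, R j i = 0 := by
          rw [sum_compl_add_sum, hcol]
        rw [← sum_mul, ← neg_mul, ← eq_neg_of_add_eq_zero_left h3, sum_mul]
        refine sum_congr rfl fun j hj => if_neg ?_
        rintro rfl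
        exact mem_compl.mp hj hi
      rw [h1, h2]
      simp_rw [mul_sub, sum_sub_distrib]
      have h4 : ∑ j ∈ C, (R j i * p i : ℂ) * u j = lam * p i * u i := by
        rw [mul_right_comm, ← heigC i hi, sum_mul]
        exact sum_congr rfl fun j _ => by ring
      rw [h4, ← sum_mul]
      push_cast
      ring
    · have hz : ∀ j, w j i = 0 := fun j => by simp [hw, hpC i hi]
      simp [hz, hpC i hi]
  obtain ⟨hE1, hE2⟩ := energy_identities w hbal p
    (fun i => ∑ j ∈ Cᶜ, if j = i then 0 else R j i * p i)
    (fun i => sum_nonneg fun j _ => by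
      split_ifs with h
      exacts [le_rfl, mul_nonneg (hoff _ _ h) (hp i)]) lam u heq
  set M := ∑ i, p i * Complex.normSq (u i) with hM
  have hMpos : 0 < M :=
    sum_pos' (fun i _ => mul_nonneg (hp i) (Complex.normSq_nonneg _))
      ⟨i₀, mem_univ _, mul_pos ((hp i₀).lt_of_ne' hpi₀) (Complex.normSq_pos.mpr hui₀)⟩
  by_contra! hcon
  obtain ⟨k, hk, hk0, hle⟩ := exists_lt_sum_mul_le_of_cycles (netCurrent w)
    (fun j i => le_max_right _ _) (netCurrent_balanced hbal)
    (fun j i h => max_eq_right (sub_nonpos.mpr (netCurrent_pos_iff.mp h).le))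
    (fun j i => Complex.normSq (u j - u i) / ((w j i - w i j) / (w j i + w i j)) *
      if w i j < w j i then 1 else 0)
    (fun j i => 2 * ((starRingEnd ℂ) (u i) * u j).im)
    (fun j i => by
      split_ifs with h
      · rw [mul_one]
        exact div_nonneg (Complex.normSq_nonneg _)
          (div_nonneg (sub_nonneg.mpr h.le) (add_nonneg (hw0 _ _) (hw0 _ _)))
      · rw [mul_zero])
    (K := lam.im / -lam.re) (div_pos him (neg_pos.mpr hre))
    (fun c => by
      obtain ⟨c', hc', hle⟩ := MCycle.exists_of_netCurrent hw0 hp hwR hwle c u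
      refine ⟨_, hcon c' hc', ?_⟩
      simp_rw [if_pos (netCurrent_pos_iff.mp (c.pos _)), mul_one, ← mul_sum]
      exact hle)
  have hG : ∑ j, ∑ i, netCurrent w j i * (Complex.normSq (u j - u i) /
      ((w j i - w i j) / (w j i + w i j)) * if w i j < w j i then 1 else 0) ≤
      2 * (-lam.re * M) := by
    refine le_trans (le_of_eq ?_) ((sum_sum_netCurrent_mul_div_le w hw0
      (fun j i => Complex.normSq (u j - u i)) (fun _ _ => Complex.normSq_nonneg _)
      fun j i => by rw [← Complex.normSq_neg, neg_sub]).trans hE1)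
    refine sum_congr rfl fun j _ => sum_congr rfl fun i _ => ?_
    split_ifs with h
    · rw [mul_one]
    · have : netCurrent w j i = 0 := max_eq_right (by linarith)
      simp [this]
  have hH : ∑ j, ∑ i, netCurrent w j i * (2 * ((starRingEnd ℂ) (u i) * u j).im) =
      2 * (lam.im * M) := by
    rw [sum_sum_netCurrent_mul w _ fun j i => by
      simp only [Complex.mul_im, Complex.conj_re, Complex.conj_im]; ring, ← hE2, mul_sum]
    refine sum_congr rfl fun j _ => ?_
    rw [mul_sum]
    exact sum_congr rfl fun i _ => by ring
  rw [hH] at hle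
  have h1 := hle.trans (mul_le_mul_of_nonneg_left hG hk0)
  rw [lt_div_iff₀ (neg_pos.mpr hre)] at hk
  nlinarith [mul_pos (sub_pos.mpr hk) hMpos]

theorem exists_gershgorin_of_eigenvector {n : ℕ} (R : Matrix (Fin n) (Fin n) ℝ)
    (hoff : ∀ i j, i ≠ j → 0 ≤ R i j) (hcol : ∀ i, ∑ j, R j i = 0)
    (lam : ℂ) (u : Fin n → ℂ) (hu : u ≠ 0)
    (heig : ∀ i, ∑ j, (R j i : ℂ) * u j = lam * u i) :
    ∃ i, ‖lam - R i i‖ ≤ -R i i := by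
  obtain ⟨i₀, hi₀⟩ := Function.ne_iff.mp hu
  obtain ⟨i, -, hi⟩ := exists_max_image univ (fun i => ‖u i‖) ⟨i₀, mem_univ _⟩
  have hpos : 0 < ‖u i‖ := (norm_pos_iff.mpr hi₀).trans_le (hi i₀ (mem_univ _))
  refine ⟨i, le_of_mul_le_mul_right ?_ hpos⟩
  have h1 : (lam - R i i) * u i = ∑ j ∈ univ.erase i, (R j i : ℂ) * u j := by
    rw [sub_mul, ← heig i, ← add_sum_erase _ _ (mem_univ i)]
    ring
  have h2 : -R i i = ∑ j ∈ univ.erase i, R j i := by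
    have := hcol i
    rw [← add_sum_erase _ _ (mem_univ i)] at this
    linarith
  rw [← norm_mul, h1, h2, sum_mul]
  refine (norm_sum_le _ _).trans (sum_le_sum fun j hj => ?_)
  have := hoff j i (ne_of_mem_erase hj)
  rw [norm_mul, Complex.norm_real, Real.norm_of_nonneg this]
  exact mul_le_mul_of_nonneg_left (hi j (mem_univ _)) this

theorem multicyclic_slow_decay
    (n : ℕ) (hn : 3 ≤ n) (R : Matrix (Fin n) (Fin n) ℝ)
    (hoff : ∀ i j, i ≠ j → 0 ≤ R i j) (hcol : ∀ i, ∑ j, R j i = 0)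
    (r : ℝ) (hr : IsGreatest (Set.range fun i => -R i i) r)
    (lam : ℂ) (hlam : lam.im ≠ 0)
    (heig : ∃ v : Fin n → ℂ, v ≠ 0 ∧ R.map Complex.ofReal *ᵥ v = lam • v) :
    (-(2 * r) < lam.re ∧ lam.re < 0) ∧
    ∃ c : MCycle n R, c.affPos ∧
      |lam.im| / (-lam.re) ≤ c.tanhAff * Real.cot (Real.pi / (c.len + 3)) := by
  obtain ⟨u, hu, heig⟩ : ∃ u : Fin n → ℂ, u ≠ 0 ∧ ∀ i, ∑ j, (R j i : ℂ) * u j = lam * u i := by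
    obtain ⟨v, hv, hRv⟩ := heig
    have hdet : (R.map Complex.ofReal - lam • (1 : Matrix (Fin n) (Fin n) ℂ)).det = 0 := by
      refine Matrix.exists_mulVec_eq_zero_iff.mp ⟨v, hv, ?_⟩
      rw [Matrix.sub_mulVec, hRv, Matrix.smul_mulVec, Matrix.one_mulVec, sub_self]
    obtain ⟨u, hu, h⟩ := Matrix.exists_vecMul_eq_zero_iff.mpr hdet
    refine ⟨u, hu, fun i => ?_⟩
    rw [Matrix.vecMul_sub, Matrix.vecMul_smul, Matrix.vecMul_one, sub_eq_zero] at h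
    rw [← smul_eq_mul, ← Pi.smul_apply, ← h]
    simp [Matrix.vecMul, dotProduct, mul_comm]
  have hbounds : -(2 * r) < lam.re ∧ lam.re < 0 := by
    obtain ⟨i, hi⟩ := exists_gershgorin_of_eigenvector R hoff hcol lam u hu heig
    have hri : -R i i ≤ r := hr.2 ⟨i, rfl⟩
    have hsq := pow_le_pow_left₀ (norm_nonneg _) hi 2
    rw [Complex.sq_norm, Complex.normSq_apply] at hsq
    simp only [Complex.sub_re, Complex.sub_im, Complex.ofReal_re, Complex.ofReal_im,
      sub_zero] at hsq
    have him : 0 < lam.im * lam.im := mul_self_pos.mpr hlam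
    have hneg : lam.re * (lam.re - 2 * R i i) < 0 := by nlinarith
    have hRi : 0 ≤ -R i i := (norm_nonneg _).trans hi
    rcases mul_neg_iff.mp hneg with h | h <;> constructor <;> linarith
  refine ⟨hbounds, ?_⟩
  rcases hlam.lt_or_gt with him | him
  · have := exists_cycle_of_eigenvector_s10 R hoff hcol ((starRingEnd ℂ) lam)
      (by simpa using him) (by simpa using hbounds.2) (star u) (by simpa using hu) (fun i => by
        have := congrArg (starRingEnd ℂ) (heig i)
        simpa [map_sum] using this)
    simpa [abs_of_neg him] using this
  · simpa [abs_of_pos him] using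
      exists_cycle_of_eigenvector_s10 R hoff hcol lam him hbounds.2 u hu heig
end

section
/- Let R be a Markov generator on n ≥ 3 states with maximum escape rate r, and let λ be a nonreal eigenvalue of R. Then −2r < Re λ < 0 and there exists a cycle c of R with F_c > 0 such that |Im λ| ≤ tanh(F_c/(2n_c)) · √((−Re λ)(2r + Re λ)). In particular every nonreal eigenvalue lies in the ellipse centered at −r with horizontal semi-axis r and vertical semi-axis r·max_c tanh(F_c/(2n_c)) (the Uhl–Seifert ellipse). -/
open Matrix Finset

/-- `IsWalk E c m i j s` says that there is a walk of `m` edges of `E` from `i` to `j` whose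
total weight with respect to `c` is `s`. -/
def IsWalk {V : Type*} (E : V → V → Prop) (c : V → V → ℝ) (m : ℕ) (i j : V) (s : ℝ) : Prop :=
  ∃ w : ℕ → V, w 0 = i ∧ w m = j ∧ (∀ t < m, E (w t) (w (t + 1))) ∧
    ∑ t ∈ range m, c (w t) (w (t + 1)) = s

namespace IsWalk

variable {V : Type*} {E : V → V → Prop} {c : V → V → ℝ} {m m' : ℕ} {i j k : V} {s s' : ℝ}

theorem refl (E : V → V → Prop) (c : V → V → ℝ) (i : V) : IsWalk E c 0 i i 0 :=
  ⟨fun _ => i, rfl, rfl, by simp, by simp⟩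

theorem snoc (h : IsWalk E c m i j s) (hjk : E j k) : IsWalk E c (m + 1) i k (s + c j k) := by
  obtain ⟨w, h0, hm, hE, hs⟩ := h
  have hw : ∀ t ≤ m, (if t ≤ m then w t else k) = w t := fun t ht => if_pos ht
  refine ⟨fun t => if t ≤ m then w t else k, by simpa using h0, by simp, fun t ht => ?_, ?_⟩
  · rcases Nat.lt_succ_iff_lt_or_eq.1 ht with ht | rfl
    · simpa [ht.le, Nat.succ_le_iff.2 ht] using hE t ht
    · simpa [hm] using hjk
  · rw [sum_range_succ, ← hs]
    congr 1
    · refine sum_congr rfl fun t ht => ?_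
      have ht := mem_range.1 ht
      simp [ht.le, Nat.succ_le_iff.2 ht]
    · simp [hm]

theorem trans (h : IsWalk E c m i j s) (h' : IsWalk E c m' j k s') :
    IsWalk E c (m + m') i k (s + s') := by
  induction m' generalizing k s' with
  | zero =>
    obtain ⟨w, h0, hm, -, hs⟩ := h'
    obtain rfl : j = k := h0.symm.trans hm
    obtain rfl : 0 = s' := by simpa using hs
    simpa using h
  | succ m' ih =>
    obtain ⟨w, h0, hm, hE, hs⟩ := h'
    rw [sum_range_succ] at hs
    have := (ih ⟨w, h0, rfl, fun t ht => hE t (by omega), rfl⟩).snoc (hE m' (by omega))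
    subst hm hs
    rwa [add_assoc s] at this

theorem of_reflTransGen (h : Relation.ReflTransGen E i j) (c : V → V → ℝ) :
    ∃ m s, IsWalk E c m i j s := by
  induction h with
  | refl => exact ⟨0, 0, refl E c i⟩
  | tail _ hE ih =>
    obtain ⟨m, s, h⟩ := ih
    exact ⟨_, _, h.snoc hE⟩

/-- If every simple cycle has nonpositive weight, then so does every closed walk. -/
theorem closed_nonpos
    (hcyc : ∀ m, ∀ w : ℕ → V, 0 < m → w m = w 0 → Set.InjOn w (Set.Iio m) →
      (∀ t < m, E (w t) (w (t + 1))) → ∑ t ∈ range m, c (w t) (w (t + 1)) ≤ 0)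
    (h : IsWalk E c m i i s) : s ≤ 0 := by
  induction m using Nat.strong_induction_on generalizing i s with
  | _ m ih =>
    obtain ⟨w, h0, hm, hE, hs⟩ := h
    rcases Nat.eq_zero_or_pos m with rfl | hpos
    · simp at hs
      exact hs.ge
    by_cases hinj : Set.InjOn w (Set.Iio m)
    · exact hs ▸ hcyc m w hpos (hm.trans h0.symm) hinj hE
    obtain ⟨a, b, hab, hbm, hwab⟩ : ∃ a b, a < b ∧ b < m ∧ w a = w b := by
      simp only [Set.InjOn, not_forall] at hinj
      obtain ⟨a, ha, b, hb, hw, hne⟩ := hinj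
      rcases lt_or_gt_of_ne hne with h | h
      · exact ⟨a, b, h, hb, hw⟩
      · exact ⟨b, a, h, ha, hw.symm⟩
    obtain ⟨d, rfl⟩ := Nat.exists_eq_add_of_lt hab
    obtain ⟨e, rfl⟩ := Nat.exists_eq_add_of_lt hbm
    have hpre : IsWalk E c a i (w a) (∑ t ∈ range a, c (w t) (w (t + 1))) :=
      ⟨w, h0, rfl, fun t ht => hE t (by omega), rfl⟩
    have hmid : IsWalk E c (d + 1) (w a) (w a)
        (∑ t ∈ range (d + 1), c (w (a + t)) (w (a + t + 1))) :=
      ⟨fun t => w (a + t), rfl, by rw [hwab]; rfl, fun t ht => hE _ (by omega), rfl⟩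
    have hsuf : IsWalk E c (e + 1) (w a) i
        (∑ t ∈ range (e + 1), c (w (a + (d + 1) + t)) (w (a + (d + 1) + t + 1))) :=
      ⟨fun t => w (a + (d + 1) + t), hwab.symm, hm, fun t ht => hE _ (by omega), rfl⟩
    have h1 := ih _ (by omega) hmid
    have h2 := ih _ (by omega) (hpre.trans hsuf)
    rw [show a + d + 1 + e + 1 = a + (d + 1) + (e + 1) by ring, sum_range_add,
      sum_range_add] at hs
    linarith

end IsWalk

/-- If closed walks have nonpositive weight, then the edges of a strongly connected component
have a potential dominating the weights. -/
theorem exists_potential {V : Type*} {E : V → V → Prop} {c : V → V → ℝ}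
    (hclosed : ∀ m i s, IsWalk E c m i i s → s ≤ 0) (a : V) :
    ∃ q : V → ℝ, ∀ i j, Relation.ReflTransGen E a i → Relation.ReflTransGen E j a → E i j →
      q i + c i j ≤ q j := by
  refine ⟨fun i => sSup {s | ∃ m, IsWalk E c m a i s}, fun i j hi hj hij => ?_⟩
  have hbdd : BddAbove {s | ∃ m, IsWalk E c m a j s} := by
    obtain ⟨m, s, h⟩ := IsWalk.of_reflTransGen hj c
    refine ⟨-s, ?_⟩
    rintro s' ⟨m', h'⟩
    linarith [hclosed _ _ _ (h'.trans h)]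
  obtain ⟨m, s, h⟩ := IsWalk.of_reflTransGen hi c
  rw [← le_sub_iff_add_le]
  refine csSup_le ⟨s, m, h⟩ ?_
  rintro s' ⟨m', h'⟩
  rw [le_sub_iff_add_le]
  exact le_csSup hbdd ⟨_, h'.snoc hij⟩

/-- Weighted arithmetic-geometric mean inequality for `1` and `t ^ (2 * E / (E - 1))`. -/
theorem mul_sq_le_one_add_rpow {E t : ℝ} (hE : 1 < E) (ht : 0 < t) :
    E * t ^ 2 ≤ 1 + (E - 1) * t ^ (2 * E / (E - 1)) := by
  have h := Real.geom_mean_le_arith_mean2_weighted (w₁ := 1 / E) (w₂ := (E - 1) / E)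
    (p₁ := 1) (p₂ := t ^ (2 * E / (E - 1))) (by positivity)
    (div_nonneg (by linarith) (by linarith)) zero_le_one (by positivity) (by field_simp; ring)
  have hE1 : E - 1 ≠ 0 := by linarith
  have hE0 : E ≠ 0 := by linarith
  rw [Real.one_rpow, one_mul, ← Real.rpow_mul ht.le,
    show 2 * E / (E - 1) * ((E - 1) / E) = (2 : ℕ) by field_simp; norm_num, Real.rpow_natCast] at h
  have := mul_le_mul_of_nonneg_left h (by linarith : 0 ≤ E)
  field_simp at this
  rwa [mul_comm E 2] at this

/-- The pairwise inequality behind the ellipse, with `T` a power of the modulus `t` and `(x, y)` a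
point of the unit circle. -/
theorem polar_pair_nonpos {a b τ t x y : ℝ} (hτ0 : 0 < τ) (hτ1 : τ < 1) (hb : b ≠ 0)
    (hab : a ^ 2 + τ ^ 2 * b ^ 2 = 1) (ht : 0 < t) (hxy : x ^ 2 + y ^ 2 = 1)
    {T : ℝ} (hT : T = t ^ (2 * (a ^ 2 + b ^ 2) / (a ^ 2 + b ^ 2 - 1))) :
    (t * (a * x + b * y) - 1) + (1 + τ) / (1 - τ) * T * ((a * x - b * y) / t - 1) ≤ 0 := by
  set ρ := (1 + τ) / (1 - τ) with hρ
  set E := a ^ 2 + b ^ 2 with hEdef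
  have h1τ : 0 < 1 - τ := by linarith
  have hρ0 : 0 < ρ := by positivity
  have hE : 1 < E := by
    have : 0 < b ^ 2 * (1 - τ ^ 2) := mul_pos (by positivity) (by nlinarith)
    linarith
  have hT0 : 0 < T := hT ▸ Real.rpow_pos_of_pos ht _
  have h1 : E * t ^ 2 ≤ 1 + (E - 1) * T := hT ▸ mul_sq_le_one_add_rpow hE ht
  have h2 : E * (T / t) ^ 2 ≤ T ^ 2 + (E - 1) * T := by
    have h := mul_sq_le_one_add_rpow hE (inv_pos.2 ht)
    rw [Real.inv_rpow ht.le, ← hT] at h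
    have := mul_le_mul_of_nonneg_left h (sq_nonneg T)
    calc E * (T / t) ^ 2 = T ^ 2 * (E * t⁻¹ ^ 2) := by field_simp
      _ ≤ _ := this
      _ = _ := by field_simp
  have hid : 2 * ρ * (1 - (a ^ 2 - b ^ 2)) = (1 + ρ ^ 2) * (E - 1) := by
    rw [hρ, hEdef, show a ^ 2 = 1 - τ ^ 2 * b ^ 2 by linarith]
    field_simp
    ring
  have hq : t * (T / t) = T := by field_simp
  set q := T / t with hqdef
  have hsq : (a * (t + ρ * q)) ^ 2 + (b * (t - ρ * q)) ^ 2 ≤ (1 + ρ * T) ^ 2 := by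
    have h3 := mul_le_mul_of_nonneg_left h2 (sq_nonneg ρ)
    have : (a * (t + ρ * q)) ^ 2 + (b * (t - ρ * q)) ^ 2
        = E * t ^ 2 + ρ ^ 2 * (E * q ^ 2) + 2 * ρ * (a ^ 2 - b ^ 2) * (t * q) := by
      rw [hEdef]; ring
    rw [this, hq]
    linear_combination h1 + h3 - T * hid
  have hlin : x * (a * (t + ρ * q)) + y * (b * (t - ρ * q)) ≤ 1 + ρ * T := by
    refine abs_le_of_sq_le_sq' ?_ (by positivity) |>.2
    refine le_trans ?_ hsq
    nlinarith [sq_nonneg (x * (b * (t - ρ * q)) - y * (a * (t + ρ * q)))]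
  have : (t * (a * x + b * y) - 1) + ρ * T * ((a * x - b * y) / t - 1)
      = x * (a * (t + ρ * q)) + y * (b * (t - ρ * q)) - (1 + ρ * T) := by
    rw [hqdef]; field_simp; ring
  linarith

/-- `z ↦ a * Re z + b * Im z`. -/
def realFunctional (a b : ℝ) (z : ℂ) : ℝ := a * z.re + b * z.im

theorem norm_rpow_pair_nonpos {a b τ : ℝ} (hτ0 : 0 < τ) (hτ1 : τ < 1) (hb : b ≠ 0)
    (hab : a ^ 2 + τ ^ 2 * b ^ 2 = 1) {u v : ℂ} (hu : u ≠ 0) (hv : v ≠ 0)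
    {K : ℝ} (hK : K = 2 * (a ^ 2 + b ^ 2) / (a ^ 2 + b ^ 2 - 1)) :
    ‖u‖ ^ K * (realFunctional a b (v / u) - 1)
      + (1 + τ) / (1 - τ) * (‖v‖ ^ K * (realFunctional a b (u / v) - 1)) ≤ 0 := by
  have hu' : 0 < ‖u‖ := norm_pos_iff.2 hu
  have hv' : 0 < ‖v‖ := norm_pos_iff.2 hv
  set z := v / u with hz
  have hz0 : z ≠ 0 := div_ne_zero hv hu
  have ht : 0 < ‖z‖ := norm_pos_iff.2 hz0
  have hsq : z.re ^ 2 + z.im ^ 2 = ‖z‖ ^ 2 := by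
    rw [← Complex.normSq_eq_norm_sq, Complex.normSq_apply]; ring
  have hinv : u / v = z⁻¹ := by rw [hz, inv_div]
  have key := polar_pair_nonpos (x := z.re / ‖z‖) (y := z.im / ‖z‖) hτ0 hτ1 hb hab ht
    (by rw [div_pow, div_pow, ← add_div, hsq, div_self (by positivity)]) rfl
  rw [← hK] at key
  have hpow : ‖v‖ ^ K = ‖u‖ ^ K * ‖z‖ ^ K := by
    rw [← Real.mul_rpow hu'.le ht.le, ← norm_mul, hz, mul_div_cancel₀ _ hu]
  have h1 : realFunctional a b z = ‖z‖ * (a * (z.re / ‖z‖) + b * (z.im / ‖z‖)) := by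
    unfold realFunctional; field_simp
  have h2 : realFunctional a b (u / v) = (a * (z.re / ‖z‖) - b * (z.im / ‖z‖)) / ‖z‖ := by
    unfold realFunctional
    rw [hinv, Complex.inv_re, Complex.inv_im, Complex.normSq_eq_norm_sq]
    field_simp
    ring
  rw [h1, h2, hpow]
  have := mul_nonpos_of_nonneg_of_nonpos (Real.rpow_nonneg hu'.le K) key
  linarith

theorem weighted_pair_nonpos {a b τ : ℝ} (hτ0 : 0 < τ) (hτ1 : τ < 1) (hb : b ≠ 0)
    (hab : a ^ 2 + τ ^ 2 * b ^ 2 = 1) {u v : ℂ} (hu : u ≠ 0) (hv : v ≠ 0)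
    {K : ℝ} (hK : K = 2 * (a ^ 2 + b ^ 2) / (a ^ 2 + b ^ 2 - 1)) {G H : ℝ}
    (hGH : G ≤ (1 + τ) / (1 - τ) * H) (hHG : H ≤ (1 + τ) / (1 - τ) * G) :
    G * (‖u‖ ^ K * (realFunctional a b (v / u) - 1))
      + H * (‖v‖ ^ K * (realFunctional a b (u / v) - 1)) ≤ 0 := by
  have h1 := norm_rpow_pair_nonpos hτ0 hτ1 hb hab hu hv hK
  have h2 := norm_rpow_pair_nonpos hτ0 hτ1 hb hab hv hu hK
  have hρ : 1 < (1 + τ) / (1 - τ) := by rw [one_lt_div] <;> linarith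
  generalize (1 + τ) / (1 - τ) = ρ at *
  generalize ‖u‖ ^ K * (realFunctional a b (v / u) - 1) = A at *
  generalize ‖v‖ ^ K * (realFunctional a b (u / v) - 1) = B at *
  have h3 := mul_nonpos_of_nonneg_of_nonpos (sub_nonneg.2 hGH) h1
  have h4 := mul_nonpos_of_nonneg_of_nonpos (sub_nonneg.2 hHG) h2
  have h5 : 0 < ρ ^ 2 - 1 := by nlinarith
  refine nonpos_of_mul_nonpos_right (a := ρ ^ 2 - 1) ?_ h5
  linarith

namespace MCycle

variable {n : ℕ} {R : Matrix (Fin n) (Fin n) ℝ}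

/-- A closed simple walk of length at least three is an `MCycle`. -/
theorem exists_of_closed_walk {m : ℕ} (hm : 3 ≤ m) (w : ℕ → Fin n) (hw : w m = w 0)
    (hinj : Set.InjOn w (Set.Iio m)) (hpos : ∀ t < m, 0 < R (w (t + 1)) (w t)) :
    ∃ c : MCycle n R, c.len + 3 = m ∧
      (∀ f : Fin n → Fin n → ℝ,
        ∑ t, f (c.vert t) (c.vert (t + 1)) = ∑ t ∈ range m, f (w t) (w (t + 1))) ∧
      ∀ P : Fin n → Fin n → Prop, (∀ t, P (c.vert t) (c.vert (t + 1))) →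
        ∀ t < m, P (w t) (w (t + 1)) := by
  obtain ⟨l, rfl⟩ := Nat.exists_eq_add_of_le' hm
  have hsucc : ∀ t : ZMod (l + 3), w (t + 1).val = w (t.val + 1) := by
    intro t
    rw [ZMod.val_add, ZMod.val_one'' (by omega)]
    rcases Nat.lt_or_ge (t.val + 1) (l + 3) with h | h
    · rw [Nat.mod_eq_of_lt h]
    · have : t.val + 1 = l + 3 := le_antisymm (ZMod.val_lt t) h
      rw [this, Nat.mod_self, hw]
  refine ⟨⟨l, fun t => w t.val, fun s t hst => ZMod.val_injective _
    (hinj (ZMod.val_lt s) (ZMod.val_lt t) hst), fun t => ?_⟩, rfl, fun f => ?_, fun P hP t ht => ?_⟩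
  · rw [hsucc]
    exact hpos _ (ZMod.val_lt t)
  · simp only [hsucc]
    exact Fin.sum_univ_eq_sum_range (fun t => f (w t) (w (t + 1))) (l + 3)
  · have := hP (t : ZMod (l + 3))
    simp only [hsucc] at this
    rwa [ZMod.val_natCast_of_lt ht] at this

theorem tanhAff_of_pos (c : MCycle n R) (h : ∀ t, 0 < R (c.vert t) (c.vert (t + 1))) :
    c.tanhAff = Real.tanh ((∑ t : ZMod (c.len + 3),
        Real.log (R (c.vert (t + 1)) (c.vert t) / R (c.vert t) (c.vert (t + 1)))) /
      (2 * (c.len + 3))) :=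
  if_pos h

theorem tanhAff_of_not_pos (c : MCycle n R)
    (h : ¬ ∀ t, 0 < R (c.vert t) (c.vert (t + 1))) : c.tanhAff = 1 :=
  if_neg h

instance : Finite (MCycle n R) := by
  have hlen : ∀ c : MCycle n R, c.len < n := fun c => by
    have := Fintype.card_le_of_injective c.vert c.inj
    rw [ZMod.card, Fintype.card_fin] at this
    omega
  refine Finite.of_injective
    (β := Σ l : Fin n, (ZMod (l.val + 3) → Fin n)) (fun c => ⟨⟨c.len, hlen c⟩, c.vert⟩) ?_
  rintro ⟨l, v, _, _⟩ ⟨l', v', _, _⟩ h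
  simp only [Sigma.mk.injEq, Fin.mk.injEq] at h
  obtain ⟨rfl, h⟩ := h
  simpa using h

end MCycle

section Gauge

variable {n : ℕ} {R : Matrix (Fin n) (Fin n) ℝ} {τ : ℝ}

/-- The transition graph of `R`. -/
def Transition (R : Matrix (Fin n) (Fin n) ℝ) (i j : Fin n) : Prop := i ≠ j ∧ 0 < R j i

theorem reverse_rate_pos_of_simple (hτ1 : τ < 1)
    (hcyc : ∀ c : MCycle n R, c.affPos → c.tanhAff ≤ τ) {m : ℕ} {w : ℕ → Fin n} (hm : 0 < m)
    (hw : w m = w 0) (hinj : Set.InjOn w (Set.Iio m))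
    (hE : ∀ t < m, Transition R (w t) (w (t + 1))) : ∀ t < m, 0 < R (w t) (w (t + 1)) := by
  obtain rfl | rfl | hm3 : m = 1 ∨ m = 2 ∨ 3 ≤ m := by omega
  · exact absurd hw.symm (hE 0 one_pos).1
  · intro t ht
    obtain rfl | rfl : t = 0 ∨ t = 1 := by omega
    · exact hw ▸ (hE 1 (by omega)).2
    · have := (hE 0 (by omega)).2
      rwa [← hw] at this
  · obtain ⟨c, -, -, hP⟩ := MCycle.exists_of_closed_walk hm3 w hw hinj fun t ht => (hE t ht).2
    refine hP (fun i j => 0 < R i j) ?_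
    by_contra hneg
    have := hcyc c fun h => absurd h hneg
    rw [c.tanhAff_of_not_pos hneg] at this
    linarith

theorem affinity_le_of_simple (hτ0 : 0 < τ) (hτ1 : τ < 1)
    (hcyc : ∀ c : MCycle n R, c.affPos → c.tanhAff ≤ τ) {m : ℕ} {w : ℕ → Fin n} (hm : 0 < m)
    (hw : w m = w 0) (hinj : Set.InjOn w (Set.Iio m))
    (hE : ∀ t < m, Transition R (w t) (w (t + 1))) :
    ∑ t ∈ range m, (Real.log (R (w (t + 1)) (w t) / R (w t) (w (t + 1)))
      - 2 * Real.artanh τ) ≤ 0 := by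
  have hL : 0 < Real.artanh τ := Real.artanh_pos ⟨hτ0, hτ1⟩
  obtain rfl | rfl | hm3 : m = 1 ∨ m = 2 ∨ 3 ≤ m := by omega
  · exact absurd hw.symm (hE 0 one_pos).1
  · simp only [sum_range_succ, range_zero, sum_empty, zero_add, Nat.reduceAdd, hw]
    rw [← inv_div (R (w 1) (w 0)), Real.log_inv]
    linarith
  · have hrev := reverse_rate_pos_of_simple hτ1 hcyc hm hw hinj hE
    obtain ⟨c, hlen, hsum, -⟩ :=
      MCycle.exists_of_closed_walk hm3 w hw hinj fun t ht => (hE t ht).2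
    have hF := hsum fun i j => Real.log (R j i / R i j)
    rw [sum_sub_distrib, ← hF, sum_const, card_range, nsmul_eq_mul, ← hlen]
    rcases le_or_gt (∑ t, Real.log (R (c.vert (t + 1)) (c.vert t) /
      R (c.vert t) (c.vert (t + 1)))) 0 with h | h
    · have : 0 ≤ ((c.len + 3 : ℕ) : ℝ) * (2 * Real.artanh τ) := by positivity
      linarith
    · have hc := hcyc c fun _ => h
      have hpos : ∀ t, 0 < R (c.vert t) (c.vert (t + 1)) := by
        by_contra hneg
        rw [c.tanhAff_of_not_pos hneg] at hc
        linarith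
      rw [c.tanhAff_of_pos hpos] at hc
      have := Real.artanh_le_artanh (Real.neg_one_lt_tanh _) hτ1 hc
      rw [Real.artanh_tanh, div_le_iff₀ (by positivity)] at this
      push_cast
      linarith

/-- If all cycle affinities are bounded, then on each strongly connected component the rates can be
rescaled so that each rate is bounded in terms of its reverse. -/
theorem exists_gauge (hoff : ∀ i j, i ≠ j → 0 ≤ R i j) (hτ0 : 0 < τ) (hτ1 : τ < 1)
    (hcyc : ∀ c : MCycle n R, c.affPos → c.tanhAff ≤ τ) (a : Fin n) :
    ∃ p : Fin n → ℝ, (∀ i, 0 < p i) ∧ ∀ i j,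
      Relation.ReflTransGen (Transition R) a i → Relation.ReflTransGen (Transition R) j a →
      i ≠ j → p i * R j i ≤ (1 + τ) / (1 - τ) * (p j * R i j) := by
  classical
  have hρ : Real.exp (2 * Real.artanh τ) = (1 + τ) / (1 - τ) := by
    rw [two_mul, Real.exp_add, Real.exp_artanh ⟨by linarith, hτ1⟩]
    exact Real.mul_self_sqrt (div_nonneg (by linarith) (by linarith))
  have hrev : ∀ i j, Transition R i j → Relation.ReflTransGen (Transition R) j i → 0 < R i j := by
    intro i j hij hji
    by_contra hneg
    let c : Fin n → Fin n → ℝ := fun i j => if 0 < R i j then 0 else 1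
    have hc : ∀ i j, 0 ≤ c i j := fun i j => by simp only [c]; split_ifs <;> norm_num
    obtain ⟨m, s, hwalk⟩ := IsWalk.of_reflTransGen hji c
    have hs : 0 ≤ s := by
      obtain ⟨w, -, -, -, rfl⟩ := hwalk
      exact sum_nonneg fun _ _ => hc _ _
    have := IsWalk.closed_nonpos (fun m w hm hw hinj hE => by
      have h := reverse_rate_pos_of_simple hτ1 hcyc hm hw hinj hE
      refine (sum_eq_zero fun t ht => ?_).le
      exact if_pos (h t (mem_range.1 ht))) (hwalk.snoc hij)
    have h1 : c i j = 1 := if_neg hneg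
    linarith
  obtain ⟨q, hq⟩ := exists_potential (E := Transition R)
    (c := fun i j => Real.log (R j i / R i j) - 2 * Real.artanh τ)
    (fun m i s h => IsWalk.closed_nonpos
      (fun m w hm hw hinj hE => affinity_le_of_simple hτ0 hτ1 hcyc hm hw hinj hE) h) a
  refine ⟨fun i => Real.exp (q i), fun i => Real.exp_pos _, fun i j hi hj hne => ?_⟩
  rcases (hoff j i hne.symm).eq_or_lt with h0 | hlt
  · rw [← h0, mul_zero]
    exact mul_nonneg (div_nonneg (by linarith) (by linarith))
      (mul_nonneg (Real.exp_pos _).le (hoff i j hne))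
  · have hR := hrev i j ⟨hne, hlt⟩ (hj.trans hi)
    have h : q i + Real.log (R j i / R i j) ≤ q j + 2 * Real.artanh τ := by
      linarith [hq i j hi hj ⟨hne, hlt⟩]
    rw [← Real.exp_le_exp] at h
    rw [Real.exp_add, Real.exp_add, Real.exp_log (div_pos hlt hR), hρ, ← mul_div_assoc,
      div_le_iff₀ hR] at h
    linarith

end Gauge

theorem exists_returning {V : Type*} [Finite V] (E : V → V → Prop) (P : V → Prop)
    (hP : ∃ i, P i) : ∃ a, P a ∧ ∀ j, P j → Relation.ReflTransGen E a j →
      Relation.ReflTransGen E j a := by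
  obtain ⟨a, ha, hmin⟩ := Set.exists_min_image {i | P i}
    (fun i => {j | Relation.ReflTransGen E i j}.ncard) (Set.toFinite _) hP
  refine ⟨a, ha, fun j hj haj => ?_⟩
  have hsub : {k | Relation.ReflTransGen E j k} ⊆ {k | Relation.ReflTransGen E a k} :=
    fun k hk => haj.trans hk
  have heq := Set.eq_of_subset_of_ncard_le hsub (hmin j hj) (Set.toFinite _)
  exact heq.symm.subset (Relation.ReflTransGen.refl : Relation.ReflTransGen E a a)

section Eigenvector

variable {n : ℕ} {R : Matrix (Fin n) (Fin n) ℝ} {lam : ℂ} {u : Fin n → ℂ}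

theorem sum_realFunctional_ratio (hcol : ∀ i, ∑ j, R j i = 0)
    (hu : ∀ i, ∑ j, (R j i : ℂ) * u j = lam * u i) (a b : ℝ) {i : Fin n} (hi : u i ≠ 0) :
    ∑ j, R j i * (realFunctional a b (u j / u i) - 1) = realFunctional a b lam := by
  have h : lam = ∑ j, (R j i : ℂ) * (u j / u i) := by
    simp only [← mul_div_assoc, ← sum_div, hu i, mul_div_cancel_right₀ _ hi]
  simp only [mul_sub, mul_one, sum_sub_distrib, hcol, sub_zero]
  conv_rhs => rw [h]
  simp only [realFunctional, Complex.re_sum, Complex.im_sum, Complex.re_ofReal_mul,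
    Complex.im_ofReal_mul, mul_sum, ← sum_add_distrib]
  exact sum_congr rfl fun j _ => by ring

/-- When every cycle affinity is bounded, all eigenvalues lie on one side of each nonvertical
supporting line of the ellipse. -/
theorem realFunctional_le (hoff : ∀ i j, i ≠ j → 0 ≤ R i j) (hcol : ∀ i, ∑ j, R j i = 0)
    {r : ℝ} (hr : ∀ i, -R i i ≤ r) (hu0 : u ≠ 0)
    (hu : ∀ i, ∑ j, (R j i : ℂ) * u j = lam * u i) {τ : ℝ} (hτ0 : 0 < τ) (hτ1 : τ < 1)
    (hcyc : ∀ c : MCycle n R, c.affPos → c.tanhAff ≤ τ) {a b : ℝ} (hb : b ≠ 0)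
    (hab : a ^ 2 + τ ^ 2 * b ^ 2 = 1) : realFunctional a b lam ≤ r * (1 - a) := by
  classical
  by_contra! hlt
  have ha : a ≤ 1 := by nlinarith [sq_nonneg (τ * b)]
  obtain ⟨o, ho, hret⟩ := exists_returning (Transition R) (fun i => u i ≠ 0)
    (Function.ne_iff.1 hu0)
  obtain ⟨p, hp, hgauge⟩ := exists_gauge hoff hτ0 hτ1 hcyc o
  set K := 2 * (a ^ 2 + b ^ 2) / (a ^ 2 + b ^ 2 - 1) with hK
  let C := univ.filter fun i => u i ≠ 0 ∧ Relation.ReflTransGen (Transition R) o i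
  have hC : ∀ i, i ∈ C ↔ u i ≠ 0 ∧ Relation.ReflTransGen (Transition R) o i := by simp [C]
  let g : Fin n → Fin n → ℝ := fun i j =>
    if j = i then 0 else R j i * (realFunctional a b (u j / u i) - 1)
  have hrow : ∀ i ∈ C, 0 < ∑ j ∈ C, g i j := by
    intro i hi
    obtain ⟨hui, hoi⟩ := (hC i).1 hi
    have h := sum_realFunctional_ratio hcol hu a b hui
    have hdiag : R i i * (realFunctional a b (u i / u i) - 1) ≤ r * (1 - a) := by
      rw [div_self hui]
      simp only [realFunctional, Complex.one_re, Complex.one_im]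
      nlinarith [hr i]
    have hall : ∑ j, R j i * (realFunctional a b (u j / u i) - 1)
        = R i i * (realFunctional a b (u i / u i) - 1) + ∑ j, g i j := by
      rw [← add_sum_erase _ _ (mem_univ i), ← add_sum_erase univ (g i) (mem_univ i)]
      simp only [g, if_true, zero_add]
      congr 1
      exact sum_congr rfl fun j hj => (if_neg (ne_of_mem_erase hj)).symm
    have hsub : ∑ j, g i j ≤ ∑ j ∈ C, g i j := by
      rw [← sum_add_sum_compl C]
      have : ∑ j ∈ Cᶜ, g i j ≤ 0 := by
        refine sum_nonpos fun j hj => ?_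
        have hjC : j ∉ C := mem_compl.1 hj
        have hne : j ≠ i := fun h => hjC (h ▸ hi)
        simp only [g, if_neg hne]
        rcases (hoff j i hne).eq_or_lt with h0 | hpos
        · rw [← h0, zero_mul]
        · have huj : u j = 0 := by
            by_contra huj
            exact hjC ((hC j).2 ⟨huj, hoi.tail ⟨hne.symm, hpos⟩⟩)
          simp only [huj, zero_div, realFunctional, Complex.zero_re, Complex.zero_im]
          linarith
      linarith
    linarith
  let T : Fin n → Fin n → ℝ := fun i j => p i * ‖u i‖ ^ K * g i j
  have hpos : 0 < ∑ i ∈ C, ∑ j ∈ C, T i j := by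
    refine sum_pos (fun i hi => ?_) ⟨o, (hC o).2 ⟨ho, .refl⟩⟩
    simp only [T, ← mul_sum]
    have : 0 < ‖u i‖ := norm_pos_iff.2 ((hC i).1 hi).1
    exact mul_pos (mul_pos (hp i) (Real.rpow_pos_of_pos this K)) (hrow i hi)
  have hpair : ∀ i ∈ C, ∀ j ∈ C, T i j + T j i ≤ 0 := by
    intro i hi j hj
    obtain ⟨hui, hoi⟩ := (hC i).1 hi
    obtain ⟨huj, hoj⟩ := (hC j).1 hj
    rcases eq_or_ne i j with rfl | hne
    · simp [T, g]
    · have := weighted_pair_nonpos hτ0 hτ1 hb hab hui huj hK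
        (hgauge i j hoi (hret j huj hoj) hne) (hgauge j i hoj (hret i hui hoi) hne.symm)
      simp only [T, g, if_neg hne, if_neg hne.symm]
      linarith
  have hswap : ∑ i ∈ C, ∑ j ∈ C, (T i j + T j i) = 2 * ∑ i ∈ C, ∑ j ∈ C, T i j := by
    simp only [sum_add_distrib]
    rw [sum_comm (f := fun i j => T j i)]
    ring
  have := sum_nonpos fun i hi => sum_nonpos (hpair i hi)
  linarith

/-- The ellipse bound when every cycle affinity is bounded. -/
theorem im_sq_le (hoff : ∀ i j, i ≠ j → 0 ≤ R i j) (hcol : ∀ i, ∑ j, R j i = 0)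
    {r : ℝ} (hr : ∀ i, -R i i ≤ r) (hlam : lam.im ≠ 0) (hu0 : u ≠ 0)
    (hu : ∀ i, ∑ j, (R j i : ℂ) * u j = lam * u i) {τ : ℝ} (hτ0 : 0 < τ) (hτ1 : τ < 1)
    (hcyc : ∀ c : MCycle n R, c.affPos → c.tanhAff ≤ τ) :
    lam.im ^ 2 ≤ τ ^ 2 * (-lam.re * (2 * r + lam.re)) := by
  set x := lam.re + r with hx
  set y := lam.im / τ with hy
  have hy0 : y ≠ 0 := div_ne_zero hlam hτ0.ne'
  have hyτ : lam.im = τ * y := by rw [hy]; field_simp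
  set N := √(x ^ 2 + y ^ 2) with hN
  have hN0 : 0 < N := Real.sqrt_pos.2 (by positivity)
  have hNsq : N ^ 2 = x ^ 2 + y ^ 2 := Real.sq_sqrt (by positivity)
  have h := realFunctional_le hoff hcol hr hu0 hu hτ0 hτ1 hcyc (a := x / N) (b := y / (τ * N))
    (div_ne_zero hy0 (by positivity)) (by field_simp; linarith)
  have hle : N ≤ r := by
    have heq : realFunctional (x / N) (y / (τ * N)) lam - r * (1 - x / N) = N - r := by
      rw [realFunctional, hyτ, show lam.re = x - r by rw [hx]; ring]
      field_simp
      linarith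
    linarith
  have : N ^ 2 ≤ r ^ 2 := by gcongr
  have h3 : y ^ 2 ≤ -lam.re * (2 * r + lam.re) := by rw [hNsq, hx] at this; linarith
  rw [hyτ, mul_pow]
  gcongr

theorem exists_left_eigenvector
    (h : ∃ v : Fin n → ℂ, v ≠ 0 ∧ R.map Complex.ofReal *ᵥ v = lam • v) :
    ∃ u : Fin n → ℂ, u ≠ 0 ∧ (R.map Complex.ofReal)ᵀ *ᵥ u = lam • u := by
  obtain ⟨v, hv, hRv⟩ := h
  have hdet : (R.map Complex.ofReal - lam • (1 : Matrix (Fin n) (Fin n) ℂ)).det = 0 :=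
    exists_mulVec_eq_zero_iff.1 ⟨v, hv, by
      rw [sub_mulVec, smul_mulVec, one_mulVec, hRv, sub_self]⟩
  obtain ⟨u, hu, hRu⟩ := exists_vecMul_eq_zero_iff.2 hdet
  refine ⟨u, hu, ?_⟩
  rw [mulVec_transpose]
  rwa [vecMul_sub, vecMul_smul, vecMul_one, sub_eq_zero] at hRu

theorem norm_add_escape_le (hoff : ∀ i j, i ≠ j → 0 ≤ R i j) (hcol : ∀ i, ∑ j, R j i = 0)
    {r : ℝ} (hr : ∀ i, -R i i ≤ r) (hu0 : u ≠ 0)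
    (hu : (R.map Complex.ofReal)ᵀ *ᵥ u = lam • u) : ‖lam + r‖ ≤ r := by
  obtain ⟨k, hk⟩ := eigenvalue_mem_ball (A := (R.map Complex.ofReal)ᵀ) (μ := lam)
    (Module.End.hasEigenvalue_of_hasEigenvector
      (Module.End.hasEigenvector_iff.2 ⟨Module.End.mem_eigenspace_iff.2 (by simpa using hu), hu0⟩))
  have hsum : ∑ j ∈ univ.erase k, ‖(R.map Complex.ofReal)ᵀ k j‖ = -R k k := by
    rw [eq_neg_iff_add_eq_zero, add_comm, ← hcol k, ← add_sum_erase _ _ (mem_univ k)]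
    congr 1
    exact sum_congr rfl fun j hj => by
      simp [abs_of_nonneg (hoff j k (ne_of_mem_erase hj))]
  rw [mem_closedBall_iff_norm, hsum] at hk
  have h2 : ‖((r + R k k : ℝ) : ℂ)‖ = r + R k k := by
    rw [Complex.norm_real, Real.norm_of_nonneg (by linarith [hr k])]
  calc ‖lam + r‖ = ‖(lam - (R k k : ℂ)) + ((r + R k k : ℝ) : ℂ)‖ := by
        congr 1; push_cast; ring
    _ ≤ -R k k + (r + R k k) := (norm_add_le _ _).trans (add_le_add hk h2.le)
    _ = r := by ring

end Eigenvector

theorem multicyclic_uhl_seifert_ellipse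
    (n : ℕ) (hn : 3 ≤ n) (R : Matrix (Fin n) (Fin n) ℝ)
    (hoff : ∀ i j, i ≠ j → 0 ≤ R i j) (hcol : ∀ i, ∑ j, R j i = 0)
    (r : ℝ) (hr : IsGreatest (Set.range fun i => -R i i) r)
    (lam : ℂ) (hlam : lam.im ≠ 0)
    (heig : ∃ v : Fin n → ℂ, v ≠ 0 ∧ R.map Complex.ofReal *ᵥ v = lam • v) :
    (-(2 * r) < lam.re ∧ lam.re < 0) ∧
    ∃ c : MCycle n R, c.affPos ∧
      |lam.im| ≤ c.tanhAff * Real.sqrt ((-lam.re) * (2 * r + lam.re)) := by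
  obtain ⟨u, hu0, hu⟩ := exists_left_eigenvector heig
  have hrle : ∀ i, -R i i ≤ r := fun i => hr.2 ⟨i, rfl⟩
  have hball := norm_add_escape_le hoff hcol hrle hu0 hu
  have hr0 : 0 ≤ r := (norm_nonneg _).trans hball
  have hsq : (lam.re + r) ^ 2 + lam.im ^ 2 ≤ r ^ 2 := by
    have h : ‖lam + r‖ ^ 2 ≤ r ^ 2 := by gcongr
    rw [← Complex.normSq_eq_norm_sq, Complex.normSq_apply] at h
    simp only [Complex.add_re, Complex.ofReal_re, Complex.add_im, Complex.ofReal_im,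
      add_zero] at h
    linarith
  have him : 0 < lam.im ^ 2 := by positivity
  have hre : |lam.re + r| < r := abs_lt_of_sq_lt_sq (by linarith) hr0
  rw [abs_lt] at hre
  refine ⟨⟨by linarith, by linarith⟩, ?_⟩
  set D := √(-lam.re * (2 * r + lam.re)) with hD
  have hDsq : D ^ 2 = -lam.re * (2 * r + lam.re) :=
    Real.sq_sqrt (mul_nonneg (by linarith) (by linarith))
  have hD0 : 0 < D := Real.sqrt_pos.2 (mul_pos (by linarith) (by linarith))
  have hle : |lam.im| ≤ D := abs_le_of_sq_le_sq (by linarith) hD0.le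
  by_contra! hcon
  have habs : 0 < |lam.im| := abs_pos.2 hlam
  have hev : ∀ᶠ τ in nhdsWithin (|lam.im| / D) (Set.Iio (|lam.im| / D)),
      ∀ c : MCycle n R, c.affPos → c.tanhAff ≤ τ := by
    refine Filter.eventually_all.2 fun c => ?_
    by_cases hc : c.affPos
    · filter_upwards [mem_nhdsWithin_of_mem_nhds
        (lt_mem_nhds ((lt_div_iff₀ hD0).2 (hcon c hc)))] with τ hτ _ using hτ.le
    · exact Filter.Eventually.of_forall fun τ h => absurd h hc
  obtain ⟨τ, ⟨hcyc, hτ0⟩, hτ⟩ := ((hev.and (mem_nhdsWithin_of_mem_nhds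
    (lt_mem_nhds (div_pos habs hD0)))).and self_mem_nhdsWithin).exists
  have hτ1 : τ < 1 := lt_of_lt_of_le hτ ((div_le_one hD0).2 hle)
  have h := im_sq_le hoff hcol hrle hlam hu0
    (fun i => by simpa [mulVec, dotProduct] using congrFun hu i) hτ0 hτ1 hcyc
  rw [← hDsq, ← mul_pow] at h
  have h1 := abs_le_of_sq_le_sq h (by positivity)
  have h2 := (lt_div_iff₀ hD0).1 hτ
  linarith
end
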